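/- Let b, c ≥ 2 be integers such that ln(b)/ln(c) is irrational. Then there exists a real constant d such that for every integer n > 25, s_b(n) + s_c(n) > (ln ln n)/(ln ln ln n + d) − 1. -/

import Mathlib

/-- The state reached after feeding the base-`k` digits of `n`
(most significant digit first, empty string for `n = 0`) into the
transition function `ρ` starting from state `q₀`. -/
def autoRun {Q : Type} (k : ℕ) (ρ : Q → Fin k → Q) (q₀ : Q) (n : ℕ) : Q :=
  (Nat.digits k n).reverse.foldl (fun q d => if h : d < k then ρ q ⟨d, h⟩ else q) q₀

/-- A sequence `a : ℕ → Δ` is `k`-automatic: some DFAO over the alphabet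
`{0, …, k-1}` computes `a n` from the base-`k` digits of `n`
(most significant digit first). -/
def IsAutomatic {Δ : Type*} (k : ℕ) (a : ℕ → Δ) : Prop :=
  ∃ (Q : Type) (_ : Finite Q) (ρ : Q → Fin k → Q) (q₀ : Q) (τ : Q → Δ),
    ∀ n : ℕ, a n = τ (autoRun k ρ q₀ n)

/-- `lnz b n` is the last nonzero digit of `n` in base `b`:
`(n / b ^ v_b(n)) % b`, where `v_b(n) = padicValNat b n` is the largest `t`
with `b ^ t ∣ n`. -/
def lnz (b n : ℕ) : ℕ := (n / b ^ padicValNat b n) % b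

/-- `digSum b n` is the sum of the digits of `n` written in base `b`. -/
def digSum (b n : ℕ) : ℕ := (Nat.digits b n).sum


open Polynomial in
/-- weighted divisibility of a determinant -/
lemma det_weight_dvd {R : Type*} [CommRing R] {N : ℕ} (M : Matrix (Fin N) (Fin N) R) (y : R)
    (cw : Fin N → ℕ) (hM : ∀ (i j : Fin N), y ^ (cw j - (i : ℕ)) ∣ M i j) (w : ℕ)
    (hw : ∃ g : ℕ → ℕ, (∀ a b, g a - g b ≤ a - b) ∧
      w + ∑ i : Fin N, g i ≤ ∑ j : Fin N, g (cw j)) :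
    y ^ w ∣ M.det := by
  obtain ⟨g, hg, hsum⟩ := hw
  rw [Matrix.det_apply]
  refine Finset.dvd_sum fun σ _ => ?_
  rw [Units.smul_def, zsmul_eq_mul]
  refine Dvd.dvd.mul_left ?_ _
  · refine Dvd.dvd.trans ?_ (Finset.prod_dvd_prod_of_dvd _ _ fun i _ => hM (σ i) i)
    rw [Finset.prod_pow_eq_pow_sum]
    refine pow_dvd_pow _ ?_
    have h1 : ∑ i : Fin N, g i = ∑ i : Fin N, g (σ i) :=
      (Equiv.sum_comp σ (fun i : Fin N => g i)).symm
    have h2 : ∑ j : Fin N, g (cw j) ≤ ∑ j : Fin N, ((cw j - (σ j : ℕ)) + g (σ j)) := by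
      refine Finset.sum_le_sum fun j _ => ?_
      have := hg (cw j) (σ j)
      omega
    rw [Finset.sum_add_distrib] at h2
    omega

lemma min_sum_aux (o e : ℕ) (ho : 1 ≤ o) :
    o * (o - 1) + ∑ i ∈ Finset.range (2 * (o + e) - 1), min i (2 * o - 1)
      = ∑ j ∈ Finset.range (o + e), min (o - 1 + j) (2 * o - 1)
        + ∑ j ∈ Finset.range (o + e - 1), min (o + j) (2 * o - 1) := by
  induction e with
  | zero =>
    obtain ⟨k, rfl⟩ : ∃ k, o = k + 1 := ⟨o - 1, by omega⟩
    have e1 : ∀ n, ∀ c, n + c ≤ 2 * k + 2 → ∑ j ∈ Finset.range n, min (c + j) (2 * k + 1) =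
        n * c + ∑ j ∈ Finset.range n, j := by
      intro n c h
      rw [Finset.sum_congr rfl (g := fun j => c + j), Finset.sum_add_distrib]
      · simp
      · intro j hj
        simp at hj
        omega
    have h0 := e1 (2 * k + 1) 0 (by omega)
    have h1 := e1 (k + 1) k (by omega)
    have h2 := e1 k (k + 1) (by omega)
    have g1 := Finset.sum_range_id_mul_two (2 * k + 1)
    have g2 := Finset.sum_range_id_mul_two (k + 1)
    have g3 := Finset.sum_range_id_mul_two k
    have a1 : 2 * (k + 1 + 0) - 1 = 2 * k + 1 := by omega
    have a2 : 2 * (k + 1) - 1 = 2 * k + 1 := by omega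
    simp only [zero_add, Nat.add_zero, Nat.add_sub_cancel] at *
    rw [a2, h0, h1, h2]
    rcases k with _ | k
    · simp
    · simp only [Nat.add_sub_cancel] at *
      nlinarith
  | succ e ih =>
    have a1 : 2 * (o + (e + 1)) - 1 = (2 * (o + e) - 1) + 1 + 1 := by omega
    have a2 : o + (e + 1) - 1 = (o + e - 1) + 1 := by omega
    have a3 : o + (e + 1) = (o + e) + 1 := by omega
    rw [a1, a2, a3, Finset.sum_range_succ, Finset.sum_range_succ, Finset.sum_range_succ,
      Finset.sum_range_succ _ (o + e - 1)]
    have b1 : min (2 * (o + e) - 1) (2 * o - 1) = 2 * o - 1 := by omega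
    have b2 : min (2 * (o + e) - 1 + 1) (2 * o - 1) = 2 * o - 1 := by omega
    have b3 : min (o - 1 + (o + e)) (2 * o - 1) = 2 * o - 1 := by omega
    have b4 : min (o + (o + e - 1)) (2 * o - 1) = 2 * o - 1 := by omega
    rw [b1, b2, b3, b4]
    omega

lemma big_sum_aux (o d : ℕ) (hd : 1 ≤ d) (h : d ≤ o) :
    (o - 1) * d + ∑ i ∈ Finset.range (2 * d - 1), i
      ≤ ∑ j ∈ Finset.range d, (o - 1 + j)
        + ∑ j ∈ Finset.range (d - 1), (o + j) := by
  obtain ⟨k, rfl⟩ : ∃ k, d = k + 1 := ⟨d - 1, by omega⟩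
  obtain ⟨e, rfl⟩ : ∃ e, o = k + 1 + e := ⟨o - (k+1), by omega⟩
  rw [Finset.sum_add_distrib, Finset.sum_add_distrib]
  have g1 := Finset.sum_range_id_mul_two (2 * k + 1)
  have g2 := Finset.sum_range_id_mul_two (k + 1)
  have g3 := Finset.sum_range_id_mul_two k
  have a1 : 2 * (k + 1) - 1 = 2 * k + 1 := by omega
  have a2 : k + 1 + e - 1 = k + e := by omega
  simp only [Nat.add_sub_cancel, Finset.sum_const, Finset.card_range, smul_eq_mul] at *
  rw [a1, a2]
  rcases k with _ | k
  · simp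
  · simp only [Nat.add_sub_cancel] at *
    nlinarith

open Polynomial in
/-- order lemma for the resultant of `f` and its derivative -/
lemma resultant_deriv_dvd {R : Type*} [CommRing R] (f : R[X]) (y : R) (d o : ℕ) (hd : 1 ≤ d)
    (hf : ∀ i, y ^ (o - i) ∣ f.coeff i) :
    y ^ ((o - 1) * min o d) ∣ resultant f (derivative f) d (d - 1) := by
  rcases Nat.eq_zero_or_pos o with rfl | ho
  · simp
  have hf' : ∀ i, y ^ (o - 1 - i) ∣ (derivative f).coeff i := by
    intro i
    rw [coeff_derivative]
    refine Dvd.dvd.mul_right ?_ _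
    have := hf (i + 1)
    rwa [show o - (i + 1) = o - 1 - i by omega] at this
  unfold resultant
  let cw : Fin (d + (d - 1)) → ℕ := fun j => j.addCases (fun j₁ => o - 1 + j₁) (fun j₁ => o + j₁)
  refine det_weight_dvd _ y cw ?_ _ ?_
  · intro i j
    induction j using Fin.addCases with
    | left j =>
      simp only [sylvester, Matrix.of_apply, Fin.addCases_left, cw]
      split_ifs with h
      · have := hf' (i - j)
        have h' := h.1
        rwa [show o - 1 - ((i:ℕ) - j) = o - 1 + j - i by omega] at this
      · exact dvd_zero _
    | right j =>
      simp only [sylvester, Matrix.of_apply, Fin.addCases_right, cw]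
      split_ifs with h
      · have := hf (i - j)
        have h' := h.1
        rwa [show o - ((i:ℕ) - j) = o + j - i by omega] at this
      · exact dvd_zero _
  · rcases le_total o d with h | h
    · refine ⟨fun a => min a (2 * o - 1), fun a b => by show min a _ - min b _ ≤ _; omega, ?_⟩
      rw [Fin.sum_univ_add (fun j => min (cw j) (2 * o - 1))]
      simp only [cw, Fin.addCases_left, Fin.addCases_right]
      rw [Fin.sum_univ_eq_sum_range (fun i => min i (2 * o - 1)),
       Fin.sum_univ_eq_sum_range (fun i => min (o - 1 + i) (2 * o - 1)),
       Fin.sum_univ_eq_sum_range (fun i => min (o + i) (2 * o - 1))]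
      have := min_sum_aux o (d - o) ho
      rw [show o + (d - o) = d by omega, show 2 * d - 1 = d + (d - 1) by omega] at this
      rw [min_eq_left h, mul_comm]
      exact this.le
    · refine ⟨fun a => a, fun a b => le_rfl, ?_⟩
      rw [Fin.sum_univ_add (fun j => cw j)]
      simp only [cw, Fin.addCases_left, Fin.addCases_right]
      rw [Fin.sum_univ_eq_sum_range (fun i => i),
       Fin.sum_univ_eq_sum_range (fun i => o - 1 + i),
       Fin.sum_univ_eq_sum_range (fun i => o + i)]
      have := big_sum_aux o d hd h
      rw [show 2 * d - 1 = d + (d - 1) by omega] at this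
      rw [min_eq_right h]
      exact this

open Polynomial in
/-- divisibility of coefficients from a weighted substitution -/
lemma coeff_dvd_of_eval₂ {R : Type*} [CommRing R] (g : R[X][X]) (T : ℕ)
    (h : (X : R[X][X]) ^ T ∣ eval₂ (mapRingHom (C : R →+* R[X])) (C X * X) g) (i : ℕ) :
    (X : R[X]) ^ (T - i) ∣ g.coeff i := by
  rw [X_pow_dvd_iff] at h ⊢
  intro e he
  have h1 := h (e + i) (by omega)
  rw [eval₂_eq_sum_range, finsetSum_coeff] at h1
  have h2 := congrArg (fun p => coeff p i) h1
  simp only [finsetSum_coeff, mul_pow, coeff_zero] at h2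
  have key : ∀ k, (((mapRingHom C) (g.coeff k) * ((C X : R[X][X]) ^ k * X ^ k)).coeff (e + i)).coeff i
      = if k = i then (g.coeff i).coeff e else 0 := by
    intro k
    rw [← mul_assoc, ← C_pow, coeff_mul_X_pow']
    split_ifs with h1 h2 h2
    · subst h2
      rw [coeff_mul_C, coe_mapRingHom, coeff_map, coeff_C_mul, coeff_X_pow, if_pos rfl]
      simp
    · rw [coeff_mul_C, coe_mapRingHom, coeff_map, coeff_C_mul, coeff_X_pow, if_neg (Ne.symm h2)]
      simp
    · omega
    · simp
  simp only [key, Finset.sum_ite_eq'] at h2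
  split_ifs at h2 with h3
  · exact h2
  · simp only [Finset.mem_range, not_lt] at h3
    rw [coeff_eq_zero_of_natDegree_lt (p := g) (by omega)]
    simp


open MvPolynomial in
/-- expansion of a polynomial around the point `p` with a scaling variable -/
noncomputable def phiAt {n : ℕ} (p : Fin n → ℝ) :
    MvPolynomial (Fin n) ℝ →ₐ[ℝ] Polynomial (MvPolynomial (Fin n) ℝ) :=
  MvPolynomial.aeval (fun i => Polynomial.C (MvPolynomial.C (p i)) +
    Polynomial.C (MvPolynomial.X i) * Polynomial.X)

/-- order of vanishing -/
noncomputable def ordAt {n : ℕ} (p : Fin n → ℝ) (F : MvPolynomial (Fin n) ℝ) : ℕ :=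
  (phiAt p F).natTrailingDegree

lemma phiAt_injective {n : ℕ} (p : Fin n → ℝ) : Function.Injective (phiAt p) := by
  let u : Polynomial (MvPolynomial (Fin n) ℝ) →ₐ[ℝ] MvPolynomial (Fin n) ℝ :=
    (Polynomial.aeval (R := MvPolynomial (Fin n) ℝ) (1 : MvPolynomial (Fin n) ℝ)).restrictScalars ℝ
  let v : MvPolynomial (Fin n) ℝ →ₐ[ℝ] MvPolynomial (Fin n) ℝ :=
    MvPolynomial.aeval (fun i => MvPolynomial.X i - MvPolynomial.C (p i))
  have h : ((v.comp u).comp (phiAt p)) = AlgHom.id ℝ _ := by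
    ext i
    simp [phiAt, u, v, MvPolynomial.algebraMap_eq]
  intro a b hab
  have h1 := congrArg (fun w => w a) h
  have h2 := congrArg (fun w => w b) h
  simp only [AlgHom.comp_apply, AlgHom.id_apply] at h1 h2
  rw [← h1, ← h2, hab]

lemma phiAt_ne_zero {n : ℕ} (p : Fin n → ℝ) {F : MvPolynomial (Fin n) ℝ} (hF : F ≠ 0) :
    phiAt p F ≠ 0 := by
  intro h
  exact hF (phiAt_injective p (by rw [h, map_zero]))

lemma le_ordAt_iff {n : ℕ} (p : Fin n → ℝ) {F : MvPolynomial (Fin n) ℝ} (hF : F ≠ 0) (T : ℕ) :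
    T ≤ ordAt p F ↔ (Polynomial.X : Polynomial (MvPolynomial (Fin n) ℝ)) ^ T ∣ phiAt p F := by
  rw [Polynomial.X_pow_dvd_iff]
  constructor
  · intro h d hd
    exact Polynomial.coeff_eq_zero_of_lt_natTrailingDegree (lt_of_lt_of_le hd h)
  · intro h
    exact Polynomial.le_natTrailingDegree (phiAt_ne_zero p hF) h

lemma ordAt_mul {n : ℕ} (p : Fin n → ℝ) {F G : MvPolynomial (Fin n) ℝ} (hF : F ≠ 0) (hG : G ≠ 0) :
    ordAt p (F * G) = ordAt p F + ordAt p G := by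
  unfold ordAt
  rw [map_mul, Polynomial.natTrailingDegree_mul (phiAt_ne_zero p hF) (phiAt_ne_zero p hG)]

lemma phiAt_coeff_zero {n : ℕ} (p : Fin n → ℝ) (F : MvPolynomial (Fin n) ℝ) :
    (phiAt p F).coeff 0 = MvPolynomial.C (MvPolynomial.eval p F) := by
  let u : Polynomial (MvPolynomial (Fin n) ℝ) →ₐ[ℝ] MvPolynomial (Fin n) ℝ :=
    (Polynomial.aeval (R := MvPolynomial (Fin n) ℝ) (0 : MvPolynomial (Fin n) ℝ)).restrictScalars ℝ
  let v : MvPolynomial (Fin n) ℝ →ₐ[ℝ] MvPolynomial (Fin n) ℝ :=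
    (Algebra.ofId ℝ (MvPolynomial (Fin n) ℝ)).comp (MvPolynomial.aeval p)
  have h : (u.comp (phiAt p)) = v := by
    ext i
    simp [phiAt, u, v, MvPolynomial.algebraMap_eq, Algebra.ofId_apply]
  have h1 := congrArg (fun w => w F) h
  have h2 : u (phiAt p F) = (phiAt p F).coeff 0 := by
    simp only [u, AlgHom.restrictScalars_apply]
    rw [Polynomial.coeff_zero_eq_aeval_zero]
  have h3 : v F = MvPolynomial.C (MvPolynomial.eval p F) := by
    simp only [v, AlgHom.comp_apply, Algebra.ofId_apply, MvPolynomial.algebraMap_eq,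
      MvPolynomial.aeval_eq_eval]
  rw [← h2, ← h3]
  exact h1

lemma ordAt_eq_zero {n : ℕ} (p : Fin n → ℝ) {F : MvPolynomial (Fin n) ℝ}
    (h : MvPolynomial.eval p F ≠ 0) : ordAt p F = 0 := by
  unfold ordAt
  apply Polynomial.natTrailingDegree_eq_zero_of_constantCoeff_ne_zero
  rw [Polynomial.constantCoeff_apply, phiAt_coeff_zero]
  simpa using h

open Polynomial in
/-- coefficients of the Taylor shifted polynomial are divisible -/
lemma coeff_taylor_dvd {n : ℕ} (p : Fin (n + 1) → ℝ) (F : MvPolynomial (Fin (n + 1)) ℝ) (T : ℕ)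
    (h : (X : (MvPolynomial (Fin (n+1)) ℝ)[X]) ^ T ∣ phiAt p F) (i : ℕ) :
    (X : (MvPolynomial (Fin n) ℝ)[X]) ^ (T - i) ∣
      (taylor (C (MvPolynomial.C (p 0)))
        ((MvPolynomial.finSuccEquiv ℝ n F).map (phiAt (Fin.tail p) : _ →+* _))).coeff i := by
  apply coeff_dvd_of_eval₂
  let σ : (MvPolynomial (Fin (n+1)) ℝ)[X] →+* (MvPolynomial (Fin n) ℝ)[X][X] :=
    mapRingHom (MvPolynomial.finSuccEquiv ℝ n : _ →+* _)
  have h1 : (X : (MvPolynomial (Fin n) ℝ)[X][X]) ^ T ∣ σ (phiAt p F) := by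
    have := map_dvd σ h
    simpa [σ] using this
  convert h1 using 1
  let A := MvPolynomial (Fin n) ℝ
  let τ1 : A[X][X] →+* A[X][X] := 
    eval₂RingHom (R := A[X]) (S := A[X][X]) (mapRingHom (C : A →+* A[X])) (C X * X)
  let τ2 : A[X][X] →+* A[X][X] := (taylorAlgHom (C (MvPolynomial.C (p 0)) : A[X])).toRingHom
  let τ3 : A[X] →+* A[X][X] := mapRingHom (phiAt (Fin.tail p)).toRingHom
  let τ4 : MvPolynomial (Fin (n+1)) ℝ →+* A[X] := (MvPolynomial.finSuccEquiv ℝ n).toRingEquiv.toRingHom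
  let φ : MvPolynomial (Fin (n+1)) ℝ →+* (MvPolynomial (Fin (n+1)) ℝ)[X] := (phiAt p).toRingHom
  have key : (τ1.comp τ2).comp (τ3.comp τ4) = σ.comp φ := by
    apply MvPolynomial.ringHom_ext
    · intro r
      simp [τ1, τ2, τ3, τ4, φ, σ, A, phiAt, MvPolynomial.algebraMap_eq, MvPolynomial.finSuccEquiv_apply]
    · intro j
      refine Fin.cases ?_ (fun j => ?_) j
      · simp [τ1, τ2, τ3, τ4, φ, σ, A, phiAt, MvPolynomial.finSuccEquiv_apply]
        rw [add_comm]
      · simp [τ1, τ2, τ3, τ4, φ, σ, A, phiAt, MvPolynomial.finSuccEquiv_apply]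
        rw [← C_mul, eval₂_C]
        simp [Fin.tail]
  have := congrArg (fun w => w F) key
  exact this


open Polynomial in
lemma natDegree_deriv_aux {R : Type*} [CommRing R] [IsDomain R] [CharZero R] (f : R[X])
    (hd : 1 ≤ f.natDegree) : (derivative f).natDegree = f.natDegree - 1 :=
  natDegree_eq_of_degree_eq_some (degree_derivative (by omega))

open Polynomial in
lemma resultant_deriv_ne_zero {n : ℕ} (f : (MvPolynomial (Fin n) ℝ)[X]) (hf : Irreducible f)
    (hd : 1 ≤ f.natDegree) : resultant f (derivative f) f.natDegree (f.natDegree - 1) ≠ 0 := by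
  let A := MvPolynomial (Fin n) ℝ
  let K := FractionRing A
  let _ : NormalizedGCDMonoid A := Classical.choice inferInstance
  have hprim : f.IsPrimitive := hf.isPrimitive (by omega)
  have hirr : Irreducible (f.map (algebraMap A K)) :=
    (hprim.irreducible_iff_irreducible_map_fraction_map (K := K)).1 hf
  have hinj : Function.Injective (algebraMap A K) := IsFractionRing.injective A K
  have : CharZero K := charZero_of_injective_algebraMap hinj
  have hsep : (f.map (algebraMap A K)).Separable := hirr.separable
  have hne := resultant_ne_zero _ _ hsep
  intro h
  apply hne
  rw [natDegree_deriv_aux _ (by rwa [natDegree_map_eq_of_injective hinj]),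
    natDegree_map_eq_of_injective hinj, derivative_map, resultant_map_map]
  rw [h, map_zero]

open Polynomial in
lemma ord_resultant {n : ℕ} (p : Fin (n + 1) → ℝ) (F : MvPolynomial (Fin (n + 1)) ℝ)
    (hF : F ≠ 0) (d : ℕ) (hd : 1 ≤ d) (hdF : (MvPolynomial.finSuccEquiv ℝ n F).natDegree = d)
    (hR : resultant (MvPolynomial.finSuccEquiv ℝ n F)
      (derivative (MvPolynomial.finSuccEquiv ℝ n F)) d (d - 1) ≠ 0) :
    (ordAt p F - 1) * min (ordAt p F) d ≤ ordAt (Fin.tail p) 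
      (resultant (MvPolynomial.finSuccEquiv ℝ n F)
      (derivative (MvPolynomial.finSuccEquiv ℝ n F)) d (d - 1)) := by
  rw [le_ordAt_iff _ hR]
  set f := MvPolynomial.finSuccEquiv ℝ n F with hf
  have h1 := coeff_taylor_dvd p F (ordAt p F) ((le_ordAt_iff p hF _).1 le_rfl)
  have h2 := resultant_deriv_dvd _ X d (ordAt p F) hd h1
  rw [← hf] at h2
  have hinj : Function.Injective ((phiAt (Fin.tail p) : MvPolynomial (Fin n) ℝ →+* (MvPolynomial (Fin n) ℝ)[X])) :=
    phiAt_injective _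
  have h3 := resultant_map_map f (derivative f) d (d - 1) ((phiAt (Fin.tail p) : MvPolynomial (Fin n) ℝ →+* (MvPolynomial (Fin n) ℝ)[X]))
  set g := f.map ((phiAt (Fin.tail p) : MvPolynomial (Fin n) ℝ →+* (MvPolynomial (Fin n) ℝ)[X])) with hg
  have hgd : g.natDegree = d := by rw [hg, natDegree_map_eq_of_injective hinj, hdF]
  have hgd' : (derivative g).natDegree = d - 1 := by
    rw [natDegree_deriv_aux _ (by omega), hgd]
  have h4 := resultant_taylor g (derivative g) (C (MvPolynomial.C (p 0)))
  rw [natDegree_taylor, natDegree_taylor, hgd, hgd'] at h4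
  have h5 : derivative (taylor (C (MvPolynomial.C (p 0))) g) =
      taylor (C (MvPolynomial.C (p 0))) (derivative g) := by
    simp [taylor_apply, derivative_comp]
  rw [h5, h4, hg, derivative_map, h3] at h2
  exact h2

open Polynomial in
lemma degreeOf_resultant {n : ℕ} (f : (MvPolynomial (Fin n) ℝ)[X]) (d : ℕ) (j : Fin n) (e : ℕ)
    (he : ∀ i, MvPolynomial.degreeOf j (f.coeff i) ≤ e) :
    MvPolynomial.degreeOf j (resultant f (derivative f) d (d - 1)) ≤ (d + (d - 1)) * e := by
  unfold resultant
  rw [Matrix.det_apply]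
  refine (MvPolynomial.degreeOf_sum_le _ _ _).trans ?_
  refine Finset.sup_le fun σ _ => ?_
  have he' : ∀ i, MvPolynomial.degreeOf j ((derivative f).coeff i) ≤ e := by
    intro i
    rw [coeff_derivative]
    refine (MvPolynomial.degreeOf_mul_le _ _ _).trans ?_
    have : ((i:MvPolynomial (Fin n) ℝ) + 1) = MvPolynomial.C ((i:ℝ) + 1) := by simp
    rw [this, MvPolynomial.degreeOf_C]
    exact he _
  have hs : ∀ i j', MvPolynomial.degreeOf j (sylvester f (derivative f) d (d - 1) i j') ≤ e := by
    intro i j'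
    induction j' using Fin.addCases with
    | left j' =>
      simp only [sylvester, Matrix.of_apply, Fin.addCases_left]
      split_ifs with h
      · exact he' _
      · simp
    | right j' =>
      simp only [sylvester, Matrix.of_apply, Fin.addCases_right]
      split_ifs with h
      · exact he _
      · simp
  rw [Units.smul_def, zsmul_eq_mul]
  refine (MvPolynomial.degreeOf_mul_le _ _ _).trans ?_
  have h1 : MvPolynomial.degreeOf j (((Equiv.Perm.sign σ : ℤ)) : MvPolynomial (Fin n) ℝ) = 0 := by
    have : (((Equiv.Perm.sign σ : ℤ)) : MvPolynomial (Fin n) ℝ) = MvPolynomial.C ((Equiv.Perm.sign σ : ℤ) : ℝ) := by simp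
    rw [this, MvPolynomial.degreeOf_C]
  rw [h1, zero_add]
  refine (MvPolynomial.degreeOf_prod_le _ _ _).trans ?_
  refine (Finset.sum_le_card_nsmul _ _ e fun i _ => hs _ _).trans ?_
  simp

/-- number of zeros among the first `S` points -/
noncomputable def zeroCount {n : ℕ} (P : ℕ → Fin n → ℝ) (S : ℕ) (F : MvPolynomial (Fin n) ℝ) : ℕ :=
  ((Finset.range S).filter (fun s => MvPolynomial.eval (P s) F = 0)).card

lemma zeroCount_le {n : ℕ} (P : ℕ → Fin n → ℝ) (S : ℕ) (F : MvPolynomial (Fin n) ℝ) :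
    zeroCount P S F ≤ S := by
  unfold zeroCount
  exact (Finset.card_filter_le _ _).trans (by simp)

open MvPolynomial in
lemma step_pos {n : ℕ} (P : ℕ → Fin (n + 1) → ℝ) (S : ℕ) (A : Fin n → ℝ) (hA : ∀ j, 0 ≤ A j)
    (htail : ∀ G : MvPolynomial (Fin n) ℝ, G ≠ 0 →
      (∑ s ∈ Finset.range S, (ordAt (Fin.tail (P s)) G : ℝ)) ≤ ∑ j, A j * degreeOf j G)
    (F : MvPolynomial (Fin (n + 1)) ℝ) (hF : Irreducible F) (hd : 1 ≤ degreeOf 0 F)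
    (η : ℝ) (hη : 0 < η) (hη1 : η ≤ 1) :
    (∑ s ∈ Finset.range S, (ordAt (P s) F : ℝ)) ≤ zeroCount P S F + η * S * degreeOf 0 F +
      (2 / η) * ∑ j, A j * degreeOf (Fin.succ j) F := by
  set d := degreeOf 0 F with hdd
  set f := finSuccEquiv ℝ n F with hf
  have hfd : f.natDegree = d := by rw [hf, natDegree_finSuccEquiv]
  have hfirr : Irreducible f := by
    rw [hf]; exact (MulEquiv.irreducible_iff (finSuccEquiv ℝ n)).2 hF
  set R := Polynomial.resultant f (Polynomial.derivative f) d (d - 1) with hR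
  have hR0 : R ≠ 0 := by
    have := resultant_deriv_ne_zero f hfirr (by omega)
    rwa [hfd] at this
  have h1 := htail R hR0
  have h2 : ∑ j, A j * degreeOf j R ≤ 2 * d * ∑ j, A j * degreeOf (Fin.succ j) F := by
    rw [Finset.mul_sum]
    refine Finset.sum_le_sum fun j _ => ?_
    have h3 := degreeOf_resultant f d j (degreeOf j.succ F) (fun i => degreeOf_coeff_finSuccEquiv F j i)
    have h4 : (degreeOf j R : ℝ) ≤ 2 * d * degreeOf j.succ F := by
      have : degreeOf j R ≤ 2 * d * degreeOf j.succ F := 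
        h3.trans (Nat.mul_le_mul_right _ (by omega))
      exact_mod_cast this
    calc A j * degreeOf j R ≤ A j * (2 * d * degreeOf j.succ F) := mul_le_mul_of_nonneg_left h4 (hA j)
      _ = _ := by ring
  have hd0 : (0:ℝ) < d := by exact_mod_cast hd
  have h5 : ∀ s, (ordAt (P s) F : ℝ) ≤ (if eval (P s) F = 0 then 1 else 0) + η * d +
      (ordAt (Fin.tail (P s)) R : ℝ) / (η * d) := by
    intro s
    split_ifs with h0
    · have h6 := ord_resultant (P s) F hF.ne_zero d hd hfd hR0
      rw [← hf, ← hR] at h6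
      set o := ordAt (P s) F
      set ρ := ordAt (Fin.tail (P s)) R
      rcases Nat.eq_zero_or_pos o with ho | ho
      · rw [ho]; push_cast; positivity
      have h7 : ((o:ℝ) - 1) * min (o:ℝ) d ≤ ρ := by
        have : (((o - 1) * min o d : ℕ) : ℝ) ≤ ρ := by exact_mod_cast h6
        rw [Nat.cast_mul, Nat.cast_sub ho, Nat.cast_min] at this
        simpa using this
      have ho1 : (1:ℝ) ≤ o := by exact_mod_cast ho
      by_cases hc : (o:ℝ) - 1 ≤ η * d
      · have : 0 ≤ (ρ:ℝ) / (η * d) := by positivity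
        linarith
      · push Not at hc
        have h8 : η * d ≤ min (o:ℝ) d := by
          apply le_min
          · linarith
          · nlinarith
        have h9 : (o:ℝ) - 1 ≤ ρ / (η * d) := by
          rw [le_div_iff₀ (by positivity)]
          nlinarith
        have : 0 < η * d := by positivity
        linarith
    · rw [ordAt_eq_zero _ h0]
      push_cast
      positivity
  calc (∑ s ∈ Finset.range S, (ordAt (P s) F : ℝ)) ≤ ∑ s ∈ Finset.range S, ((if eval (P s) F = 0 then (1:ℝ) else 0) + η * d +
      (ordAt (Fin.tail (P s)) R : ℝ) / (η * d)) := Finset.sum_le_sum fun s _ => h5 s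
    _ = zeroCount P S F + η * S * d + (∑ s ∈ Finset.range S, (ordAt (Fin.tail (P s)) R : ℝ)) / (η * d) := by
      rw [Finset.sum_add_distrib, Finset.sum_add_distrib, ← Finset.sum_div]
      simp [zeroCount]
      ring
    _ ≤ zeroCount P S F + η * S * d + (2 * d * ∑ j, A j * degreeOf (Fin.succ j) F) / (η * d) := by
      gcongr
      exact h1.trans h2
    _ = _ := by
      field_simp

open MvPolynomial in
lemma step_zero {n : ℕ} (P : ℕ → Fin (n + 1) → ℝ) (S : ℕ) (A : Fin n → ℝ) (hA : ∀ j, 0 ≤ A j)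
    (htail : ∀ G : MvPolynomial (Fin n) ℝ, G ≠ 0 →
      (∑ s ∈ Finset.range S, (ordAt (Fin.tail (P s)) G : ℝ)) ≤ ∑ j, A j * degreeOf j G)
    (F : MvPolynomial (Fin (n + 1)) ℝ) (hF : F ≠ 0) (hd : degreeOf 0 F = 0) :
    (∑ s ∈ Finset.range S, (ordAt (P s) F : ℝ)) ≤ ∑ j, A j * degreeOf (Fin.succ j) F := by
  set f := finSuccEquiv ℝ n F with hf
  have hfd : f.natDegree = 0 := by rw [hf, natDegree_finSuccEquiv, hd]
  set G := f.coeff 0 with hG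
  have hfG : f = Polynomial.C G := Polynomial.eq_C_of_natDegree_eq_zero hfd
  have hG0 : G ≠ 0 := by
    intro h
    rw [h, map_zero] at hfG
    apply hF
    rw [← EmbeddingLike.map_eq_zero_iff (f := finSuccEquiv ℝ n)]
    exact hfG
  refine le_trans (Finset.sum_le_sum fun s _ => ?_) ((htail G hG0).trans ?_)
  · have h1 := coeff_taylor_dvd (P s) F (ordAt (P s) F) ((le_ordAt_iff _ hF _).1 le_rfl) 0
    rw [← hf, hfG, Polynomial.map_C, Polynomial.taylor_C, Polynomial.coeff_C_zero] at h1
    have := (le_ordAt_iff (Fin.tail (P s)) hG0 (ordAt (P s) F)).2 h1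
    exact_mod_cast this
  · refine Finset.sum_le_sum fun j _ => mul_le_mul_of_nonneg_left ?_ (hA j)
    exact_mod_cast degreeOf_coeff_finSuccEquiv F j 0


/-- Rolle for finite sets of zeros -/
lemma rolle_finset (f : ℝ → ℝ) (hf : Differentiable ℝ f) (Z : Finset ℝ) (hZ : Z.Nonempty)
    (h0 : ∀ z ∈ Z, f z = 0) :
    ∃ Z' : Finset ℝ, (∀ z ∈ Z', deriv f z = 0) ∧ Disjoint Z Z' ∧ Z'.card + 1 = Z.card ∧
      ∀ z ∈ Z', (∃ a ∈ Z, a < z) ∧ (∃ b ∈ Z, z < b) := by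
  induction Z using Finset.induction_on_max with
  | empty => simp at hZ
  | insert a Z ha ih =>
    rcases Z.eq_empty_or_nonempty with rfl | hne
    · exact ⟨∅, by simp⟩
    obtain ⟨Z', h1, h2, h3, h4⟩ := ih hne (fun z hz => h0 z (Finset.mem_insert_of_mem hz))
    obtain ⟨c, hc, hc'⟩ := exists_deriv_eq_zero (f := f) (ha _ (Z.max'_mem hne))
      hf.continuous.continuousOn
      (by rw [h0 _ (Finset.mem_insert_self _ _), h0 _ (Finset.mem_insert_of_mem (Z.max'_mem hne))])
    have hmax : ∀ z ∈ Z, z < c := fun z hz => lt_of_le_of_lt (Z.le_max' z hz) hc.1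
    have hcZ' : c ∉ Z' := by
      intro h
      obtain ⟨b, hb, hb'⟩ := (h4 c h).2
      exact absurd (hmax b hb) (not_lt.2 hb'.le)
    refine ⟨insert c Z', ?_, ?_, ?_, ?_⟩
    · intro z hz
      rcases Finset.mem_insert.1 hz with rfl | hz
      · exact hc'
      · exact h1 z hz
    · rw [Finset.disjoint_left]
      intro z hz hz'
      rcases Finset.mem_insert.1 hz with rfl | hz
      · rcases Finset.mem_insert.1 hz' with h | hz'
        · exact absurd hc.2 (by rw [h]; exact lt_irrefl _)
        · obtain ⟨b, hb, hb'⟩ := (h4 z hz').2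
          exact absurd (ha b hb) (not_lt.2 hb'.le)
      · rcases Finset.mem_insert.1 hz' with rfl | hz'
        · exact lt_irrefl _ (hmax _ hz)
        · exact Finset.disjoint_left.1 h2 hz hz'
    · rw [Finset.card_insert_of_notMem hcZ', h3, Finset.card_insert_of_notMem]
      intro h
      exact lt_irrefl _ (ha a h)
    · intro z hz
      rcases Finset.mem_insert.1 hz with rfl | hz
      · exact ⟨⟨_, Finset.mem_insert_of_mem (Z.max'_mem hne), hc.1⟩, ⟨a, Finset.mem_insert_self _ _, hc.2⟩⟩
      · obtain ⟨⟨u, hu, hu'⟩, ⟨v, hv, hv'⟩⟩ := h4 z hz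
        exact ⟨⟨u, Finset.mem_insert_of_mem hu, hu'⟩, ⟨v, Finset.mem_insert_of_mem hv, hv'⟩⟩

open Polynomial in
/-- an exponential polynomial -/
noncomputable def expPoly (W : Finset ℝ) (P : ℝ → ℝ[X]) (x : ℝ) : ℝ :=
  ∑ w ∈ W, (P w).eval x * Real.exp (w * x)

open Polynomial in
lemma expPoly_zeros (N : ℕ) : ∀ (W : Finset ℝ) (P : ℝ → ℝ[X]) (_ : ∀ w ∈ W, P w ≠ 0)
    (_ : W.Nonempty) (_ : ∑ w ∈ W, ((P w).natDegree + 1) = N) (Z : Finset ℝ)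
    (_ : ∀ z ∈ Z, expPoly W P z = 0), Z.card < N := by
  induction N with
  | zero =>
    intro W P hP hW hN
    obtain ⟨w, hw⟩ := hW
    have := Finset.sum_eq_zero_iff.1 hN w hw
    omega
  | succ N ih =>
    intro W P hP hW hN Z hZ
    obtain ⟨w0, hw0⟩ := hW
    rcases Z.eq_empty_or_nonempty with rfl | hZne
    · simp
    let g : ℝ → ℝ := fun x => ∑ w ∈ W, (P w).eval x * Real.exp ((w - w0) * x)
    let Q : ℝ → ℝ[X] := fun w => derivative (P (w + w0)) + C w * P (w + w0)
    have hg : ∀ x, HasDerivAt g (∑ w ∈ W, (Q (w - w0)).eval x * Real.exp ((w - w0) * x)) x := by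
      intro x
      have : ∀ w ∈ W, HasDerivAt (fun x => (P w).eval x * Real.exp ((w - w0) * x))
          ((Q (w - w0)).eval x * Real.exp ((w - w0) * x)) x := by
        intro w _
        have h1 := (P w).hasDerivAt x
        have h2 : HasDerivAt (fun x => Real.exp ((w - w0) * x)) (Real.exp ((w - w0) * x) * (w - w0)) x := by
          simpa using ((hasDerivAt_id x).const_mul (w - w0)).exp
        refine (h1.fun_mul h2).congr_deriv ?_
        simp [Q]
        ring
      exact HasDerivAt.fun_sum this
    have hgz : ∀ z ∈ Z, g z = 0 := by
      intro z hz
      have := hZ z hz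
      have h2 : g z = Real.exp (- w0 * z) * expPoly W P z := by
        simp only [g, expPoly, Finset.mul_sum]
        refine Finset.sum_congr rfl fun w _ => ?_
        rw [show (w - w0) * z = - w0 * z + w * z by ring, Real.exp_add]
        ring
      rw [h2, this, mul_zero]
    obtain ⟨Z', hZ', -, hcard, -⟩ := rolle_finset g (fun x => (hg x).differentiableAt) Z hZne hgz
    -- degrees of Q
    have hQd : ∀ w ∈ W, w ≠ w0 → Q (w - w0) ≠ 0 ∧ (Q (w - w0)).natDegree = (P w).natDegree := by
      intro w hw hne
      have hne' : w - w0 ≠ 0 := sub_ne_zero.2 hne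
      have h1 : Q (w - w0) = derivative (P w) + C (w - w0) * P w := by simp [Q]
      have h2 : (Q (w - w0)).degree = (P w).degree := by
        rw [h1, degree_add_eq_right_of_degree_lt, degree_C_mul hne']
        rw [degree_C_mul hne']
        exact degree_derivative_lt (hP w hw)
      refine ⟨?_, natDegree_eq_natDegree h2⟩
      intro h
      rw [h, degree_zero] at h2
      exact hP w hw (degree_eq_bot.1 h2.symm)
    have hQ0 : Q 0 = derivative (P w0) := by simp [Q]
    have hsplit := Finset.sum_erase_add W (fun w => (P w).natDegree + 1) hw0
    have htr : ∀ V : Finset ℝ, ∑ v ∈ V.image (fun w => w - w0), ((Q v).natDegree + 1) =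
        ∑ w ∈ V, ((Q (w - w0)).natDegree + 1) := by
      intro V
      rw [Finset.sum_image]
      intro a _ b _ h
      simpa using h
    have htr2 : ∀ V : Finset ℝ, ∀ x, expPoly (V.image (fun w => w - w0)) Q x =
        ∑ w ∈ V, (Q (w - w0)).eval x * Real.exp ((w - w0) * x) := by
      intro V x
      rw [expPoly, Finset.sum_image]
      intro a _ b _ h
      simpa using h
    have hsame : ∑ w ∈ W.erase w0, ((Q (w - w0)).natDegree + 1) = ∑ w ∈ W.erase w0, ((P w).natDegree + 1) := by
      refine Finset.sum_congr rfl fun w hw => ?_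
      rw [(hQd w (Finset.mem_of_mem_erase hw) (Finset.ne_of_mem_erase hw)).2]
    have hderiv0 : ∀ z ∈ Z', ∑ w ∈ W, (Q (w - w0)).eval z * Real.exp ((w - w0) * z) = 0 := by
      intro z hz
      rw [← (hg z).deriv]
      exact hZ' z hz
    by_cases hdeg : (P w0).natDegree = 0
    · have hQ00 : Q 0 = 0 := by
        rw [hQ0, eq_C_of_natDegree_eq_zero hdeg, derivative_C]
      rcases (W.erase w0).eq_empty_or_nonempty with hemp | hne
      · -- only one exponential with a constant
        exfalso
        obtain ⟨z, hz⟩ := hZne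
        have h1 := hZ z hz
        have hW1 : W = {w0} := by
          rw [← Finset.insert_erase hw0, hemp]; rfl
        rw [expPoly, hW1, Finset.sum_singleton, eq_C_of_natDegree_eq_zero hdeg, eval_C] at h1
        have h2 : (P w0).coeff 0 = 0 := by
          rcases mul_eq_zero.1 h1 with h | h
          · exact h
          · exact absurd h (Real.exp_ne_zero _)
        apply hP w0 hw0
        rw [eq_C_of_natDegree_eq_zero hdeg, h2, C_0]
      · have := ih ((W.erase w0).image (fun w => w - w0)) Q (by
          intro v hv
          obtain ⟨w, hw, rfl⟩ := Finset.mem_image.1 hv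
          exact (hQd w (Finset.mem_of_mem_erase hw) (Finset.ne_of_mem_erase hw)).1)
          (hne.image _) (by rw [htr, hsame]; omega) Z' (by
          intro z hz
          rw [htr2, ← hderiv0 z hz, ← Finset.sum_erase_add W _ hw0]
          simp [hQ00])
        omega
    · have hQ0d : (Q 0).natDegree = (P w0).natDegree - 1 := by
        rw [hQ0, natDegree_deriv_aux _ (by omega)]
      have := ih (W.image (fun w => w - w0)) Q (by
          intro v hv
          obtain ⟨w, hw, rfl⟩ := Finset.mem_image.1 hv
          by_cases h : w = w0
          · subst h
            rw [sub_self, hQ0]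
            intro h
            exact hdeg (derivative_eq_zero.1 h)
          · exact (hQd w hw h).1)
          (⟨_, Finset.mem_image_of_mem _ hw0⟩) (by 
            rw [htr, ← Finset.sum_erase_add W _ hw0, hsame, sub_self, hQ0d]; omega) Z' (by
          intro z hz
          rw [htr2, hderiv0 z hz])
      omega


open MvPolynomial in
lemma zeroCount_general {n : ℕ} (P : ℕ → Fin n → ℝ) (S : ℕ) (F : MvPolynomial (Fin n) ℝ)
    (hF : F ≠ 0) (w : (Fin n →₀ ℕ) → ℝ) (k : (Fin n →₀ ℕ) → ℕ)
    (hinj : ∀ m m', w m = w m' → k m = k m' → m = m')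
    (hP : ∀ s m, ∏ i, P s i ^ m i = (s:ℝ) ^ k m * Real.exp (w m * s))
    (D B : ℕ) (hD : ∀ m ∈ F.support, k m ≤ D) (hB : (F.support.image w).card ≤ B) :
    zeroCount P S F ≤ B * (D + 1) := by
  classical
  let W := F.support.image w
  let Q : ℝ → Polynomial ℝ := fun v => ∑ m ∈ F.support.filter (fun m => w m = v),
    Polynomial.monomial (k m) (coeff m F)
  have hQdeg : ∀ v, (Q v).natDegree ≤ D := by
    intro v
    refine Polynomial.natDegree_sum_le_of_forall_le _ _ fun m hm => ?_
    exact (Polynomial.natDegree_monomial_le _).trans (hD m (Finset.mem_filter.1 hm).1)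
  have hQne : ∀ v ∈ W, Q v ≠ 0 := by
    intro v hv h
    obtain ⟨m, hm, rfl⟩ := Finset.mem_image.1 hv
    have h1 := congrArg (fun q => Polynomial.coeff q (k m)) h
    simp only [Q, Polynomial.finsetSum_coeff, Polynomial.coeff_monomial, Polynomial.coeff_zero] at h1
    rw [Finset.sum_eq_single m] at h1
    · simp at h1
      exact (mem_support_iff.1 hm) h1
    · intro m' hm' hne
      rw [if_neg]
      intro h2
      exact hne (hinj _ _ (Finset.mem_filter.1 hm').2 h2)
    · intro h2
      exact (h2 (Finset.mem_filter.2 ⟨hm, rfl⟩)).elim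
  have hWne : W.Nonempty := (support_nonempty.2 hF).image _
  have heval : ∀ s : ℕ, eval (P s) F = expPoly W Q s := by
    intro s
    rw [eval_eq', expPoly]
    rw [← Finset.sum_fiberwise_of_maps_to (t := W) (g := w) (fun m hm => Finset.mem_image_of_mem _ hm)]
    refine Finset.sum_congr rfl fun v _ => ?_
    simp only [Q, Polynomial.eval_finsetSum, Polynomial.eval_monomial, Finset.sum_mul]
    refine Finset.sum_congr rfl fun m hm => ?_
    rw [hP, (Finset.mem_filter.1 hm).2]
    ring
  have h1 := expPoly_zeros _ W Q hQne hWne rfl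
    (((Finset.range S).filter (fun s => eval (P s) F = 0)).image (fun s : ℕ => (s:ℝ))) (by
      intro z hz
      obtain ⟨s, hs, rfl⟩ := Finset.mem_image.1 hz
      rw [← heval]
      exact (Finset.mem_filter.1 hs).2)
  rw [Finset.card_image_of_injective _ Nat.cast_injective] at h1
  have h2 : ∑ v ∈ W, ((Q v).natDegree + 1) ≤ W.card * (D + 1) := by
    rw [← smul_eq_mul]
    exact Finset.sum_le_card_nsmul _ _ _ fun v _ => Nat.succ_le_succ (hQdeg v)
  unfold zeroCount
  exact h1.le.trans (h2.trans (Nat.mul_le_mul_right _ hB))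

/-- the bound on total vanishing order -/
def ZB {n : ℕ} (P : ℕ → Fin n → ℝ) (S : ℕ) (A : Fin n → ℝ) : Prop :=
  ∀ F : MvPolynomial (Fin n) ℝ, F ≠ 0 →
      (∑ s ∈ Finset.range S, (ordAt (P s) F : ℝ)) ≤ ∑ j, A j * MvPolynomial.degreeOf j F

lemma ordAt_unit {n : ℕ} (p : Fin n → ℝ) {F : MvPolynomial (Fin n) ℝ} (hF : IsUnit F) :
    ordAt p F = 0 := by
  apply ordAt_eq_zero
  exact (hF.map (MvPolynomial.eval p)).ne_zero

open MvPolynomial in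
lemma ZB_of_irreducible {n : ℕ} (P : ℕ → Fin n → ℝ) (S : ℕ) (A : Fin n → ℝ) (hA : ∀ j, 0 ≤ A j)
    (h : ∀ F : MvPolynomial (Fin n) ℝ, Irreducible F →
      (∑ s ∈ Finset.range S, (ordAt (P s) F : ℝ)) ≤ ∑ j, A j * degreeOf j F) : ZB P S A := by
  intro F
  refine UniqueFactorizationMonoid.induction_on_prime F ?_ ?_ ?_
  · intro h; exact absurd rfl h
  · intro u hu _
    rw [Finset.sum_eq_zero]
    · exact Finset.sum_nonneg fun j _ => mul_nonneg (hA j) (Nat.cast_nonneg _)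
    · intro s _; rw [ordAt_unit _ hu]; simp
  · intro a p ha hp ih _
    have h1 := h p hp.irreducible
    have h2 := ih ha
    have h3 : ∀ s, (ordAt (P s) (p * a) : ℝ) = ordAt (P s) p + ordAt (P s) a := by
      intro s; rw [ordAt_mul _ hp.ne_zero ha]; push_cast; rfl
    have h4 : ∀ j, A j * (degreeOf j (p * a) : ℝ) = A j * degreeOf j p + A j * degreeOf j a := by
      intro j; rw [degreeOf_mul_eq hp.ne_zero ha]; push_cast; ring
    simp only [h3, h4, Finset.sum_add_distrib]
    linarith

lemma ZB_zero (P : ℕ → Fin 0 → ℝ) (S : ℕ) (A : Fin 0 → ℝ) : ZB P S A := by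
  apply ZB_of_irreducible _ _ _ (fun j => j.elim0)
  intro F hF
  exfalso
  apply hF.not_isUnit
  rw [MvPolynomial.eq_C_of_isEmpty F]
  apply IsUnit.map
  rw [isUnit_iff_ne_zero]
  intro h
  apply hF.ne_zero
  rw [MvPolynomial.eq_C_of_isEmpty F, h, map_zero]

lemma support_le_degreeOf {n : ℕ} (F : MvPolynomial (Fin n) ℝ) (m) (hm : m ∈ F.support) (j) :
    m j ≤ MvPolynomial.degreeOf j F := MvPolynomial.le_degreeOf_of_mem_support j hm

lemma finsupp_ext_fin1 (m m' : Fin 1 →₀ ℕ) (h : m 0 = m' 0) : m = m' := by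
  refine Finsupp.ext fun j => ?_
  fin_cases j; exact h

/-- the points -/
noncomputable def pt3 (g0 g1 : ℝ) (s : ℕ) : Fin 3 → ℝ := ![Real.exp (g0 * s), Real.exp (g1 * s), s]
noncomputable def pt2 (g1 : ℝ) (s : ℕ) : Fin 2 → ℝ := ![Real.exp (g1 * s), s]
noncomputable def pt1 (s : ℕ) : Fin 1 → ℝ := ![s]

lemma zc1 (S : ℕ) (F : MvPolynomial (Fin 1) ℝ) (hF : F ≠ 0) :
    zeroCount pt1 S F ≤ MvPolynomial.degreeOf 0 F + 1 := by
  have := zeroCount_general pt1 S F hF (fun _ => 0) (fun m => m 0)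
    (fun m m' _ h => finsupp_ext_fin1 _ _ h) (by intro s m; simp [pt1])
    (MvPolynomial.degreeOf 0 F) 1 (fun m hm => support_le_degreeOf F m hm 0)
    ((Finset.card_le_card (t := {0}) (by intro x hx; simp at hx; simp [hx.2])).trans (by simp))
  simpa using this

lemma zc2 (g1 : ℝ) (hg : g1 ≠ 0) (S : ℕ) (F : MvPolynomial (Fin 2) ℝ) (hF : F ≠ 0) :
    zeroCount (pt2 g1) S F ≤ (MvPolynomial.degreeOf 0 F + 1) * (MvPolynomial.degreeOf 1 F + 1) := by
  classical
  refine zeroCount_general (pt2 g1) S F hF (fun m => m 0 * g1) (fun m => m 1) ?_ ?_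
    _ _ (fun m hm => support_le_degreeOf F m hm 1) ?_
  · intro m m' h h'
    have : (m 0 : ℝ) = m' 0 := mul_right_cancel₀ hg h
    have h0 : m 0 = m' 0 := by exact_mod_cast this
    ext j; fin_cases j
    · exact h0
    · exact h'
  · intro s m
    simp [pt2, Fin.prod_univ_two, ← Real.exp_nat_mul]
    ring_nf
  · have : F.support.image (fun m => (m 0 : ℝ) * g1) ⊆ 
       (Finset.range (MvPolynomial.degreeOf 0 F + 1)).image (fun i : ℕ => (i:ℝ) * g1) := by
      intro x hx
      obtain ⟨m, hm, rfl⟩ := Finset.mem_image.1 hx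
      refine Finset.mem_image.2 ⟨m 0, ?_, rfl⟩
      have := support_le_degreeOf F m hm 0
      simp; omega
    exact (Finset.card_le_card this).trans (Finset.card_image_le.trans (by simp))

lemma zc3 (g0 g1 : ℝ) (hg : ∀ i j : ℤ, i * g0 + j * g1 = 0 → i = 0 ∧ j = 0) (S : ℕ)
    (F : MvPolynomial (Fin 3) ℝ) (hF : F ≠ 0) :
    zeroCount (pt3 g0 g1) S F ≤ ((MvPolynomial.degreeOf 0 F + 1) * (MvPolynomial.degreeOf 1 F + 1))
      * (MvPolynomial.degreeOf 2 F + 1) := by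
  classical
  refine zeroCount_general (pt3 g0 g1) S F hF (fun m => m 0 * g0 + m 1 * g1) (fun m => m 2) ?_ ?_
    _ _ (fun m hm => support_le_degreeOf F m hm 2) ?_
  · intro m m' h h'
    have := hg ((m 0 : ℤ) - m' 0) ((m 1 : ℤ) - m' 1) (by push_cast; linear_combination h)
    ext j; fin_cases j
    · simp; omega
    · simp; omega
    · exact h'
  · intro s m
    simp [pt3, Fin.prod_univ_three, ← Real.exp_nat_mul]
    rw [mul_comm, ← Real.exp_add]
    ring_nf
  · have : F.support.image (fun m => (m 0 : ℝ) * g0 + m 1 * g1) ⊆ 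
       ((Finset.range (MvPolynomial.degreeOf 0 F + 1)) ×ˢ (Finset.range (MvPolynomial.degreeOf 1 F + 1))).image
        (fun i : ℕ × ℕ => (i.1:ℝ) * g0 + i.2 * g1) := by
      intro x hx
      obtain ⟨m, hm, rfl⟩ := Finset.mem_image.1 hx
      refine Finset.mem_image.2 ⟨(m 0, m 1), ?_, rfl⟩
      have := support_le_degreeOf F m hm 0
      have := support_le_degreeOf F m hm 1
      simp; omega
    exact (Finset.card_le_card this).trans (Finset.card_image_le.trans (by simp))

lemma tail_pt1 (g1 : ℝ) (s : ℕ) : Fin.tail (pt2 g1 s) = pt1 s := by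
  ext j; fin_cases j; rfl

lemma tail_pt2 (g0 g1 : ℝ) (s : ℕ) : Fin.tail (pt3 g0 g1 s) = pt2 g1 s := by
  ext j; fin_cases j <;> rfl

lemma ZB1 (S : ℕ) : ZB pt1 S ![3] := by
  apply ZB_of_irreducible
  · intro j; fin_cases j; simp
  intro F hF
  rcases Nat.eq_zero_or_pos (MvPolynomial.degreeOf 0 F) with h | h
  · have := step_zero pt1 S ![] (fun j => j.elim0) (fun G hG => ZB_zero _ S _ G hG) F hF.ne_zero h
    simpa [h] using this
  · have := step_pos pt1 S ![] (fun j => j.elim0) (fun G hG => ZB_zero _ S _ G hG) F hF h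
      (1 / ((S:ℝ) + 1)) (by positivity) (by rw [div_le_one (by positivity)]; simp)
    have hz := zc1 S F hF.ne_zero
    have hz' : (zeroCount pt1 S F : ℝ) ≤ MvPolynomial.degreeOf 0 F + 1 := by exact_mod_cast hz
    have hd : (1:ℝ) ≤ MvPolynomial.degreeOf 0 F := by exact_mod_cast h
    have h3 : 1 / ((S:ℝ) + 1) * S ≤ 1 := by
      rw [one_div_mul_eq_div, div_le_one (by positivity)]; simp
    simp at this
    simp
    simp at h3
    nlinarith

lemma ZB2 (g1 : ℝ) (hg : g1 ≠ 0) (S : ℕ) (η : ℝ) (hη : 0 < η) (hη1 : η ≤ 1) (hS : 2 ≤ η ^ 2 * S) :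
    ZB (pt2 g1) S ![2 * η * S, 8 / η] := by
  apply ZB_of_irreducible
  · intro j; fin_cases j <;> simp <;> positivity
  intro F hF
  have htail : ∀ G : MvPolynomial (Fin 1) ℝ, G ≠ 0 →
      (∑ s ∈ Finset.range S, (ordAt (Fin.tail (pt2 g1 s)) G : ℝ)) ≤
        ∑ j, (![3] : Fin 1 → ℝ) j * MvPolynomial.degreeOf j G := by
    intro G hG
    simp only [tail_pt1]
    exact ZB1 S G hG
  have hA : ∀ j, 0 ≤ (![3] : Fin 1 → ℝ) j := by intro j; fin_cases j; simp
  rcases Nat.eq_zero_or_pos (MvPolynomial.degreeOf 0 F) with h | h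
  · have := step_zero (pt2 g1) S ![3] hA htail F hF.ne_zero h
    simp at this
    simp [h]
    refine this.trans ?_
    gcongr
    rw [le_div_iff₀ hη]; linarith
  · have := step_pos (pt2 g1) S ![3] hA htail F hF h η hη hη1
    have hz := zc2 g1 hg S F hF.ne_zero
    have hz' : (zeroCount (pt2 g1) S F : ℝ) ≤ (MvPolynomial.degreeOf 0 F + 1) *
      (MvPolynomial.degreeOf 1 F + 1) := by exact_mod_cast hz
    have hz2 : (zeroCount (pt2 g1) S F : ℝ) ≤ S := by exact_mod_cast zeroCount_le _ _ _
    have hd : (1:ℝ) ≤ MvPolynomial.degreeOf 0 F := by exact_mod_cast h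
    simp at this
    simp [Fin.sum_univ_two]
    set d0 : ℝ := (MvPolynomial.degreeOf 0 F : ℝ)
    set d1 : ℝ := (MvPolynomial.degreeOf 1 F : ℝ)
    have hd1 : 0 ≤ d1 := Nat.cast_nonneg _
    set z : ℝ := (zeroCount (pt2 g1) S F : ℝ)
    have hS0 : (0:ℝ) ≤ S := Nat.cast_nonneg _
    have key : z ≤ η * S * d0 + 2 / η * d1 := by
      by_cases hc : 1 ≤ η * d0
      · have : 0 ≤ 2 / η * d1 := by positivity
        nlinarith
      · push Not at hc
        have h1 : d0 + 1 ≤ 2 / η := by rw [le_div_iff₀ hη]; nlinarith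
        have h2 : 2 / η ≤ η * S * d0 := by
          rw [div_le_iff₀ hη]
          have : η ^ 2 * S * 1 ≤ η ^ 2 * S * d0 := by gcongr
          nlinarith
        calc z ≤ (d0 + 1) * (d1 + 1) := hz'
          _ ≤ 2 / η * (d1 + 1) := by gcongr
          _ = 2 / η + 2 / η * d1 := by ring
          _ ≤ _ := by linarith
    have : 8 / η * d1 = 2 / η * d1 + 2 / η * (3 * d1) := by ring
    linarith

lemma ZB3 (g0 g1 : ℝ) (hg : ∀ i j : ℤ, i * g0 + j * g1 = 0 → i = 0 ∧ j = 0) (S : ℕ) (η : ℝ)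
    (hη : 0 < η) (hη1 : η ≤ 1) (hS : 32 ≤ η ^ 4 * S) :
    ZB (pt3 g0 g1) S ![2 * η * S, 2 * η * S, 68 / η ^ 3] := by
  have hg1 : g1 ≠ 0 := by
    rintro rfl
    have := (hg 0 1 (by simp)).2
    omega
  apply ZB_of_irreducible
  · intro j; fin_cases j <;> simp <;> positivity
  intro F hF
  have hη2 : η ^ 2 ≤ 1 := by nlinarith
  have htail : ∀ G : MvPolynomial (Fin 2) ℝ, G ≠ 0 →
      (∑ s ∈ Finset.range S, (ordAt (Fin.tail (pt3 g0 g1 s)) G : ℝ)) ≤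
        ∑ j, (![η ^ 2 / 2 * S, 32 / η ^ 2] : Fin 2 → ℝ) j * MvPolynomial.degreeOf j G := by
    intro G hG
    simp only [tail_pt2]
    have := ZB2 g1 hg1 S (η ^ 2 / 4) (by positivity) (by linarith) (by nlinarith) G hG
    convert this using 5
    · ring
    · field_simp; norm_num
  have hA : ∀ j, 0 ≤ (![η ^ 2 / 2 * S, 32 / η ^ 2] : Fin 2 → ℝ) j := by
    intro j; fin_cases j <;> simp <;> positivity
  have hS0 : (0:ℝ) ≤ S := Nat.cast_nonneg _
  rcases Nat.eq_zero_or_pos (MvPolynomial.degreeOf 0 F) with h | h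
  · have := step_zero (pt3 g0 g1) S _ hA htail F hF.ne_zero h
    simp [Fin.sum_univ_two] at this
    simp [Fin.sum_univ_three, h]
    refine this.trans ?_
    gcongr ?_ * _ + ?_ * _
    · have : η ^ 2 / 2 ≤ 2 * η := by nlinarith
      gcongr
    · rw [div_le_div_iff₀ (by positivity) (by positivity)]
      have : η ^ 3 ≤ η ^ 2 := by nlinarith [sq_nonneg η]
      nlinarith [sq_nonneg η]
  · have := step_pos (pt3 g0 g1) S _ hA htail F hF h η hη hη1
    have hz := zc3 g0 g1 hg S F hF.ne_zero
    have hz' : (zeroCount (pt3 g0 g1) S F : ℝ) ≤ ((MvPolynomial.degreeOf 0 F + 1) *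
      (MvPolynomial.degreeOf 1 F + 1)) * (MvPolynomial.degreeOf 2 F + 1) := by exact_mod_cast hz
    have hz2 : (zeroCount (pt3 g0 g1) S F : ℝ) ≤ S := by exact_mod_cast zeroCount_le _ _ _
    have hd : (1:ℝ) ≤ MvPolynomial.degreeOf 0 F := by exact_mod_cast h
    simp [Fin.sum_univ_two] at this
    simp [Fin.sum_univ_three]
    set d0 : ℝ := (MvPolynomial.degreeOf 0 F : ℝ)
    set d1 : ℝ := (MvPolynomial.degreeOf 1 F : ℝ)
    set d2 : ℝ := (MvPolynomial.degreeOf 2 F : ℝ)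
    have hd1 : 0 ≤ d1 := Nat.cast_nonneg _
    have hd2 : 0 ≤ d2 := Nat.cast_nonneg _
    set z : ℝ := (zeroCount (pt3 g0 g1) S F : ℝ)
    have key : z ≤ η * S * (d0 + d1) + 4 / η ^ 3 * d2 := by
      by_cases hc : 1 ≤ η * (d0 + d1)
      · have : 0 ≤ 4 / η ^ 3 * d2 := by positivity
        nlinarith
      · push Not at hc
        have h1 : d0 + 1 ≤ 2 / η := by rw [le_div_iff₀ hη]; nlinarith
        have h1' : d1 + 1 ≤ 2 / η := by rw [le_div_iff₀ hη]; nlinarith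
        have h2 : 4 / η ^ 2 ≤ η * S * (d0 + d1) := by
          rw [div_le_iff₀ (by positivity)]
          have e1 : η ^ 3 * S * 1 ≤ η ^ 3 * S * (d0 + d1) := by gcongr; linarith
          have e2 : η ^ 4 * S ≤ η ^ 3 * S := by
            have : η ^ 4 ≤ η ^ 3 := pow_le_pow_of_le_one hη.le hη1 (by norm_num)
            gcongr
          nlinarith
        have h3 : 4 / η ^ 2 ≤ 4 / η ^ 3 := by
          have : η ^ 3 ≤ η ^ 2 := pow_le_pow_of_le_one hη.le hη1 (by norm_num)
          gcongr
        calc z ≤ (d0 + 1) * (d1 + 1) * (d2 + 1) := hz'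
          _ ≤ (2 / η) * (2 / η) * (d2 + 1) := by gcongr
          _ = 4 / η ^ 2 + 4 / η ^ 2 * d2 := by field_simp; ring
          _ ≤ 4 / η ^ 2 + 4 / η ^ 3 * d2 := by gcongr
          _ ≤ _ := by linarith
    have e1 : 2 / η * (η ^ 2 / 2 * S * d1 + 32 / η ^ 2 * d2) = η * S * d1 + 64 / η ^ 3 * d2 := by
      field_simp
      ring
    have e2 : 68 / η ^ 3 * d2 = 64 / η ^ 3 * d2 + 4 / η ^ 3 * d2 := by ring
    rw [e1] at this
    linarith


lemma gen_rolle (a b : ℝ) (n : ℕ) : ∀ (F : ℕ → ℝ → ℝ)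
    (_ : ∀ i x, HasDerivAt (F i) (F (i + 1) x) x)
    (Z : Finset ℝ) (μ : ℝ → ℕ) (_ : ∀ z ∈ Z, ∀ i < μ z, F i z = 0)
    (_ : ∑ z ∈ Z, μ z = n + 1) (_ : ∀ z ∈ Z, a ≤ z ∧ z ≤ b),
    ∃ ξ, a ≤ ξ ∧ ξ ≤ b ∧ F n ξ = 0 := by
  induction n with
  | zero =>
    intro F hF Z μ hz hsum hab
    obtain ⟨z, hz1, hz2⟩ : ∃ z ∈ Z, μ z ≠ 0 := by
      by_contra h
      push Not at h
      rw [Finset.sum_eq_zero h] at hsum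
      omega
    exact ⟨z, (hab z hz1).1, (hab z hz1).2, hz z hz1 0 (by omega)⟩
  | succ n ih =>
    intro F hF Z μ hz hsum hab
    classical
    let Zp := Z.filter (fun z => 1 ≤ μ z)
    have hsum' : ∑ z ∈ Zp, μ z = n + 2 := by
      rw [← hsum]
      refine Finset.sum_subset (Finset.filter_subset _ _) ?_
      intro z hz1 hz2
      by_contra h
      exact hz2 (Finset.mem_filter.2 ⟨hz1, by omega⟩)
    have hne : Zp.Nonempty := by
      by_contra h
      rw [Finset.not_nonempty_iff_eq_empty] at h
      rw [h] at hsum'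
      simp at hsum'
    have hZp : ∀ z ∈ Zp, z ∈ Z ∧ 1 ≤ μ z := fun z hz => Finset.mem_filter.1 hz
    obtain ⟨Z', h1, h2, h3, h4⟩ := rolle_finset (F 0) (fun x => (hF 0 x).differentiableAt) Zp hne
      (fun z hz' => hz z (hZp z hz').1 0 (hZp z hz').2)
    refine ih (fun i => F (i + 1)) (fun i x => hF (i + 1) x) (Zp ∪ Z')
      (fun z => if z ∈ Z' then 1 else μ z - 1) ?_ ?_ ?_
    · intro z hz1 i hi
      split_ifs at hi with h
      · have : i = 0 := by omega
        subst this
        rw [← h1 z h]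
        exact ((hF 0 z).deriv).symm
      · have : z ∈ Zp := by
          rcases Finset.mem_union.1 hz1 with h' | h'
          · exact h'
          · exact absurd h' h
        exact hz z (hZp z this).1 (i + 1) (by omega)
    · rw [Finset.sum_union h2]
      have e1 : ∑ z ∈ Z', (if z ∈ Z' then 1 else μ z - 1) = Z'.card := by
        rw [Finset.sum_congr rfl (g := fun _ => 1)]
        · simp
        · intro z hz; simp [hz]
      have e2 : ∑ z ∈ Zp, (if z ∈ Z' then 1 else μ z - 1) + Zp.card = ∑ z ∈ Zp, μ z := by
        rw [Finset.card_eq_sum_ones, ← Finset.sum_add_distrib]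
        refine Finset.sum_congr rfl fun z hz => ?_
        have := (hZp z hz).2
        rw [if_neg (Finset.disjoint_left.1 h2 hz)]
        omega
      omega
    · intro z hz1
      rcases Finset.mem_union.1 hz1 with h | h
      · exact hab z (hZp z h).1
      · obtain ⟨⟨u, hu, hu'⟩, ⟨v, hv, hv'⟩⟩ := h4 z h
        exact ⟨(hab u (hZp u hu).1).1.trans hu'.le, hv'.le.trans (hab v (hZp v hv).1).2⟩

/-- multiplicity of the node `s` among the indices `i, …, i + k` -/
def multW (τ i k s : ℕ) : ℕ := ((Finset.Icc i (i + k)).filter (fun r => r / τ = s)).card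

lemma multW_succ_right (τ i k s : ℕ) :
    multW τ i (k + 1) s = multW τ i k s + if (i + k + 1) / τ = s then 1 else 0 := by
  unfold multW
  rw [← add_assoc, ← Finset.insert_Icc_right_eq_Icc_add_one (by omega), Finset.filter_insert]
  split_ifs with h
  · rw [Finset.card_insert_of_notMem]
    simp
  · rfl

lemma multW_succ_left (τ i k s : ℕ) :
    multW τ i (k + 1) s = multW τ (i + 1) k s + if i / τ = s then 1 else 0 := by
  unfold multW
  rw [← add_assoc, ← Finset.insert_Icc_add_one_left_eq_Icc (show i ≤ i + k + 1 by omega), Finset.filter_insert,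
    show i + 1 + k = i + k + 1 by omega]
  split_ifs with h
  · rw [Finset.card_insert_of_notMem]
    simp
  · rfl

open Polynomial in
/-- Neville–Hermite interpolation with bounds. -/
lemma neville (τ : ℕ) (hτ : 1 ≤ τ) (S' : ℝ) (hS' : 1 ≤ S') (t : ℕ → ℝ[X]) (B0 : ℝ) (N : ℕ) (hN : ((N / τ : ℕ):ℝ) ≤ S')
    (ht : ∀ s k : ℕ, s * τ ≤ N → k ≤ τ → ∃ P : ℝ[X], (X - C (s:ℝ)) ^ k ∣ P - t s ∧ P.natDegree ≤ k - 1 ∧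
      ∀ x, 0 ≤ x → x ≤ S' → |P.eval x| ≤ B0) (k : ℕ) :
    ∀ i, i + k ≤ N → ∃ P : ℝ[X], (∀ s : ℕ, (X - C (s:ℝ)) ^ multW τ i k s ∣ P - t s) ∧ P.natDegree ≤ k ∧
      ∀ x, 0 ≤ x → x ≤ S' → |P.eval x| ≤
        B0 * ((2 * S') ^ k / ∏ r ∈ Finset.Icc 1 k, (max 1 (r / τ) : ℕ)) := by
  have hB0 : 0 ≤ B0 := by
    obtain ⟨P, -, -, h⟩ := ht 0 0 (by simp) (by simp)
    exact (abs_nonneg _).trans (h 0 le_rfl (by linarith))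
  have base : ∀ i k, i + k ≤ N → i / τ = (i + k) / τ → ∃ P : ℝ[X], (∀ s : ℕ, (X - C (s:ℝ)) ^ multW τ i k s ∣ P - t s) ∧
      P.natDegree ≤ k ∧ ∀ x, 0 ≤ x → x ≤ S' → |P.eval x| ≤ B0 := by
    intro i k hik h
    have hall : ∀ r ∈ Finset.Icc i (i + k), r / τ = i / τ := by
      intro r hr
      rw [Finset.mem_Icc] at hr
      have a1 := Nat.div_le_div_right (c := τ) hr.1
      have a2 := Nat.div_le_div_right (c := τ) hr.2
      omega
    have hk : k + 1 ≤ τ := by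
      have a1 := Nat.div_add_mod i τ
      have a2 := Nat.div_add_mod (i + k) τ
      have a3 := Nat.mod_lt (i + k) (show 0 < τ by omega)
      rw [← h] at a2
      omega
    obtain ⟨P, h1, h2, h3⟩ := ht (i / τ) (k + 1) ((Nat.div_mul_le_self i τ).trans (by omega)) hk
    refine ⟨P, ?_, by simpa using h2, h3⟩
    intro s
    by_cases hs : s = i / τ
    · subst hs
      have : multW τ i k (i / τ) = k + 1 := by
        unfold multW
        rw [Finset.filter_true_of_mem hall]
        simp
        omega
      rw [this]
      exact h1
    · have : multW τ i k s = 0 := by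
        unfold multW
        rw [Finset.card_eq_zero, Finset.filter_eq_empty_iff]
        intro r hr h'
        exact hs (by rw [← h', hall r hr])
      rw [this, pow_zero]
      exact one_dvd _
  have hprodpos : ∀ k, (0:ℝ) < ((∏ r ∈ Finset.Icc 1 k, (max 1 (r / τ)) : ℕ) : ℝ) := by
    intro k
    rw [Nat.cast_pos]
    exact Finset.prod_pos fun r _ => by omega
  induction k with
  | zero =>
    intro i hi
    obtain ⟨P, h1, h2, h3⟩ := base i 0 hi (by simp)
    exact ⟨P, h1, h2, by simpa using h3⟩
  | succ k ih =>
    intro i hi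
    by_cases hc : i / τ = (i + (k + 1)) / τ
    · obtain ⟨P, h1, h2, h3⟩ := base i (k + 1) hi hc
      refine ⟨P, h1, h2, fun x hx hx' => (h3 x hx hx').trans ?_⟩
      refine le_mul_of_one_le_right hB0 ?_
      have : ∏ r ∈ Finset.Icc 1 (k+1), (max 1 (r / τ) : ℕ) = 1 := by
        refine Finset.prod_eq_one fun r hr => ?_
        rw [Finset.mem_Icc] at hr
        have hk : k + 2 ≤ τ := by
          have a1 := Nat.div_add_mod i τ
          have a2 := Nat.div_add_mod (i + (k + 1)) τ
          have a3 := Nat.mod_lt (i + (k + 1)) (show 0 < τ by omega)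
          rw [← hc] at a2
          omega
        rw [Nat.div_eq_of_lt (by omega)]
        rfl
      have h' := congrArg (Nat.cast : ℕ → ℝ) this
      push_cast at h' ⊢
      rw [h']
      rw [div_one]
      exact one_le_pow₀ (by linarith)
    · obtain ⟨A, hA1, hA2, hA3⟩ := ih (i + 1) (by omega)
      obtain ⟨B, hB1, hB2, hB3⟩ := ih i (by omega)
      set a : ℕ := i / τ with ha
      set e : ℕ := (i + (k + 1)) / τ with he
      have hae : a ≤ e := Nat.div_le_div_right (by omega)
      have hae' : a < e := lt_of_le_of_ne hae hc
      have hdk : (k + 1) / τ ≤ e - a := by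
        have : i / τ + (k+1)/τ ≤ (i + (k+1))/τ := Nat.div_add_div_le_add_div
        omega
      set dd : ℝ := (e:ℝ) - a with hdd
      have hdd1 : ((max 1 ((k + 1) / τ) : ℕ) : ℝ) ≤ dd := by
        have : max 1 ((k + 1) / τ) ≤ e - a := by omega
        have h' : ((max 1 ((k + 1) / τ) : ℕ) : ℝ) ≤ ((e - a : ℕ) : ℝ) := by exact_mod_cast this
        rwa [Nat.cast_sub hae] at h'
      have hm1 : (1:ℝ) ≤ ((max 1 ((k + 1) / τ) : ℕ) : ℝ) := by
        exact_mod_cast le_max_left _ _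
      have hdd0 : 0 < dd := by linarith
      let P : ℝ[X] := C (dd⁻¹) * ((X - C (a:ℝ)) * A - (X - C (e:ℝ)) * B)
      have hPt : ∀ s, P - t s = C (dd⁻¹) * ((X - C (a:ℝ)) * (A - t s) - (X - C (e:ℝ)) * (B - t s)) := by
        intro s
        have h1 : C (dd⁻¹) * (C (e:ℝ) - C (a:ℝ)) = (1 : ℝ[X]) := by
          rw [← C_sub, ← C_mul, ← hdd, inv_mul_cancel₀ hdd0.ne', C_1]
        have h2 : t s = C (dd⁻¹) * (C (e:ℝ) - C (a:ℝ)) * t s := by rw [h1, one_mul]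
        conv_lhs => rw [h2]
        simp only [P]
        ring
      refine ⟨P, ?_, ?_, ?_⟩
      · intro s
        rw [hPt]
        refine Dvd.dvd.mul_left (dvd_sub ?_ ?_) _
        · have h1 := multW_succ_left τ i k s
          split_ifs at h1 with h2
          · rw [h1, pow_succ, mul_comm]
            rw [ha, h2]
            exact mul_dvd_mul_left _ (hA1 s)
          · rw [h1]
            exact Dvd.dvd.mul_left (hA1 s) _
        · have h1 := multW_succ_right τ i k s
          split_ifs at h1 with h2
          · rw [h1, pow_succ, mul_comm]
            rw [he, ← add_assoc, h2]
            exact mul_dvd_mul_left _ (hB1 s)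
          · rw [h1]
            exact Dvd.dvd.mul_left (hB1 s) _
      · refine (natDegree_C_mul_le _ _).trans ?_
        refine (natDegree_sub_le _ _).trans (max_le ?_ ?_)
        · refine natDegree_mul_le.trans ?_
          rw [natDegree_X_sub_C]; omega
        · refine natDegree_mul_le.trans ?_
          rw [natDegree_X_sub_C]; omega
      · intro x hx hx'
        have hA := hA3 x hx hx'
        have hB := hB3 x hx hx'
        set E := B0 * ((2 * S') ^ k / ∏ r ∈ Finset.Icc 1 k, (max 1 (r / τ) : ℕ)) with hE
        have heN : (e:ℝ) ≤ S' := by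
          have : e ≤ N / τ := Nat.div_le_div_right hi
          exact le_trans (by exact_mod_cast this) hN
        have haS : (a:ℝ) ≤ S' := le_trans (by exact_mod_cast hae) heN
        have ha0 : (0:ℝ) ≤ a := Nat.cast_nonneg _
        have he0 : (0:ℝ) ≤ e := Nat.cast_nonneg _
        have hxa : |x - a| ≤ S' := by rw [abs_le]; constructor <;> linarith
        have hxe : |x - e| ≤ S' := by rw [abs_le]; constructor <;> linarith
        have hE0 : 0 ≤ E := (abs_nonneg _).trans hA
        have h1 : |P.eval x| = dd⁻¹ * |(x - a) * A.eval x - (x - e) * B.eval x| := by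
          simp [P, abs_mul, abs_of_pos hdd0]
        rw [h1]
        have h2 : |(x - a) * A.eval x - (x - e) * B.eval x| ≤ 2 * S' * E := by
          refine (abs_sub _ _).trans ?_
          rw [abs_mul, abs_mul]
          have e1 : |x - a| * |A.eval x| ≤ S' * E := by gcongr
          have e2 : |x - e| * |B.eval x| ≤ S' * E := by gcongr
          linarith
        have h3 : dd⁻¹ ≤ (((max 1 ((k + 1) / τ) : ℕ) : ℝ))⁻¹ := by
          gcongr
        calc dd⁻¹ * |(x - a) * A.eval x - (x - e) * B.eval x| 
            ≤ (((max 1 ((k + 1) / τ) : ℕ) : ℝ))⁻¹ * (2 * S' * E) := by gcongr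
          _ = _ := by
            rw [hE, Finset.prod_Icc_succ_top (by omega)]
            push_cast
            have := (hprodpos k).ne'
            push_cast at this
            have h5 : (max (1:ℝ) (((k + 1) / τ : ℕ) : ℝ)) ≠ 0 := by positivity
            field_simp
            ring


lemma prod_max_div (τ S : ℕ) (hτ : 1 ≤ τ) :
    ∏ r ∈ Finset.range (τ * (S + 1)), max 1 (r / τ) = (S.factorial) ^ τ := by
  induction S with
  | zero =>
    simp only [zero_add, mul_one, Nat.factorial_zero, one_pow]
    refine Finset.prod_eq_one fun r hr => ?_
    rw [Finset.mem_range] at hr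
    rw [Nat.div_eq_of_lt hr]; rfl
  | succ S ih =>
    rw [mul_add, mul_one, Finset.prod_range_add, ih, Nat.factorial_succ, mul_pow, mul_comm]
    congr 1
    rw [Finset.prod_congr rfl (g := fun _ => S + 1)]
    · simp
    · intro r hr
      rw [Finset.mem_range] at hr
      rw [Nat.mul_add_div (by omega), Nat.div_eq_of_lt hr]
      omega

lemma multW_full (τ S s : ℕ) (hτ : 1 ≤ τ) (hs : s < S) : multW τ 0 (τ * S - 1) s = τ := by
  unfold multW
  have : ((Finset.Icc 0 (0 + (τ * S - 1))).filter (fun r => r / τ = s)) =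
      (Finset.range τ).map (addLeftEmbedding (τ * s)) := by
    ext r
    have hS : τ * (s + 1) ≤ τ * S := Nat.mul_le_mul_left _ hs
    rw [mul_add] at hS
    simp only [Finset.mem_filter, Finset.mem_Icc, Finset.mem_map, Finset.mem_range, addLeftEmbedding_apply]
    constructor
    · rintro ⟨_, h⟩
      have h1 := Nat.div_add_mod r τ
      have h2 := Nat.mod_lt r (show 0 < τ by omega)
      rw [h] at h1
      exact ⟨r % τ, h2, h1⟩
    · rintro ⟨a, ha, rfl⟩
      refine ⟨by omega, ?_⟩
      rw [Nat.mul_add_div (by omega), Nat.div_eq_of_lt ha]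
      omega
  rw [this]
  simp

open Polynomial in
lemma iterate_derivative_eval_eq (P : ℝ[X]) (i : ℕ) (s : ℝ) :
    (derivative^[i] P).eval s = i.factorial * (taylor s P).coeff i := by
  rw [taylor_coeff, ← Polynomial.factorial_smul_hasseDeriv]
  simp

open Polynomial in
lemma taylor_coeff_eq_of_dvd (P Q : ℝ[X]) (s : ℝ) (k i : ℕ) (hi : i < k)
    (h : (X - C s) ^ k ∣ P - Q) : (taylor s P).coeff i = (taylor s Q).coeff i := by
  obtain ⟨R, hR⟩ := h
  have h1 : taylor s P - taylor s Q = X ^ k * taylor s R := by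
    rw [← map_sub, hR, taylor_mul, taylor_pow]
    simp
  have h2 := congrArg (fun p => coeff p i) h1
  simp only [coeff_sub, coeff_X_pow_mul', if_neg (not_le.2 hi)] at h2
  linarith

open Polynomial in
lemma taylor_poly_facts (F : ℕ → ℝ → ℝ) (s : ℝ) (τ i : ℕ) (hi : i < τ) :
    (taylor s (∑ j ∈ Finset.range τ, C (F j s / j.factorial) * (X - C s) ^ j)).coeff i =
      F i s / i.factorial := by
  rw [map_sum, finsetSum_coeff]
  rw [Finset.sum_eq_single i]
  · simp [taylor_mul, taylor_pow]
  · intro j _ hj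
    simp [taylor_mul, taylor_pow, coeff_X_pow, hj.symm]
  · intro h
    exact absurd (Finset.mem_range.2 hi) h

open Polynomial in
theorem approx_schwarz (F : ℕ → ℝ → ℝ) (hF : ∀ i x, HasDerivAt (F i) (F (i + 1) x) x)
    (τ S : ℕ) (hτ : 1 ≤ τ) (hS : 1 ≤ S) (S' : ℝ) (hSS' : (S:ℝ) ≤ S') (ε M : ℝ)
    (hε : ∀ s : ℕ, s < S → ∀ i < τ, |F i s| ≤ ε * i.factorial)
    (hM : ∀ ξ, 0 ≤ ξ → ξ ≤ S' → |F (τ * S) ξ| ≤ M * (τ * S).factorial)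
    (x : ℝ) (hx : 0 ≤ x) (hx' : x ≤ S') :
    |F 0 x| ≤ M * S' ^ (τ * S) + τ * ε * Real.exp (4 * S' * τ) := by
  have hS1 : (1:ℝ) ≤ S := by exact_mod_cast hS
  have hS'1 : 1 ≤ S' := hS1.trans hSS'
  have hε0 : 0 ≤ ε := by
    have := (abs_nonneg _).trans (hε 0 (by omega) 0 (by omega))
    simpa using this
  have hM0 : 0 ≤ M := by
    have := (abs_nonneg _).trans (hM 0 le_rfl (by linarith))
    have hp : (0:ℝ) < (τ * S).factorial := by positivity
    exact nonneg_of_mul_nonneg_left this hp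
  have hn1 : 1 ≤ τ * S := Nat.mul_pos hτ hS
  let t : ℕ → ℝ[X] := fun s => ∑ j ∈ Finset.range τ, C (F j s / j.factorial) * (X - C (s:ℝ)) ^ j
  obtain ⟨P, hP1, hP2, hP3⟩ := neville τ hτ S' hS'1 t (τ * ε * S' ^ τ) (τ * S - 1) (by
      have : (τ * S - 1) / τ ≤ S := (Nat.div_le_div_right (by omega : τ * S - 1 ≤ τ * S)).trans
        (by rw [Nat.mul_div_cancel_left _ (by omega)])
      exact le_trans (by exact_mod_cast this) hSS') (by
      intro s k hs hk
      have hsS : s < S := by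
        by_contra h
        push Not at h
        have := Nat.mul_le_mul_left τ h
        rw [mul_comm s] at hs
        omega
      have hsS' : (s:ℝ) ≤ S' := le_trans (by exact_mod_cast hsS.le) hSS'
      refine ⟨∑ j ∈ Finset.range k, C (F j s / j.factorial) * (X - C (s:ℝ)) ^ j, ?_, ?_, ?_⟩
      · obtain ⟨m, rfl⟩ := Nat.exists_eq_add_of_le hk
        simp only [t]
        rw [Finset.sum_range_add, sub_add_eq_sub_sub, sub_self, zero_sub, dvd_neg]
        refine Finset.dvd_sum fun j _ => ?_
        rw [pow_add]
        exact ⟨C (F (k + j) s / (k + j).factorial) * (X - C (s:ℝ)) ^ j, by ring⟩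
      · refine natDegree_sum_le_of_forall_le _ _ fun j hj => ?_
        refine (natDegree_C_mul_le _ _).trans ?_
        rw [natDegree_pow, natDegree_X_sub_C]
        rw [Finset.mem_range] at hj
        omega
      · intro y hy hy'
        rw [eval_finsetSum]
        refine (Finset.abs_sum_le_sum_abs _ _).trans ?_
        have : ∀ j ∈ Finset.range k, |eval y (C (F j s / j.factorial) * (X - C (s:ℝ)) ^ j)| ≤ ε * S' ^ τ := by
          intro j hj
          rw [Finset.mem_range] at hj
          simp only [eval_mul, eval_C, eval_pow, eval_sub, eval_X, abs_mul, abs_pow, abs_div, Nat.abs_cast]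
          have h1 : |F j s| / j.factorial ≤ ε := by
            rw [div_le_iff₀ (by positivity)]
            exact hε s hsS j (by omega)
          have h2 : |y - s| ≤ S' := by
            have : (0:ℝ) ≤ s := Nat.cast_nonneg _
            rw [abs_le]; constructor <;> linarith
          calc |F j s| / j.factorial * |y - s| ^ j ≤ ε * S' ^ j := by gcongr
            _ ≤ ε * S' ^ τ := by
              gcongr ε * ?_
              exact pow_le_pow_right₀ hS'1 (by omega)
        refine (Finset.sum_le_card_nsmul _ _ _ this).trans ?_
        rw [Finset.card_range, nsmul_eq_mul, mul_assoc]
        gcongr) (τ * S - 1) 0 (by omega)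
  -- bound for P
  have hPb : ∀ y, 0 ≤ y → y ≤ S' → |P.eval y| ≤ τ * ε * Real.exp (4 * S' * τ) := by
    intro y hy hy'
    refine (hP3 y hy hy').trans ?_
    obtain ⟨S0, rfl⟩ : ∃ S0, S = S0 + 1 := ⟨S - 1, by omega⟩
    have hprod : ∏ r ∈ Finset.Icc 1 (τ * (S0 + 1) - 1), max 1 (r / τ) = S0.factorial ^ τ := by
      rw [← prod_max_div τ S0 hτ]
      rw [Finset.range_eq_Ico, Finset.prod_eq_prod_Ico_succ_bot (by omega)]
      simp only [Nat.zero_div, zero_add, max_eq_left (Nat.zero_le 1), one_mul]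
      apply Finset.prod_congr _ (fun _ _ => rfl)
      ext r
      simp
      omega
    rw [hprod, mul_assoc (τ * ε)]
    gcongr
    have e1 : (2 * S') ^ (τ * (S0 + 1) - 1) ≤ (2 * S') ^ (τ * (S0 + 1)) :=
      pow_le_pow_right₀ (by linarith) (by omega)
    have e2 : (2 * S') ^ S0 / S0.factorial ≤ Real.exp (2 * S') := Real.pow_div_factorial_le_exp _ (by positivity) _
    have e3 : (2 * S') ^ 2 / (Nat.factorial 2) ≤ Real.exp (2 * S') := Real.pow_div_factorial_le_exp _ (by positivity) _
    push_cast
    calc S' ^ τ * ((2 * S') ^ (τ * (S0 + 1) - 1) / (S0.factorial : ℝ) ^ τ)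
        ≤ S' ^ τ * ((2 * S') ^ (τ * (S0 + 1)) / (S0.factorial : ℝ) ^ τ) := by gcongr
      _ = (((2 * S') ^ 2 / (Nat.factorial 2)) * ((2 * S') ^ S0 / S0.factorial)) ^ τ := by
          rw [mul_comm τ (S0 + 1), pow_mul, ← div_pow, ← mul_pow]
          congr 1
          have : ((Nat.factorial 2 : ℕ) : ℝ) = 2 := by simp
          rw [this, pow_succ]
          field_simp
          try ring
      _ ≤ (Real.exp (2 * S') * Real.exp (2 * S')) ^ τ := by gcongr
      _ = Real.exp (4 * S' * τ) := by
          rw [← Real.exp_add, ← Real.exp_nat_mul]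
          ring_nf
  have hmatch : ∀ s : ℕ, s < S → ∀ i < τ, (derivative^[i] P).eval (s:ℝ) = F i s := by
    intro s hs i hi
    have h1 := hP1 s
    rw [multW_full τ S s hτ hs] at h1
    rw [iterate_derivative_eval_eq, taylor_coeff_eq_of_dvd _ _ _ _ _ hi h1, taylor_poly_facts _ _ _ _ hi]
    field_simp
  let ω : ℝ[X] := ∏ s ∈ Finset.range S, (X - C (s:ℝ)) ^ τ
  have hωd : ω.natDegree = τ * S := by
    simp only [ω]
    rw [natDegree_prod _ _ (fun s _ => pow_ne_zero _ (X_sub_C_ne_zero _))]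
    rw [Finset.sum_congr rfl (g := fun _ => τ), Finset.sum_const, Finset.card_range, smul_eq_mul, mul_comm]
    intro s _
    rw [natDegree_pow, natDegree_X_sub_C, mul_one]
  have hωm : ω.Monic := monic_prod_of_monic _ _ fun s _ => (monic_X_sub_C _).pow _
  have hωz : ∀ s : ℕ, s < S → ∀ i < τ, (derivative^[i] ω).eval (s:ℝ) = 0 := by
    intro s hs i hi
    have h1 : (X - C (s:ℝ)) ^ τ ∣ ω - 0 := by
      rw [sub_zero]
      exact Finset.dvd_prod_of_mem (fun s : ℕ => (X - C (s:ℝ)) ^ τ) (Finset.mem_range.2 hs)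
    rw [iterate_derivative_eval_eq, taylor_coeff_eq_of_dvd _ _ _ _ _ hi h1]
    simp
  have hωb : |ω.eval x| ≤ S' ^ (τ * S) := by
    simp only [ω, eval_prod, Finset.abs_prod]
    refine (Finset.prod_le_prod (g := fun _ => S' ^ τ) (fun _ _ => abs_nonneg _) ?_).trans ?_
    · intro s hs
      rw [Finset.mem_range] at hs
      simp only [eval_pow, eval_sub, eval_X, eval_C, abs_pow]
      have : (0:ℝ) ≤ s := Nat.cast_nonneg _
      have hsS' : (s:ℝ) ≤ S' := le_trans (by exact_mod_cast hs.le) hSS'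
      gcongr
      rw [abs_le]; constructor <;> linarith
    · rw [Finset.prod_const, Finset.card_range, ← pow_mul]
  by_cases hω0 : ω.eval x = 0
  · -- x is a node
    obtain ⟨s, hs, hxs⟩ : ∃ s, s < S ∧ x = s := by
      simp only [ω, eval_prod, Finset.prod_eq_zero_iff, Finset.mem_range] at hω0
      obtain ⟨s, hs, h⟩ := hω0
      simp only [eval_pow, eval_sub, eval_X, eval_C] at h
      exact ⟨s, hs, by have := pow_eq_zero_iff (by omega) |>.1 h; linarith⟩
    have h1 := hmatch s hs 0 (by omega)
    rw [hxs, ← h1]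
    have h2 := hPb s (by rw [← hxs]; exact hx) (by rw [← hxs]; exact hx')
    have : 0 ≤ M * S' ^ (τ * S) := by positivity
    simp only [Function.iterate_zero, id] at *
    linarith
  · set c : ℝ := (F 0 x - P.eval x) / ω.eval x with hc
    let G : ℕ → ℝ → ℝ := fun i y => F i y - (derivative^[i] P).eval y - c * (derivative^[i] ω).eval y
    have hG : ∀ i y, HasDerivAt (G i) (G (i + 1) y) y := by
      intro i y
      have h1 := (derivative^[i] P).hasDerivAt y
      have h2 := (derivative^[i] ω).hasDerivAt y
      rw [← Function.iterate_succ_apply' derivative] at h1 h2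
      exact ((hF i y).fun_sub h1).fun_sub (h2.const_mul c)
    classical
    let Z0 : Finset ℝ := (Finset.range S).image (fun s : ℕ => (s:ℝ))
    have hxZ : x ∉ Z0 := by
      intro h
      obtain ⟨s, hs, rfl⟩ := Finset.mem_image.1 h
      apply hω0
      have := hωz s (Finset.mem_range.1 hs) 0 (by omega)
      simpa using this
    obtain ⟨ξ, hξ1, hξ2, hξ3⟩ := gen_rolle 0 S' (τ * S) G hG (insert x Z0)
      (fun z => if z = x then 1 else τ) (by
        intro z hz i hi
        rcases Finset.mem_insert.1 hz with rfl | hz'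
        · simp at hi
          subst hi
          simp only [G, hc, Function.iterate_zero, id]
          rw [div_mul_cancel₀ _ hω0]
          ring
        · have hzx : z ≠ x := by rintro rfl; exact hxZ hz'
          rw [if_neg hzx] at hi
          obtain ⟨s, hs, rfl⟩ := Finset.mem_image.1 hz'
          rw [Finset.mem_range] at hs
          simp only [G]
          rw [hmatch s hs i hi, hωz s hs i hi]
          ring) (by
        rw [Finset.sum_insert hxZ, if_pos rfl, Finset.sum_congr rfl (g := fun _ => τ), Finset.sum_const,
          Finset.card_image_of_injective _ Nat.cast_injective, Finset.card_range, smul_eq_mul]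
        · ring
        · intro z hz
          rw [if_neg]
          rintro rfl
          exact hxZ hz) (by
        intro z hz
        rcases Finset.mem_insert.1 hz with rfl | hz'
        · exact ⟨hx, hx'⟩
        · obtain ⟨s, hs, rfl⟩ := Finset.mem_image.1 hz'
          rw [Finset.mem_range] at hs
          exact ⟨Nat.cast_nonneg _, le_trans (by exact_mod_cast hs.le) hSS'⟩)
    have d1 : derivative^[τ * S] P = 0 := iterate_derivative_eq_zero (by omega)
    have d2 : (derivative^[τ * S] ω).eval ξ = (τ * S).factorial := by
      have h1 : (derivative^[τ * S] ω).natDegree = 0 := by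
        have := natDegree_iterate_derivative ω (τ * S)
        omega
      rw [eq_C_of_natDegree_eq_zero h1, eval_C, coeff_iterate_derivative, zero_add]
      rw [← hωd, hωm.coeff_natDegree]
      simp [Nat.descFactorial_self]
    simp only [G] at hξ3
    rw [d1, d2] at hξ3
    have hF' : F (τ * S) ξ = c * (τ * S).factorial := by
      simp at hξ3
      linarith
    have hcM : |c| ≤ M := by
      have := hM ξ hξ1 hξ2
      rw [hF', abs_mul, Nat.abs_cast] at this
      have hp : (0:ℝ) < (τ * S).factorial := by positivity
      exact le_of_mul_le_mul_right this hp
    have hdiff : F 0 x = c * ω.eval x + P.eval x := by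
      rw [hc, div_mul_cancel₀ _ hω0]; ring
    rw [hdiff]
    refine (abs_add_le _ _).trans ?_
    rw [abs_mul]
    have := hPb x hx hx'
    gcongr


open Polynomial in
noncomputable def binP (k : ℕ) : ℝ[X] := C ((k.factorial : ℝ)⁻¹) * ∏ i ∈ Finset.range k, (X - C (i:ℝ))

noncomputable def qF (s n : ℕ) : Polynomial ℝ := binP s ^ (n / s) * binP (n % s)

open Polynomial in
lemma binP_natDegree (k : ℕ) : (binP k).natDegree = k := by
  unfold binP
  rw [natDegree_C_mul (by positivity), natDegree_prod _ _ (fun i _ => X_sub_C_ne_zero _)]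
  rw [Finset.sum_congr rfl (g := fun _ => 1)]
  · simp
  · intro i _
    exact natDegree_X_sub_C _

open Polynomial in
lemma binP_ne_zero (k : ℕ) : binP k ≠ 0 := by
  unfold binP
  refine mul_ne_zero (by rw [Ne, C_eq_zero]; positivity) ?_
  exact Finset.prod_ne_zero_iff.2 fun i _ => X_sub_C_ne_zero _

lemma qF_ne_zero (s n : ℕ) : qF s n ≠ 0 :=
  mul_ne_zero (pow_ne_zero _ (binP_ne_zero _)) (binP_ne_zero _)

lemma qF_natDegree (s n : ℕ) : (qF s n).natDegree = n := by
  unfold qF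
  rw [Polynomial.natDegree_mul (pow_ne_zero _ (binP_ne_zero _)) (binP_ne_zero _), Polynomial.natDegree_pow,
    binP_natDegree, binP_natDegree, mul_comm]
  exact Nat.div_add_mod n s

/-- integrality after scaling by `d`, at every natural number -/
def IsZ (d : ℕ) (q : Polynomial ℝ) : Prop :=
  ∀ s : ℕ, ∃ g : Polynomial ℤ, (Polynomial.taylor (s:ℝ) q).comp (Polynomial.C (d:ℝ) * Polynomial.X) =
    g.map (Int.castRingHom ℝ)

lemma IsZ.mul {d : ℕ} {p q : Polynomial ℝ} (hp : IsZ d p) (hq : IsZ d q) : IsZ d (p * q) := by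
  intro s
  obtain ⟨g, hg⟩ := hp s
  obtain ⟨g', hg'⟩ := hq s
  exact ⟨g * g', by rw [Polynomial.taylor_mul, Polynomial.mul_comp, hg, hg', Polynomial.map_mul]⟩

lemma IsZ.one (d : ℕ) : IsZ d 1 := fun s => ⟨1, by simp⟩

lemma IsZ.pow {d : ℕ} {p : Polynomial ℝ} (hp : IsZ d p) (n : ℕ) : IsZ d (p ^ n) := by
  induction n with
  | zero => simpa using IsZ.one d
  | succ n ih => rw [pow_succ]; exact ih.mul hp

lemma IsZ.coeff {d : ℕ} {q : Polynomial ℝ} (hq : IsZ d q) (s t : ℕ) :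
    ∃ z : ℤ, (d:ℝ) ^ t * (Polynomial.hasseDeriv t q).eval (s:ℝ) = z := by
  obtain ⟨g, hg⟩ := hq s
  refine ⟨g.coeff t, ?_⟩
  have := congrArg (fun p => Polynomial.coeff p t) hg
  simp only [Polynomial.comp_C_mul_X_coeff, Polynomial.taylor_coeff, Polynomial.coeff_map] at this
  rw [mul_comm, this]
  simp

open Polynomial in
lemma taylor_prod' {ι : Type*} (r : ℝ) (s : Finset ι) (f : ι → ℝ[X]) :
    taylor r (∏ i ∈ s, f i) = ∏ i ∈ s, taylor r (f i) := map_prod (taylorAlgHom r) f s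

open Polynomial in
lemma binP_pascal (k : ℕ) : taylor (1:ℝ) (binP (k + 1)) = binP (k + 1) + binP k := by
  unfold binP
  rw [taylor_mul, taylor_C, taylor_prod']
  have h1 : ∏ i ∈ Finset.range (k + 1), taylor (1:ℝ) (X - C (i:ℝ)) =
      (∏ i ∈ Finset.range k, (X - C (i:ℝ))) * (X + C 1) := by
    rw [Finset.prod_range_succ']
    congr 1
    · refine Finset.prod_congr rfl fun i _ => ?_
      rw [map_sub, taylor_X, taylor_C]
      push_cast
      rw [C_add]; ring
    · simp
  rw [h1, Finset.prod_range_succ]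
  have h2 : C (((k+1).factorial : ℝ)⁻¹) * (C (k:ℝ) + C 1) = C ((k.factorial : ℝ)⁻¹) := by
    rw [← C_add, ← C_mul]
    congr 1
    rw [Nat.factorial_succ]
    push_cast
    have : (k.factorial : ℝ) ≠ 0 := by positivity
    field_simp
  linear_combination (∏ i ∈ Finset.range k, (X - C (i:ℝ))) * h2

open Polynomial in
lemma binP_isZ (d S k : ℕ) (hd : ∀ i, 1 ≤ i → i ≤ S → i ∣ d) (hk : k ≤ S) : IsZ d (binP k) := by
  intro s
  induction s generalizing k with
  | zero =>
    simp only [Nat.cast_zero, taylor_zero]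
    cases k with
    | zero => exact ⟨1, by simp [binP]⟩
    | succ k =>
      refine ⟨C ((d / (k+1) : ℕ) : ℤ) * X * ∏ i ∈ Finset.range k, (C ((d / (i+1) : ℕ) : ℤ) * X - 1), ?_⟩
      unfold binP
      have hdiv : ∀ i, i + 1 ≤ S → (C (d:ℝ)) = C ((i:ℝ) + 1) * C ((d / (i+1) : ℕ):ℝ) := by
        intro i hi
        rw [← C_mul]
        congr 1
        have := Nat.mul_div_cancel' (hd (i+1) (by omega) hi)
        exact_mod_cast this.symm
      rw [Finset.prod_range_succ']
      simp only [mul_comp, C_comp, prod_comp, sub_comp, X_comp, Nat.cast_zero, map_zero, sub_zero,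
        Polynomial.map_mul, Polynomial.map_prod, Polynomial.map_sub, map_C, map_X, Polynomial.map_one]
      have h1 : ∏ i ∈ Finset.range k, (C (d:ℝ) * X - C ((i + 1 : ℕ):ℝ)) =
          C (k.factorial : ℝ) * ∏ i ∈ Finset.range k, (C ((d / (i+1) : ℕ) : ℝ) * X - 1) := by
        rw [← Finset.prod_range_add_one_eq_factorial, Nat.cast_prod]
        rw [map_prod, ← Finset.prod_mul_distrib]
        refine Finset.prod_congr rfl fun i hi => ?_
        rw [Finset.mem_range] at hi
        rw [hdiv i (by omega), Nat.cast_add, Nat.cast_one]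
        ring
      have h3 : ∀ x : ℕ, (Int.castRingHom ℝ) (x : ℤ) = (x : ℝ) := fun x => by simp
      simp only [h3]
      rw [h1, hdiv k hk]
      have h2 : C (((k+1).factorial : ℝ)⁻¹) * (C (k.factorial : ℝ)) * C ((k:ℝ) + 1) = 1 := by
        rw [← C_mul, ← C_mul, ← C_1]
        congr 1
        rw [Nat.factorial_succ]
        push_cast
        have : (k.factorial : ℝ) ≠ 0 := by positivity
        field_simp
      linear_combination ((∏ i ∈ Finset.range k, (C ((d / (i+1) : ℕ):ℝ) * X - 1)) * C ((d / (k+1) : ℕ):ℝ) * X) * h2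
  | succ s ih =>
    cases k with
    | zero => exact ⟨1, by simp [binP]⟩
    | succ k =>
      obtain ⟨g, hg⟩ := ih (k + 1) hk
      obtain ⟨g', hg'⟩ := ih k (by omega)
      refine ⟨g + g', ?_⟩
      push_cast
      rw [← taylor_taylor, binP_pascal, map_add, add_comp, hg, hg', Polynomial.map_add]

lemma qF_isZ (d S n : ℕ) (hS : 1 ≤ S) (hd : ∀ i, 1 ≤ i → i ≤ S → i ∣ d) : IsZ d (qF S n) :=
  ((binP_isZ d S S hd le_rfl).pow _).mul (binP_isZ d S _ hd (Nat.mod_lt _ (by omega)).le)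

/-- majorant relation -/
def Maj (p P : Polynomial ℝ) : Prop := ∀ i, |p.coeff i| ≤ P.coeff i

lemma Maj.mul {p q P Q : Polynomial ℝ} (hp : Maj p P) (hq : Maj q Q) : Maj (p * q) (P * Q) := by
  intro i
  rw [Polynomial.coeff_mul, Polynomial.coeff_mul]
  refine (Finset.abs_sum_le_sum_abs _ _).trans (Finset.sum_le_sum fun x _ => ?_)
  rw [abs_mul]
  exact mul_le_mul (hp _) (hq _) (abs_nonneg _) ((abs_nonneg _).trans (hp _))

lemma Maj.one : Maj 1 1 := by
  intro i
  rw [Polynomial.coeff_one]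
  split_ifs <;> simp

lemma Maj.pow {p P : Polynomial ℝ} (hp : Maj p P) (n : ℕ) : Maj (p ^ n) (P ^ n) := by
  induction n with
  | zero => simpa using Maj.one
  | succ n ih => rw [pow_succ, pow_succ]; exact ih.mul hp

lemma Maj.prod {ι : Type*} (s : Finset ι) (f : ι → Polynomial ℝ) (P : Polynomial ℝ) (h : ∀ i ∈ s, Maj (f i) P) :
    Maj (∏ i ∈ s, f i) (P ^ s.card) := by
  classical
  induction s using Finset.induction_on with
  | empty => simpa using Maj.one
  | insert a s ha ih =>
    rw [Finset.prod_insert ha, Finset.card_insert_of_notMem ha, pow_succ, mul_comm]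
    exact (ih fun i hi => h i (Finset.mem_insert_of_mem hi)).mul (h a (Finset.mem_insert_self _ _))

lemma Maj.bound {p P : Polynomial ℝ} (hp : Maj p P) (ρ : ℝ) (hρ : 0 ≤ ρ) (i : ℕ) :
    |p.coeff i| * ρ ^ i ≤ P.eval ρ := by
  have hP : ∀ j, 0 ≤ P.coeff j := fun j => (abs_nonneg _).trans (hp j)
  by_cases hi : i ∈ P.support
  · rw [Polynomial.eval_eq_sum, Polynomial.sum]
    refine le_trans ?_ (Finset.single_le_sum (f := fun j => P.coeff j * ρ ^ j) (fun j _ => by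
      have := hP j; positivity) hi)
    have := hp i
    show _ ≤ P.coeff i * ρ ^ i
    gcongr
  · have h0 : P.coeff i = 0 := by simpa using hi
    have h1 : |p.coeff i| ≤ 0 := h0 ▸ hp i
    have h2 : 0 ≤ P.eval ρ := by
      rw [Polynomial.eval_eq_sum, Polynomial.sum]
      exact Finset.sum_nonneg fun j _ => by have := hP j; positivity
    have h3 : |p.coeff i| = 0 := le_antisymm h1 (abs_nonneg _)
    rw [h3, zero_mul]; exact h2

open Polynomial in
lemma binP_maj (k : ℕ) (S' ξ : ℝ) (hk : (k:ℝ) ≤ S') (h0 : 0 ≤ ξ) (h1 : ξ ≤ S') :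
    Maj (taylor ξ (binP k)) (C ((k.factorial:ℝ)⁻¹) * (X + C S') ^ k) := by
  unfold binP
  rw [taylor_mul, taylor_C, taylor_prod']
  refine Maj.mul ?_ ?_
  · intro i
    rw [coeff_C]
    split_ifs
    · rw [abs_of_nonneg (by positivity)]
    · simp
  · have := Maj.prod (Finset.range k) (fun i => taylor ξ (X - C (i:ℝ))) (X + C S') (by
      intro i hi
      rw [Finset.mem_range] at hi
      have hi' : (i:ℝ) ≤ k := by exact_mod_cast hi.le
      have hi0 : (0:ℝ) ≤ i := by positivity
      intro j
      rw [map_sub, taylor_X, taylor_C, add_sub_assoc, ← C_sub, coeff_add, coeff_add, coeff_C, coeff_C, coeff_X]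
      rcases j with _ | j
      · simp
        rw [abs_le]; constructor <;> linarith
      · simp only [Nat.add_eq_zero_iff, one_ne_zero, and_false, if_false, add_zero]
        split_ifs <;> simp)
    simpa using this

lemma qF_bound (S n : ℕ) (hS : 1 ≤ S) (S' ξ : ℝ) (hSS : (S:ℝ) ≤ S') (h0 : 0 ≤ ξ) (h1 : ξ ≤ S') (i : ℕ) :
    |(Polynomial.hasseDeriv i (qF S n)).eval ξ| * S' ^ i ≤ (2 * S' / S) ^ n * Real.exp (n + S) := by
  have hSp : (0:ℝ) < S := by exact_mod_cast hS
  have hmod : (n % S : ℕ) ≤ S := (Nat.mod_lt _ (by omega)).le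
  have hmaj := ((binP_maj S S' ξ hSS h0 h1).pow (n / S)).mul (binP_maj (n % S) S' ξ
      (le_trans (by exact_mod_cast hmod) hSS) h0 h1)
  rw [← Polynomial.taylor_pow, ← Polynomial.taylor_mul] at hmaj
  change Maj (Polynomial.taylor ξ (qF S n)) _ at hmaj
  have := hmaj.bound S' (by linarith) i
  rw [Polynomial.taylor_coeff] at this
  refine this.trans ?_
  simp only [Polynomial.eval_mul, Polynomial.eval_pow, Polynomial.eval_C, Polynomial.eval_add, Polynomial.eval_X]
  have hS' : 0 ≤ S' := by linarith
  have key : ∀ k : ℕ, k ≤ S → ((k.factorial:ℝ)⁻¹) * (S' + S') ^ k ≤ (2 * S' / S) ^ k * Real.exp S := by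
    intro k hk
    have h := Real.pow_div_factorial_le_exp (S:ℝ) (by positivity) k
    calc ((k.factorial:ℝ)⁻¹) * (S' + S') ^ k = (2 * S' / S) ^ k * ((S:ℝ) ^ k / k.factorial) := by
          rw [div_pow, ← two_mul]; field_simp
      _ ≤ _ := by gcongr
  calc _ ≤ ((2 * S' / S) ^ S * Real.exp S) ^ (n / S) * ((2 * S' / S) ^ (n % S) * Real.exp S) := by
        refine mul_le_mul (pow_le_pow_left₀ (by positivity) (key S le_rfl) _) (key _ hmod)
          (by positivity) (by positivity)
    _ = (2 * S' / S) ^ n * Real.exp (S * (n / S : ℕ) + S) := by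
        rw [mul_pow, ← pow_mul, ← Real.exp_nat_mul, Real.exp_add, mul_comm ((n / S : ℕ):ℝ)]
        have : (2 * S' / S) ^ n = (2 * S' / S) ^ (S * (n/S)) * (2 * S' / S) ^ (n % S) := by
          rw [← pow_add, Nat.div_add_mod]
        rw [this]; ring
    _ ≤ _ := by
        gcongr
        have : S * (n / S) ≤ n := Nat.mul_div_le n S
        exact_mod_cast this


open Polynomial in
noncomputable def opW (w : ℝ) : Module.End ℝ ℝ[X] := derivative + w • (1 : Module.End ℝ ℝ[X])

open Polynomial in
lemma opW_apply (w : ℝ) (P : ℝ[X]) : opW w P = derivative P + C w * P := by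
  simp [opW, smul_eq_C_mul]

open Polynomial in
lemma opW_hasDerivAt (w : ℝ) (P : ℝ[X]) (k : ℕ) (z : ℝ) :
    HasDerivAt (fun z => ((opW w ^ k) P).eval z * Real.exp (w * z))
      (((opW w ^ (k + 1)) P).eval z * Real.exp (w * z)) z := by
  have h1 := ((opW w ^ k) P).hasDerivAt z
  have h2 : HasDerivAt (fun z => Real.exp (w * z)) (Real.exp (w * z) * w) z := by
    have := ((hasDerivAt_id z).const_mul w).exp
    simpa using this
  refine (h1.fun_mul h2).congr_deriv ?_
  rw [pow_succ', Module.End.mul_apply, opW_apply]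
  simp only [eval_add, eval_mul, eval_C]
  ring

open Polynomial in
lemma opW_pow_apply (w : ℝ) (P : ℝ[X]) (k : ℕ) :
    (opW w ^ k) P = ∑ j ∈ Finset.range (k + 1), C (k.factorial * (w ^ (k - j) / (k - j).factorial)) * hasseDeriv j P := by
  have hc : Commute (derivative : Module.End ℝ ℝ[X]) (w • (1 : Module.End ℝ ℝ[X])) :=
    (Commute.one_right _).smul_right w
  unfold opW
  rw [hc.add_pow, LinearMap.sum_apply]
  refine Finset.sum_congr rfl fun j hj => ?_
  rw [Finset.mem_range] at hj
  have h1 : ((derivative : Module.End ℝ ℝ[X]) ^ j) P = C (j.factorial : ℝ) * hasseDeriv j P := by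
    have := congrArg (fun f => f P) (factorial_smul_hasseDeriv (R := ℝ) (k := j))
    simp only [LinearMap.smul_apply, Pi.smul_apply] at this
    rw [Module.End.pow_apply, ← this]
    simp [nsmul_eq_mul]
  have h2 : ((derivative : Module.End ℝ ℝ[X]) ^ j * (w • (1 : Module.End ℝ ℝ[X])) ^ (k - j) * ((k.choose j : ℕ) : Module.End ℝ ℝ[X])) P
      = C ((k.choose j : ℝ) * w ^ (k - j)) * ((derivative : Module.End ℝ ℝ[X]) ^ j) P := by
    rw [_root_.smul_pow, one_pow, ← nsmul_one (k.choose j), ← Nat.cast_smul_eq_nsmul ℝ]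
    simp only [mul_smul_comm, mul_one, LinearMap.smul_apply, smul_eq_C_mul, C_mul, mul_assoc]
  rw [h2, h1, ← mul_assoc, ← C_mul]
  congr 2
  have := Nat.choose_mul_factorial_mul_factorial (show j ≤ k by omega)
  have h3 : ((k.choose j : ℝ) * j.factorial * (k - j).factorial) = k.factorial := by exact_mod_cast this
  rw [← h3]
  have : ((k - j).factorial : ℝ) ≠ 0 := by positivity
  field_simp

open Polynomial in
lemma opW_bound (w W S' Q Y z : ℝ) (q : ℝ[X]) (D k t0 : ℕ) (hq : q.natDegree < D) (hw : |w| ≤ W) (hS' : 1 ≤ S')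
    (hQ : ∀ t, |(hasseDeriv t q).eval z| * S' ^ t ≤ Q)
    (hY : ∀ j, j < D → j ≤ k → (W * S') ^ (k - j) / (k - j).factorial ≤ Y) :
    |((opW w ^ k) (hasseDeriv t0 q)).eval z| * S' ^ k ≤ k.factorial * (D * 2 ^ D * Q * Y) := by
  have hQ0 : 0 ≤ Q := le_trans (by positivity) (hQ 0)
  have hW : 0 ≤ W := (abs_nonneg _).trans hw
  have hY0 : 0 ≤ Y := le_trans (by positivity) (hY 0 (by omega) (by omega))
  rw [opW_pow_apply, eval_finsetSum]
  have hterm : ∀ j ∈ Finset.range (k + 1),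
      |eval z (C (k.factorial * (w ^ (k - j) / (k - j).factorial)) * hasseDeriv j (hasseDeriv t0 q))| * S' ^ k
      ≤ if j < D then k.factorial * (2 ^ D * Q * Y) else 0 := by
    intro j hj
    rw [Finset.mem_range] at hj
    have hcomp : hasseDeriv j (hasseDeriv t0 q) = ((j + t0).choose j : ℝ) • hasseDeriv (j + t0) q := by
      have := congrArg (fun f => f q) (hasseDeriv_comp (R := ℝ) j t0)
      simp only [LinearMap.comp_apply, LinearMap.smul_apply] at this
      rw [this, Nat.cast_smul_eq_nsmul]
    rw [hcomp]
    simp only [eval_mul, eval_C, eval_smul, smul_eq_mul, abs_mul, abs_div, abs_pow, Nat.abs_cast]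
    by_cases hD : j + t0 < D
    · rw [if_pos (by omega)]
      have e1 : ((j + t0).choose j : ℝ) ≤ 2 ^ D := by
        have h1 : (j + t0).choose j ≤ 2 ^ (j + t0) := Nat.choose_le_two_pow _ _
        have h2 : 2 ^ (j + t0) ≤ 2 ^ D := Nat.pow_le_pow_right (by norm_num) hD.le
        exact_mod_cast h1.trans h2
      have e2 : |eval z (hasseDeriv (j + t0) q)| * S' ^ j ≤ Q := by
        refine le_trans ?_ (hQ (j + t0))
        gcongr ?_ * ?_
        exact pow_le_pow_right₀ hS' (by omega)
      have e3 : S' ^ k = S' ^ j * S' ^ (k - j) := by rw [← pow_add]; congr 1; omega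
      have e4 : |w| ^ (k - j) * S' ^ (k - j) / (k - j).factorial ≤ Y := by
        refine le_trans ?_ (hY j (by omega) (by omega))
        rw [mul_pow]
        gcongr
      calc _ = (k.factorial : ℝ) * (((j + t0).choose j : ℝ) * (|eval z (hasseDeriv (j + t0) q)| * S' ^ j) *
              (|w| ^ (k - j) * S' ^ (k - j) / (k - j).factorial)) := by rw [e3]; ring
        _ ≤ (k.factorial : ℝ) * (2 ^ D * Q * Y) := by gcongr
    · have : hasseDeriv (j + t0) q = 0 := hasseDeriv_eq_zero_of_lt_natDegree _ _ (by omega)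
      rw [this]
      simp only [eval_zero, abs_zero, mul_zero, zero_mul]
      split_ifs <;> positivity
  calc _ ≤ (∑ j ∈ Finset.range (k + 1),
      |eval z (C (k.factorial * (w ^ (k - j) / (k - j).factorial)) * hasseDeriv j (hasseDeriv t0 q))|) * S' ^ k := by
        gcongr
        exact Finset.abs_sum_le_sum_abs _ _
    _ ≤ ∑ j ∈ Finset.range (k + 1), if j < D then k.factorial * (2 ^ D * Q * Y) else 0 := by
        rw [Finset.sum_mul]
        exact Finset.sum_le_sum hterm
    _ ≤ D * (k.factorial * (2 ^ D * Q * Y)) := by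
        rw [← Finset.sum_filter, Finset.sum_const, nsmul_eq_mul]
        gcongr
        have : (Finset.range (k + 1)).filter (fun j => j < D) ⊆ Finset.range D := by
          intro j; simp
        simpa using Finset.card_le_card this
    _ = _ := by ring

open Polynomial in
lemma opW_node {ι : Type*} [Fintype ι] (pr u1 u2 : ι → ℝ) (q : ι → ℝ[X]) (Es : ι → ℝ) (β1 β2 : ℝ) (T : ℕ) (s : ℝ)
    (hV : ∀ t0 t1 t2, t0 + t1 + t2 < T →
      ∑ i, pr i * (hasseDeriv t0 (q i)).eval s * u1 i ^ t1 * u2 i ^ t2 * Es i = 0)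
    (k : ℕ) : ∀ t0 t1 t2, k + t0 + t1 + t2 < T →
      ∑ i, pr i * ((opW (-β1 * u1 i + β2 * u2 i) ^ k) (hasseDeriv t0 (q i))).eval s * u1 i ^ t1 * u2 i ^ t2 * Es i = 0 := by
  induction k with
  | zero => intro t0 t1 t2 h; simpa using hV t0 t1 t2 (by omega)
  | succ k ih =>
    intro t0 t1 t2 h
    have h1 := ih (t0 + 1) t1 t2 (by omega)
    have h2 := ih t0 (t1 + 1) t2 (by omega)
    have h3 := ih t0 t1 (t2 + 1) (by omega)
    have hd : ∀ i, derivative (hasseDeriv t0 (q i)) = ((t0 + 1 : ℕ) : ℝ) • hasseDeriv (t0 + 1) (q i) := by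
      intro i
      have := congrArg (fun f => f (q i)) (hasseDeriv_comp (R := ℝ) 1 t0)
      simp only [LinearMap.comp_apply, LinearMap.smul_apply, hasseDeriv_one] at this
      rw [this, Nat.cast_smul_eq_nsmul, add_comm 1 t0, Nat.choose_one_right]
    have : ∀ i, ((opW (-β1 * u1 i + β2 * u2 i) ^ (k+1)) (hasseDeriv t0 (q i))) =
        ((t0 + 1 : ℕ) : ℝ) • ((opW (-β1 * u1 i + β2 * u2 i) ^ k) (hasseDeriv (t0 + 1) (q i))) +
        (-β1 * u1 i + β2 * u2 i) • ((opW (-β1 * u1 i + β2 * u2 i) ^ k) (hasseDeriv t0 (q i))) := by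
      intro i
      rw [pow_succ, Module.End.mul_apply, opW_apply, hd, ← smul_eq_C_mul, map_add, map_smul, map_smul]
    simp only [this, eval_add, eval_smul, smul_eq_mul]
    calc _ = ((t0 + 1 : ℕ) : ℝ) * (∑ i, pr i * ((opW (-β1 * u1 i + β2 * u2 i) ^ k) (hasseDeriv (t0 + 1) (q i))).eval s * u1 i ^ t1 * u2 i ^ t2 * Es i)
        + (-β1) * (∑ i, pr i * ((opW (-β1 * u1 i + β2 * u2 i) ^ k) (hasseDeriv t0 (q i))).eval s * u1 i ^ (t1+1) * u2 i ^ t2 * Es i)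
        + β2 * (∑ i, pr i * ((opW (-β1 * u1 i + β2 * u2 i) ^ k) (hasseDeriv t0 (q i))).eval s * u1 i ^ t1 * u2 i ^ (t2+1) * Es i) := by
          rw [Finset.mul_sum, Finset.mul_sum, Finset.mul_sum, ← Finset.sum_add_distrib, ← Finset.sum_add_distrib]
          refine Finset.sum_congr rfl fun i _ => ?_
          ring
      _ = 0 := by rw [h1, h2, h3]; ring


lemma pow_div_fact_small (x : ℝ) (hx : 0 ≤ x) (m : ℕ) : x ^ m / m.factorial ≤ Real.exp (8 * x - 2 * m) := by
  have h := Real.pow_div_factorial_le_exp (Real.exp 2 * x) (by positivity) m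
  have he : Real.exp 2 ≤ 8 := by
    have h1 : Real.exp 2 = Real.exp 1 * Real.exp 1 := by rw [← Real.exp_add]; norm_num
    have := Real.exp_one_lt_d9
    have h2 := Real.exp_pos 1
    rw [h1]; nlinarith
  have h3 : x ^ m / m.factorial = Real.exp (-(2 * m)) * ((Real.exp 2 * x) ^ m / m.factorial) := by
    rw [mul_pow, ← Real.exp_nat_mul, ← mul_div_assoc, ← mul_assoc, ← Real.exp_add]
    have : -(2 * (m:ℝ)) + m * 2 = 0 := by ring
    rw [this, Real.exp_zero, one_mul]
  rw [h3]
  calc _ ≤ Real.exp (-(2 * m)) * Real.exp (Real.exp 2 * x) := by gcongr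
    _ = Real.exp (Real.exp 2 * x - 2 * m) := by rw [← Real.exp_add]; ring_nf
    _ ≤ _ := by
      gcongr

open Polynomial in
theorem extrap_abs {ι : Type*} [Fintype ι] (pr u1 u2 : ι → ℝ) (q : ι → ℝ[X]) (E : ι → ℕ → ℝ) (β1 β2 : ℝ)
    (T S S' τ D : ℕ) (P U Q W κ : ℝ) (hS : 1 ≤ S) (hSS' : S ≤ S') (hτ : 1 ≤ τ) (hD : 2 * D ≤ τ * S)
    (hq : ∀ i, (q i).natDegree < D) (hP : ∀ i, |pr i| ≤ P) (hU : 1 ≤ U) (hu1 : ∀ i, |u1 i| ≤ U) (hu2 : ∀ i, |u2 i| ≤ U)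
    (hW : ∀ i, |-β1 * u1 i + β2 * u2 i| ≤ W) (hW0 : 0 ≤ W) (hQ0 : 0 ≤ Q) (hP0 : 0 ≤ P) (hκ : 0 ≤ κ)
    (hQ : ∀ i, ∀ ξ : ℝ, 0 ≤ ξ → ξ ≤ S' → ∀ t, |(hasseDeriv t (q i)).eval ξ| * (S':ℝ) ^ t ≤ Q)
    (hE : ∀ i, ∀ s : ℕ, s ≤ S' → |Real.exp ((-β1 * u1 i + β2 * u2 i) * s) - E i s| ≤ Real.exp (W * S') * κ)
    (hV : ∀ s < S, ∀ t0 t1 t2, t0 + t1 + t2 < T →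
      ∑ i, pr i * (hasseDeriv t0 (q i)).eval (s:ℝ) * u1 i ^ t1 * u2 i ^ t2 * E i s = 0)
    (s : ℕ) (hs : s ≤ S') (t0 t1 t2 : ℕ) (ht : t0 + t1 + t2 + τ ≤ T) :
    |∑ i, pr i * (hasseDeriv t0 (q i)).eval (s:ℝ) * u1 i ^ t1 * u2 i ^ t2 * E i s| ≤
      Fintype.card ι * P * U ^ T * (D * 2 ^ D * Q) *
        (Real.exp (9 * (W * S') - τ * S) + (τ + 1) * Real.exp (4 * S' * τ + 2 * (W * S')) * κ) := by
  set w : ι → ℝ := fun i => -β1 * u1 i + β2 * u2 i with hw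
  have hS'1 : (1:ℝ) ≤ S' := by exact_mod_cast hS.trans hSS'
  set Y := (Fintype.card ι : ℝ) * P * U ^ T * (D * 2 ^ D * Q) with hY
  have hY0 : 0 ≤ Y := by positivity
  -- coefficient bound
  have hcoef : ∀ i, |pr i * (u1 i ^ t1 * u2 i ^ t2)| ≤ P * U ^ T := by
    intro i
    rw [abs_mul, abs_mul, abs_pow, abs_pow]
    have h1 : |u1 i| ^ t1 * |u2 i| ^ t2 ≤ U ^ T := by
      calc |u1 i| ^ t1 * |u2 i| ^ t2 ≤ U ^ t1 * U ^ t2 := by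
            gcongr
            · exact hu1 i
            · exact hu2 i
        _ = U ^ (t1 + t2) := by rw [pow_add]
        _ ≤ U ^ T := pow_le_pow_right₀ hU (by omega)
    exact mul_le_mul (hP i) h1 (by positivity) hP0
  -- general summation bound
  have hsum : ∀ (g : ι → ℝ) (B : ℝ), (∀ i, |g i| ≤ (D * 2 ^ D * Q) * B) → 
      |∑ i, pr i * (u1 i ^ t1 * u2 i ^ t2) * g i| ≤ Y * B := by
    intro g B hg
    refine (Finset.abs_sum_le_sum_abs _ _).trans ?_
    have : ∀ i ∈ Finset.univ, |pr i * (u1 i ^ t1 * u2 i ^ t2) * g i| ≤ P * U ^ T * ((D * 2 ^ D * Q) * B) := by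
      intro i _
      rw [abs_mul]
      exact mul_le_mul (hcoef i) (hg i) (abs_nonneg _) (by positivity)
    refine (Finset.sum_le_card_nsmul _ _ _ this).trans ?_
    rw [Finset.card_univ, nsmul_eq_mul, hY]
    apply le_of_eq; ring
  have hexpw : ∀ i, ∀ ξ : ℝ, 0 ≤ ξ → ξ ≤ S' → Real.exp (w i * ξ) ≤ Real.exp (W * S') := by
    intro i ξ h0 h1
    rw [Real.exp_le_exp]
    calc w i * ξ ≤ |w i| * ξ := by gcongr; exact le_abs_self _
      _ ≤ W * S' := by gcongr; exact hW i
  -- the functions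
  let F : ℕ → ℝ → ℝ := fun k z => ∑ i, pr i * (u1 i ^ t1 * u2 i ^ t2) *
    (((opW (w i) ^ k) (hasseDeriv t0 (q i))).eval z * Real.exp (w i * z))
  have hF : ∀ k z, HasDerivAt (F k) (F (k + 1) z) z := by
    intro k z
    exact HasDerivAt.fun_sum fun i _ => (opW_hasDerivAt (w i) _ k z).const_mul _
  -- small derivative size
  have hsmall : ∀ i (s : ℕ), s ≤ S' → ∀ k, |((opW (w i) ^ k) (hasseDeriv t0 (q i))).eval (s:ℝ)| ≤
      k.factorial * (D * 2 ^ D * Q * Real.exp (W * S')) := by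
    intro i s hs k
    have hs' : (s:ℝ) ≤ S' := by exact_mod_cast hs
    have h := opW_bound (w i) W S' Q (Real.exp (W * S')) s (q i) D k t0 (hq i) (hW i) hS'1
      (hQ i s (by positivity) hs')
      (fun j _ _ => Real.pow_div_factorial_le_exp _ (by positivity) _)
    refine le_trans ?_ h
    exact le_mul_of_one_le_right (abs_nonneg _) (one_le_pow₀ hS'1)
  have hnode : ∀ s : ℕ, s < S → ∀ k < τ, |F k s| ≤ (Y * (Real.exp (2 * (W * S')) * κ)) * k.factorial := by
    intro s hs k hk
    have h0 := opW_node pr u1 u2 q (fun i => E i s) β1 β2 T s (hV s hs) k t0 t1 t2 (by omega)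
    have hFe : F k s = ∑ i, pr i * (u1 i ^ t1 * u2 i ^ t2) *
        (((opW (w i) ^ k) (hasseDeriv t0 (q i))).eval (s:ℝ) * (Real.exp (w i * s) - E i s)) := by
      rw [← sub_zero (F k s), ← h0, ← Finset.sum_sub_distrib]
      refine Finset.sum_congr rfl fun i _ => ?_
      simp only [hw]
      ring
    rw [hFe]
    have := hsum (fun i => ((opW (w i) ^ k) (hasseDeriv t0 (q i))).eval (s:ℝ) * (Real.exp (w i * s) - E i s))
      (Real.exp (2 * (W * S')) * κ * k.factorial) (by
        intro i
        rw [abs_mul]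
        calc _ ≤ (k.factorial * (D * 2 ^ D * Q * Real.exp (W * S'))) * (Real.exp (W * S') * κ) := by
              gcongr
              · exact hsmall i s (by omega) k
              · exact hE i s (by omega)
          _ = _ := by
              rw [two_mul (W * (S':ℝ)), Real.exp_add]; ring)
    refine this.trans (le_of_eq (by ring))
  have hbig : ∀ ξ : ℝ, 0 ≤ ξ → ξ ≤ S' → |F (τ * S) ξ| ≤
      (Y * Real.exp (9 * (W * S') - τ * S) / (S':ℝ) ^ (τ * S)) * (τ * S).factorial := by
    intro ξ h0 h1
    have := hsum (fun i => ((opW (w i) ^ (τ * S)) (hasseDeriv t0 (q i))).eval ξ * Real.exp (w i * ξ))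
      (Real.exp (9 * (W * S') - τ * S) / (S':ℝ) ^ (τ * S) * (τ * S).factorial) (by
        intro i
        have h := opW_bound (w i) W S' Q (Real.exp (8 * (W * S') - (τ * S : ℕ))) ξ (q i) D (τ * S) t0 (hq i) (hW i) hS'1
          (hQ i ξ h0 h1)
          (fun j hj hj' => by
            refine (pow_div_fact_small _ (by positivity) _).trans ?_
            rw [Real.exp_le_exp]
            have : ((τ * S : ℕ):ℝ) ≤ 2 * ((τ * S - j : ℕ):ℝ) := by
              have : τ * S ≤ 2 * (τ * S - j) := by omega
              exact_mod_cast this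
            linarith)
        rw [abs_mul, abs_of_pos (Real.exp_pos _)]
        have hpos : (0:ℝ) < (S':ℝ) ^ (τ * S) := by positivity
        rw [← le_div_iff₀ hpos] at h
        calc _ ≤ ((τ * S).factorial * (D * 2 ^ D * Q * Real.exp (8 * (W * S') - (τ * S : ℕ))) / (S':ℝ) ^ (τ * S)) * Real.exp (W * S') :=
              mul_le_mul h (hexpw i ξ h0 h1) (Real.exp_pos _).le (by positivity)
          _ = D * 2 ^ D * Q * ((Real.exp (8 * (W * S') - (τ * S : ℕ)) * Real.exp (W * S')) / (S':ℝ) ^ (τ * S) * (τ * S).factorial) := by ring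
          _ = _ := by
              rw [← Real.exp_add]
              push_cast
              ring_nf)
    refine this.trans (le_of_eq (by ring))
  have hs' : (s:ℝ) ≤ S' := by exact_mod_cast hs
  have hmain := approx_schwarz F hF τ S hτ hS S' (by exact_mod_cast hSS') _ _ hnode hbig s (by positivity) hs'
  rw [div_mul_cancel₀ _ (by positivity)] at hmain
  have hdiff : |F 0 s - ∑ i, pr i * (hasseDeriv t0 (q i)).eval (s:ℝ) * u1 i ^ t1 * u2 i ^ t2 * E i s| ≤
      Y * (Real.exp (2 * (W * S')) * κ) := by
    have e : F 0 s - ∑ i, pr i * (hasseDeriv t0 (q i)).eval (s:ℝ) * u1 i ^ t1 * u2 i ^ t2 * E i s =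
        ∑ i, pr i * (u1 i ^ t1 * u2 i ^ t2) * ((hasseDeriv t0 (q i)).eval (s:ℝ) * (Real.exp (w i * s) - E i s)) := by
      rw [← Finset.sum_sub_distrib]
      refine Finset.sum_congr rfl fun i _ => ?_
      simp only [pow_zero, Module.End.one_apply]
      ring
    rw [e]
    refine hsum _ _ fun i => ?_
    rw [abs_mul]
    have h1 := hsmall i s hs 0
    simp only [pow_zero, Module.End.one_apply, Nat.factorial_zero, Nat.cast_one, one_mul] at h1
    calc _ ≤ (D * 2 ^ D * Q * Real.exp (W * S')) * (Real.exp (W * S') * κ) := by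
          gcongr
          exact hE i s hs
      _ = _ := by rw [two_mul (W * (S':ℝ)), Real.exp_add]; ring
  set G := ∑ i, pr i * (hasseDeriv t0 (q i)).eval (s:ℝ) * u1 i ^ t1 * u2 i ^ t2 * E i s
  have hG : |G| ≤ |F 0 s| + |F 0 s - G| := by
    have := abs_sub_abs_le_abs_sub G (F 0 s)
    rw [abs_sub_comm] at this
    linarith
  have hexp1 : Real.exp (2 * (W * S')) ≤ Real.exp (4 * S' * τ + 2 * (W * S')) := by
    rw [Real.exp_le_exp]
    have : (0:ℝ) ≤ 4 * S' * τ := by positivity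
    linarith
  calc |G| ≤ (Y * Real.exp (9 * (W * S') - τ * S) + τ * (Y * (Real.exp (2 * (W * S')) * κ)) * Real.exp (4 * S' * τ))
        + Y * (Real.exp (2 * (W * S')) * κ) := by linarith
    _ ≤ (Y * Real.exp (9 * (W * S') - τ * S) + τ * (Y * (Real.exp (2 * (W * S')) * κ)) * Real.exp (4 * S' * τ))
        + Y * (Real.exp (4 * S' * τ + 2 * (W * S')) * κ) := by gcongr
    _ = _ := by
      rw [Real.exp_add]; ring


/-- Parameters of the auxiliary construction. -/
structure BD where
  b : ℕ
  c : ℕ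
  m : ℕ
  k : ℕ
  A : ℕ
  B : ℕ
  Ss : ℕ
  D : ℕ
  L : ℕ
  K : ℕ

namespace BD

abbrev I (X : BD) : Type := Fin X.D × Fin X.L × Fin X.L × Fin X.K

def u1 (X : BD) (i : X.I) : ℕ := i.2.1 + X.m * i.2.2.2
def u2 (X : BD) (i : X.I) : ℕ := i.2.2.1 + X.k * i.2.2.2

noncomputable def E (X : BD) (i : X.I) (s : ℕ) : ℝ :=
  ((X.b : ℝ)⁻¹) ^ ((i.2.1 : ℕ) * s) * (X.c : ℝ) ^ ((i.2.2.1 : ℕ) * s) * ((X.A : ℝ) / X.B) ^ ((i.2.2.2 : ℕ) * s)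

noncomputable def term (X : BD) (s t0 t1 t2 : ℕ) (i : X.I) : ℝ :=
  (Polynomial.hasseDeriv t0 (qF X.Ss i.1)).eval (s:ℝ) * (X.u1 i : ℝ) ^ t1 * (X.u2 i : ℝ) ^ t2 * X.E i s

def V (X : BD) (p : X.I → ℤ) (T S : ℕ) : Prop :=
  ∀ s < S, ∀ t0 t1 t2, t0 + t1 + t2 < T → ∑ i, (p i : ℝ) * X.term s t0 t1 t2 i = 0

noncomputable def dd (X : BD) : ℕ := Nat.lcmUpto X.Ss

/-- common denominator -/
noncomputable def den (X : BD) (s t0 : ℕ) : ℕ := X.dd ^ t0 * X.B ^ (X.K * s) * X.b ^ (X.L * s)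

lemma dd_pos (X : BD) : 0 < X.dd := Nat.lcmUpto_pos _

lemma dd_le (X : BD) : (X.dd : ℝ) ≤ Real.exp (6 * X.Ss) := by
  have h := Chebyshev.psi_eq_log_lcmUpto X.Ss
  have h2 := Chebyshev.psi_le_const_mul_self (x := X.Ss) (by positivity)
  rw [h] at h2
  have h3 : Real.log 4 ≤ 2 := by
    have : Real.log 4 = 2 * Real.log 2 := by
      rw [show (4:ℝ) = 2 ^ 2 by norm_num, Real.log_pow]; norm_num
    have := Real.log_two_lt_d9
    linarith
  have hp : (0:ℝ) < X.dd := by exact_mod_cast X.dd_pos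
  rw [← Real.log_le_iff_le_exp hp]
  refine h2.trans ?_
  gcongr
  linarith

lemma E_clear (X : BD) (hb : 1 ≤ X.b) (hB : 1 ≤ X.B) (i : X.I) (s : ℕ) :
    (X.B : ℝ) ^ (X.K * s) * (X.b : ℝ) ^ (X.L * s) * X.E i s =
      ((X.b ^ ((X.L - i.2.1) * s) * X.c ^ ((i.2.2.1 : ℕ) * s) *
        (X.A ^ ((i.2.2.2 : ℕ) * s) * X.B ^ ((X.K - i.2.2.2) * s)) : ℕ) : ℝ) := by
  have hb' : (X.b : ℝ) ≠ 0 := by positivity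
  have hB' : (X.B : ℝ) ≠ 0 := by positivity
  have e1 : X.L * s = (X.L - i.2.1) * s + (i.2.1 : ℕ) * s := by
    rw [← add_mul]; congr 1; have := i.2.1.2; omega
  have e2 : X.K * s = (X.K - i.2.2.2) * s + (i.2.2.2 : ℕ) * s := by
    rw [← add_mul]; congr 1; have := i.2.2.2.2; omega
  unfold E
  rw [e1, e2, pow_add, pow_add, div_pow, inv_pow]
  push_cast
  field_simp

lemma term_int (X : BD) (hS : 1 ≤ X.Ss) (hb : 1 ≤ X.b) (hB : 1 ≤ X.B) (s t0 t1 t2 : ℕ) (i : X.I) :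
    ∃ z : ℤ, (X.den s t0 : ℝ) * X.term s t0 t1 t2 i = z := by
  obtain ⟨z, hz⟩ := (qF_isZ X.dd X.Ss i.1 hS (by
    intro j h1 h2
    exact Finset.dvd_lcm (f := id) (Finset.mem_Icc.2 ⟨h1, h2⟩))).coeff s t0
  have h := X.E_clear hb hB i s
  refine ⟨z * (X.u1 i) ^ t1 * (X.u2 i) ^ t2 * (X.b ^ ((X.L - i.2.1) * s) * X.c ^ ((i.2.2.1 : ℕ) * s) *
        (X.A ^ ((i.2.2.2 : ℕ) * s) * X.B ^ ((X.K - i.2.2.2) * s)) : ℕ), ?_⟩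
  push_cast at h ⊢
  rw [← h, ← hz, den, term]
  push_cast
  ring

lemma den_pos (X : BD) (hb : 1 ≤ X.b) (hB : 1 ≤ X.B) (s t0 : ℕ) : 0 < X.den s t0 := by
  have := X.dd_pos
  unfold den
  positivity

lemma den_le (X : BD) (β1 h : ℝ) (hb : (X.b : ℝ) ≤ Real.exp β1) (hB : (X.B : ℝ) ≤ Real.exp h)
    (s t0 : ℕ) : (X.den s t0 : ℝ) ≤ Real.exp (6 * X.Ss * t0 + h * (X.K * s) + β1 * (X.L * s)) := by
  unfold den
  push_cast
  rw [Real.exp_add, Real.exp_add]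
  have e1 : (X.dd : ℝ) ^ t0 ≤ Real.exp (6 * X.Ss * t0) := by
    rw [mul_comm (6 * (X.Ss:ℝ)), Real.exp_nat_mul]
    gcongr
    exact X.dd_le
  have e2 : (X.B : ℝ) ^ (X.K * s) ≤ Real.exp (h * (X.K * s)) := by
    have : h * ((X.K:ℝ) * s) = ((X.K * s : ℕ) : ℝ) * h := by push_cast; ring
    rw [this, Real.exp_nat_mul]
    gcongr
  have e3 : (X.b : ℝ) ^ (X.L * s) ≤ Real.exp (β1 * (X.L * s)) := by
    have : β1 * ((X.L:ℝ) * s) = ((X.L * s : ℕ) : ℝ) * β1 := by push_cast; ring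
    rw [this, Real.exp_nat_mul]
    gcongr
  gcongr

lemma exists_int_sum (X : BD) (hS : 1 ≤ X.Ss) (hb : 1 ≤ X.b) (hB : 1 ≤ X.B) (p : X.I → ℤ) (s t0 t1 t2 : ℕ) :
    ∃ z : ℤ, (X.den s t0 : ℝ) * ∑ i, (p i : ℝ) * X.term s t0 t1 t2 i = z := by
  choose z hz using fun i => X.term_int hS hb hB s t0 t1 t2 i
  refine ⟨∑ i, p i * z i, ?_⟩
  push_cast
  rw [Finset.mul_sum]
  refine Finset.sum_congr rfl fun i _ => ?_
  rw [← hz]; ring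

/-- size of the cleared entries -/
lemma entry_le (X : BD) (β1 β2 h Q U : ℝ) (hb1 : 1 ≤ X.b) (hc1 : 1 ≤ X.c) (hB1 : 1 ≤ X.B)
    (hb : (X.b : ℝ) ≤ Real.exp β1) (hc : (X.c : ℝ) ≤ Real.exp β2)
    (hA : (X.A : ℝ) ≤ Real.exp h) (hB : (X.B : ℝ) ≤ Real.exp h) (hU : 1 ≤ U) (hQ0 : 0 ≤ Q)
    (T S : ℕ) (hQ : ∀ i : X.I, ∀ s : ℕ, s ≤ S → ∀ t, |(Polynomial.hasseDeriv t (qF X.Ss i.1)).eval (s:ℝ)| ≤ Q)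
    (hu1 : ∀ i, (X.u1 i : ℝ) ≤ U) (hu2 : ∀ i, (X.u2 i : ℝ) ≤ U)
    (s t0 t1 t2 : ℕ) (hs : s ≤ S) (h0 : t0 ≤ T) (h1 : t1 ≤ T) (h2 : t2 ≤ T) (i : X.I) :
    |(X.den s t0 : ℝ) * X.term s t0 t1 t2 i| ≤
      Real.exp (6 * X.Ss * T + (β1 + β2) * (X.L * S) + h * (X.K * S)) * Q * U ^ (2 * T) := by
  have hb1' : (1:ℝ) ≤ X.b := by exact_mod_cast hb1
  have hc1' : (1:ℝ) ≤ X.c := by exact_mod_cast hc1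
  have hB1' : (1:ℝ) ≤ X.B := by exact_mod_cast hB1
  have hβ1 : 0 ≤ β1 := by
    have := hb1'.trans hb
    rwa [Real.one_le_exp_iff] at this
  have hβ2 : 0 ≤ β2 := by
    have := hc1'.trans hc
    rwa [Real.one_le_exp_iff] at this
  have hh : 0 ≤ h := by
    have := hB1'.trans hB
    rwa [Real.one_le_exp_iff] at this
  have hsS : (s:ℝ) ≤ S := by exact_mod_cast hs
  have hcl := X.E_clear hb1 hB1 i s
  have e0 : (X.den s t0 : ℝ) * X.term s t0 t1 t2 i = (X.dd:ℝ) ^ t0 *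
      ((Polynomial.hasseDeriv t0 (qF X.Ss i.1)).eval (s:ℝ)) * ((X.u1 i : ℝ) ^ t1 * (X.u2 i : ℝ) ^ t2) *
      ((X.B : ℝ) ^ (X.K * s) * (X.b : ℝ) ^ (X.L * s) * X.E i s) := by
    unfold den term; push_cast; ring
  rw [e0, hcl]
  have dd1 : (1:ℝ) ≤ X.dd := by exact_mod_cast X.dd_pos
  have e1 : (X.dd : ℝ) ^ t0 ≤ Real.exp (6 * X.Ss * T) := by
    calc (X.dd : ℝ) ^ t0 ≤ (X.dd : ℝ) ^ T := pow_le_pow_right₀ dd1 h0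
      _ ≤ (Real.exp (6 * X.Ss)) ^ T := by gcongr; exact X.dd_le
      _ = _ := by rw [← Real.exp_nat_mul]; ring_nf
  have e2 : (X.u1 i : ℝ) ^ t1 * (X.u2 i : ℝ) ^ t2 ≤ U ^ (2 * T) := by
    calc (X.u1 i : ℝ) ^ t1 * (X.u2 i : ℝ) ^ t2 ≤ U ^ t1 * U ^ t2 := by
          gcongr
          · exact hu1 i
          · exact hu2 i
      _ = U ^ (t1 + t2) := by rw [pow_add]
      _ ≤ _ := pow_le_pow_right₀ hU (by omega)
  have pw : ∀ (x : ℕ) (β : ℝ) (n M : ℕ), (x:ℝ) ≤ Real.exp β → 0 ≤ β → n ≤ M * s →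
      (x:ℝ) ^ n ≤ Real.exp (β * n) := by
    intro x β n M hx hβ hn
    rw [mul_comm, Real.exp_nat_mul]
    gcongr
  have e3 : ((X.b ^ ((X.L - i.2.1) * s) * X.c ^ ((i.2.2.1 : ℕ) * s) *
        (X.A ^ ((i.2.2.2 : ℕ) * s) * X.B ^ ((X.K - i.2.2.2) * s)) : ℕ) : ℝ) ≤
      Real.exp ((β1 + β2) * (X.L * S) + h * (X.K * S)) := by
    push_cast
    have a1 : (X.b:ℝ) ^ ((X.L - i.2.1) * s) ≤ Real.exp (β1 * (X.L * S)) := by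
      refine (pw _ β1 _ X.L hb hβ1 (Nat.mul_le_mul_right _ (Nat.sub_le _ _))).trans ?_
      rw [Real.exp_le_exp]
      push_cast
      gcongr
      exact_mod_cast Nat.sub_le _ _
    have a2 : (X.c:ℝ) ^ ((i.2.2.1 : ℕ) * s) ≤ Real.exp (β2 * (X.L * S)) := by
      refine (pw _ β2 _ X.L hc hβ2 (Nat.mul_le_mul_right _ i.2.2.1.2.le)).trans ?_
      rw [Real.exp_le_exp]
      push_cast
      gcongr
      exact_mod_cast i.2.2.1.2.le
    have a3 : (X.A:ℝ) ^ ((i.2.2.2 : ℕ) * s) * (X.B:ℝ) ^ ((X.K - i.2.2.2) * s) ≤ Real.exp (h * (X.K * S)) := by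
      calc _ ≤ Real.exp (h * ((i.2.2.2 : ℕ) * s : ℕ)) * Real.exp (h * (((X.K - i.2.2.2) * s : ℕ):ℝ)) := by
            gcongr
            · exact pw _ h _ X.K hA hh (Nat.mul_le_mul_right _ i.2.2.2.2.le)
            · exact pw _ h _ X.K hB hh (Nat.mul_le_mul_right _ (Nat.sub_le _ _))
        _ = Real.exp (h * (X.K * s)) := by
            rw [← Real.exp_add, ← mul_add, ← Nat.cast_add, ← add_mul]
            have : (i.2.2.2 : ℕ) + (X.K - i.2.2.2) = X.K := by have := i.2.2.2.2; omega
            rw [this]; push_cast; ring_nf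
        _ ≤ _ := by
            gcongr
    calc _ ≤ Real.exp (β1 * (X.L * S)) * Real.exp (β2 * (X.L * S)) * Real.exp (h * (X.K * S)) := by gcongr
      _ = _ := by rw [← Real.exp_add, ← Real.exp_add]; ring_nf
  rw [abs_mul, abs_mul, abs_mul, abs_of_nonneg (show (0:ℝ) ≤ (X.dd:ℝ) ^ t0 by positivity),
    abs_of_nonneg (show (0:ℝ) ≤ (X.u1 i : ℝ) ^ t1 * (X.u2 i : ℝ) ^ t2 by positivity), Nat.abs_cast]
  calc _ ≤ Real.exp (6 * X.Ss * T) * Q * U ^ (2 * T) * Real.exp ((β1 + β2) * (X.L * S) + h * (X.K * S)) := by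
        gcongr
        exact hQ i s hs t0
    _ = _ := by rw [add_assoc (6 * (X.Ss:ℝ) * T), Real.exp_add (6 * (X.Ss:ℝ) * T)]; ring

attribute [local instance] Matrix.seminormedAddCommGroup in
lemma siegel (X : BD) (hS : 1 ≤ X.Ss) (hb1 : 1 ≤ X.b) (hB1 : 1 ≤ X.B)
    (T S : ℕ) (hT : 1 ≤ T) (hS1 : 1 ≤ S) (Z : ℝ) (hZ : 1 ≤ Z)
    (hN : 2 * (T ^ 3 * S) ≤ X.D * X.L ^ 2 * X.K)
    (hent : ∀ s t0 t1 t2 i, s < S → t0 < T → t1 < T → t2 < T → |(X.den s t0 : ℝ) * X.term s t0 t1 t2 i| ≤ Z) :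
    ∃ p : X.I → ℤ, p ≠ 0 ∧ X.V p T S ∧ ∀ i, |(p i : ℝ)| ≤ (X.D * X.L ^ 2 * X.K : ℕ) * Z := by
  choose z hz using fun s t0 t1 t2 i => X.term_int hS hb1 hB1 s t0 t1 t2 i
  let A : Matrix (Fin S × Fin T × Fin T × Fin T) X.I ℤ := fun r i => z r.1 r.2.1 r.2.2.1 r.2.2.2 i
  have hcα : Fintype.card (Fin S × Fin T × Fin T × Fin T) = T ^ 3 * S := by
    simp; ring
  have hcβ : Fintype.card X.I = X.D * X.L ^ 2 * X.K := by
    simp [I]; ring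
  have hpos : 0 < T ^ 3 * S := by positivity
  obtain ⟨t, ht0, ht, htn⟩ := Int.Matrix.exists_ne_zero_int_vec_norm_le A (by rw [hcα, hcβ]; omega) (by rw [hcα]; omega)
  refine ⟨t, ht0, ?_, ?_⟩
  · intro s hs t0 t1 t2 hlt
    have h := congrFun ht (⟨s, hs⟩, ⟨t0, by omega⟩, ⟨t1, by omega⟩, ⟨t2, by omega⟩)
    simp only [Matrix.mulVec, dotProduct, A, Pi.zero_apply] at h
    have hd : (X.den s t0 : ℝ) ≠ 0 := by exact_mod_cast (X.den_pos hb1 hB1 s t0).ne'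
    have h' : (X.den s t0 : ℝ) * ∑ i, (t i : ℝ) * X.term s t0 t1 t2 i = 0 := by
      have h2 : ((∑ i, z s t0 t1 t2 i * t i : ℤ) : ℝ) = 0 := by rw [h]; simp
      rw [← h2]
      push_cast
      rw [Finset.mul_sum]
      refine Finset.sum_congr rfl fun i _ => ?_
      rw [← hz]; ring
    exact (mul_eq_zero.1 h').resolve_left hd
  · intro i
    rw [hcα, hcβ] at htn
    have hA : ‖A‖ ≤ Z := by
      rw [Matrix.norm_le_iff (by linarith)]
      intro r j
      have := hent r.1 r.2.1 r.2.2.1 r.2.2.2 j r.1.2 r.2.1.2 r.2.2.1.2 r.2.2.2.2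
      rw [hz] at this
      rw [Int.norm_eq_abs]
      exact this
    have h1 : |(t i : ℝ)| ≤ ‖t‖ := by
      rw [← Int.norm_eq_abs]; exact norm_le_pi_norm t i
    refine h1.trans (htn.trans ?_)
    set N := X.D * X.L ^ 2 * X.K with hNdef
    have hNr : (2:ℝ) * ((T ^ 3 * S : ℕ):ℝ) ≤ (N:ℝ) := by exact_mod_cast hN
    have hposr : (0:ℝ) < ((T ^ 3 * S : ℕ):ℝ) := by exact_mod_cast hpos
    have hN1 : (1:ℝ) ≤ N := by
      have : 1 ≤ N := by omega
      exact_mod_cast this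
    have hbase : (1:ℝ) ≤ N * max 1 ‖A‖ := by
      have := le_max_left 1 ‖A‖
      nlinarith
    calc _ ≤ ((N:ℝ) * max 1 ‖A‖) ^ (1:ℝ) := by
          apply Real.rpow_le_rpow_of_exponent_le hbase
          rw [div_le_one (by linarith)]
          linarith
      _ = N * max 1 ‖A‖ := Real.rpow_one _
      _ ≤ N * Z := by
          gcongr
          exact max_le hZ hA

end BD


namespace BD

noncomputable def lam (X : BD) : ℝ :=
  Real.log ((X.A : ℝ) / X.B) + X.m * Real.log X.b - X.k * Real.log X.c

noncomputable def w (X : BD) (i : X.I) : ℝ := -Real.log X.b * (X.u1 i : ℝ) + Real.log X.c * (X.u2 i : ℝ)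

lemma w_eq (X : BD) (i : X.I) : X.w i = -((i.2.1:ℕ):ℝ) * Real.log X.b + ((i.2.2.1:ℕ):ℝ) * Real.log X.c
    + ((i.2.2.2:ℕ):ℝ) * (Real.log ((X.A : ℝ) / X.B) - X.lam) := by
  unfold w u1 u2 lam; push_cast; ring

lemma E_eq (X : BD) (hb : 1 ≤ X.b) (hc : 1 ≤ X.c) (hA : 1 ≤ X.A) (hB : 1 ≤ X.B) (i : X.I) (s : ℕ) :
    X.E i s = Real.exp (X.w i * s) * Real.exp (((i.2.2.2:ℕ):ℝ) * s * X.lam) := by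
  have hb' : (0:ℝ) < X.b := by exact_mod_cast hb
  have hc' : (0:ℝ) < X.c := by exact_mod_cast hc
  have hA' : (0:ℝ) < X.A := by exact_mod_cast hA
  have hB' : (0:ℝ) < X.B := by exact_mod_cast hB
  have key : ∀ (x : ℝ) (n : ℕ), 0 < x → x ^ n = Real.exp (n * Real.log x) := by
    intro x n hx
    rw [Real.exp_nat_mul, Real.exp_log hx]
  unfold E
  rw [key _ _ (inv_pos.2 hb'), key _ _ hc', key _ _ (div_pos hA' hB'), ← Real.exp_add, ← Real.exp_add,
    ← Real.exp_add, w_eq, Real.log_inv]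
  push_cast
  ring_nf

lemma abs_log_alpha (X : BD) (h : ℝ) (hA : 1 ≤ X.A) (hB : 1 ≤ X.B) (hAh : Real.log X.A ≤ h) (hBh : Real.log X.B ≤ h) :
    |Real.log ((X.A : ℝ) / X.B)| ≤ h := by
  have hA' : (1:ℝ) ≤ X.A := by exact_mod_cast hA
  have hB' : (1:ℝ) ≤ X.B := by exact_mod_cast hB
  rw [Real.log_div (by linarith) (by linarith)]
  have := Real.log_nonneg hA'
  have := Real.log_nonneg hB'
  rw [abs_le]; constructor <;> linarith

noncomputable def Cb (X : BD) : ℝ := Real.log X.b + Real.log X.c + 2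

lemma w_le (X : BD) (h : ℝ) (hb : 1 ≤ X.b) (hc : 1 ≤ X.c) (hA : 1 ≤ X.A) (hB : 1 ≤ X.B)
    (hAh : Real.log X.A ≤ h) (hBh : Real.log X.B ≤ h) (h1 : 1 ≤ h) (hK : X.K * h ≤ X.L) (hl : |X.lam| ≤ 1) (i : X.I) :
    |X.w i| ≤ X.Cb * X.L := by
  have hb' : 0 ≤ Real.log X.b := Real.log_nonneg (by exact_mod_cast hb)
  have hc' : 0 ≤ Real.log X.c := Real.log_nonneg (by exact_mod_cast hc)
  have ha := X.abs_log_alpha h hA hB hAh hBh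
  have e1 : ((i.2.1:ℕ):ℝ) ≤ X.L := by exact_mod_cast i.2.1.2.le
  have e2 : ((i.2.2.1:ℕ):ℝ) ≤ X.L := by exact_mod_cast i.2.2.1.2.le
  have e3 : ((i.2.2.2:ℕ):ℝ) ≤ X.K := by exact_mod_cast i.2.2.2.2.le
  have f1 : |-((i.2.1:ℕ):ℝ) * Real.log X.b| ≤ X.L * Real.log X.b := by
    rw [abs_mul, abs_neg, Nat.abs_cast, abs_of_nonneg hb']; gcongr
  have f2 : |((i.2.2.1:ℕ):ℝ) * Real.log X.c| ≤ X.L * Real.log X.c := by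
    rw [abs_mul, Nat.abs_cast, abs_of_nonneg hc']; gcongr
  have f3 : |((i.2.2.2:ℕ):ℝ) * (Real.log ((X.A : ℝ) / X.B) - X.lam)| ≤ X.K * (h + 1) := by
    rw [abs_mul, Nat.abs_cast]
    gcongr
    exact (abs_sub _ _).trans (by linarith)
  have hKL : (X.K : ℝ) ≤ X.L := le_trans (le_mul_of_one_le_right (by positivity) h1) hK
  rw [w_eq]
  refine (abs_add_le _ _).trans ?_
  have := abs_add_le (-((i.2.1:ℕ):ℝ) * Real.log X.b) (((i.2.2.1:ℕ):ℝ) * Real.log X.c)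
  unfold Cb
  nlinarith

lemma E_approx (X : BD) (h : ℝ) (hb : 1 ≤ X.b) (hc : 1 ≤ X.c) (hA : 1 ≤ X.A) (hB : 1 ≤ X.B)
    (hAh : Real.log X.A ≤ h) (hBh : Real.log X.B ≤ h) (h1 : 1 ≤ h) (hK : X.K * h ≤ X.L) (hl : |X.lam| ≤ 1)
    (S' : ℕ) (hl' : X.K * S' * |X.lam| ≤ 1) (i : X.I) (s : ℕ) (hs : s ≤ S') :
    |Real.exp (X.w i * s) - X.E i s| ≤ Real.exp (X.Cb * X.L * S') * (2 * X.K * S' * |X.lam|) := by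
  have hs' : (s:ℝ) ≤ S' := by exact_mod_cast hs
  have e3 : ((i.2.2.2:ℕ):ℝ) ≤ X.K := by exact_mod_cast i.2.2.2.2.le
  rw [X.E_eq hb hc hA hB, ← mul_one_sub, abs_mul, abs_of_pos (Real.exp_pos _)]
  have hw := X.w_le h hb hc hA hB hAh hBh h1 hK hl i
  have hx : |((i.2.2.2:ℕ):ℝ) * s * X.lam| ≤ X.K * S' * |X.lam| := by
    rw [abs_mul, abs_mul, Nat.abs_cast, Nat.abs_cast]
    gcongr
  refine mul_le_mul ?_ ?_ (abs_nonneg _) (Real.exp_pos _).le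
  · rw [Real.exp_le_exp]
    calc X.w i * s ≤ |X.w i| * s := by gcongr; exact le_abs_self _
      _ ≤ _ := by
        have : 0 ≤ X.Cb * X.L := (abs_nonneg _).trans hw
        gcongr
  · rw [abs_sub_comm]
    refine (Real.abs_exp_sub_one_le (hx.trans hl')).trans ?_
    linarith

noncomputable def Qb (X : BD) (S' : ℕ) : ℝ := (2 * S' / X.Ss) ^ X.D * Real.exp (X.D + X.Ss)

lemma Qb_bound (X : BD) (hSs : 1 ≤ X.Ss) (S' : ℕ) (hS' : X.Ss ≤ S') (i : X.I) (ξ : ℝ) (h0 : 0 ≤ ξ) (h1 : ξ ≤ S') (t : ℕ) :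
    |(Polynomial.hasseDeriv t (qF X.Ss i.1)).eval ξ| * (S':ℝ) ^ t ≤ X.Qb S' := by
  refine (qF_bound X.Ss i.1 hSs S' ξ (by exact_mod_cast hS') h0 h1 t).trans ?_
  have hi : ((i.1:ℕ):ℝ) ≤ X.D := by exact_mod_cast i.1.2.le
  have hp : (0:ℝ) < X.Ss := by exact_mod_cast hSs
  have hp' : (X.Ss:ℝ) ≤ S' := by exact_mod_cast hS'
  have hbase : 1 ≤ 2 * (S':ℝ) / X.Ss := by
    rw [le_div_iff₀ hp]; linarith
  unfold Qb
  have := pow_le_pow_right₀ hbase i.1.2.le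
  gcongr

lemma Qb_bound' (X : BD) (hSs : 1 ≤ X.Ss) (S' : ℕ) (hS' : X.Ss ≤ S') (i : X.I) (s : ℕ) (hs : s ≤ S') (t : ℕ) :
    |(Polynomial.hasseDeriv t (qF X.Ss i.1)).eval (s:ℝ)| ≤ X.Qb S' := by
  refine le_trans ?_ (X.Qb_bound hSs S' hS' i s (by positivity) (by exact_mod_cast hs) t)
  refine le_mul_of_one_le_right (abs_nonneg _) (one_le_pow₀ ?_)
  exact_mod_cast hSs.trans hS'

theorem step (X : BD) (p : X.I → ℤ) (h P U : ℝ) (T S S' τ : ℕ)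
    (hb : 1 ≤ X.b) (hc : 1 ≤ X.c) (hA : 1 ≤ X.A) (hB : 1 ≤ X.B)
    (hAh : Real.log X.A ≤ h) (hBh : Real.log X.B ≤ h) (h1 : 1 ≤ h) (hK : X.K * h ≤ X.L) (hl : |X.lam| ≤ 1)
    (hl' : X.K * S' * |X.lam| ≤ 1) (hSs : 1 ≤ X.Ss) (hSsS : X.Ss ≤ S) (hSS' : S ≤ S') (hτ : 1 ≤ τ)
    (hD : 2 * X.D ≤ τ * S) (hP0 : 0 ≤ P) (hP : ∀ i, |(p i : ℝ)| ≤ P) (hU : 1 ≤ U)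
    (hu1 : ∀ i, (X.u1 i : ℝ) ≤ U) (hu2 : ∀ i, (X.u2 i : ℝ) ≤ U)
    (hV : X.V p (T + τ) S)
    (hlt : Real.exp (6 * X.Ss * (T + τ : ℕ) + h * (X.K * S') + Real.log X.b * (X.L * S')) *
      (Fintype.card X.I * P * U ^ (T + τ) * (X.D * 2 ^ X.D * X.Qb S') *
        (Real.exp (9 * (X.Cb * X.L * S') - τ * S) +
          (τ + 1) * Real.exp (4 * S' * τ + 2 * (X.Cb * X.L * S')) * (2 * X.K * S' * |X.lam|))) < 1) :
    X.V p T S' := by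
  have hb' : (1:ℝ) ≤ X.b := by exact_mod_cast hb
  have hB' : (1:ℝ) ≤ X.B := by exact_mod_cast hB
  have hc' : (1:ℝ) ≤ X.c := by exact_mod_cast hc
  have hQ0 : 0 ≤ X.Qb S' := by unfold Qb; positivity
  have hCb : 0 ≤ X.Cb := by
    unfold Cb
    have := Real.log_nonneg hb'
    have := Real.log_nonneg hc'
    linarith
  intro s hs t0 t1 t2 ht
  have hmain := extrap_abs (fun i => (p i : ℝ)) (fun i => (X.u1 i : ℝ)) (fun i => (X.u2 i : ℝ))
    (fun i : X.I => qF X.Ss i.1) X.E (Real.log X.b) (Real.log X.c) (T + τ) S S' τ X.D P U (X.Qb S') (X.Cb * X.L)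
    (2 * X.K * S' * |X.lam|) (hSs.trans hSsS) hSS' hτ hD
    (fun i => by rw [qF_natDegree]; exact i.1.2) hP hU
    (fun i => by rw [Nat.abs_cast]; exact hu1 i) (fun i => by rw [Nat.abs_cast]; exact hu2 i)
    (fun i => X.w_le h hb hc hA hB hAh hBh h1 hK hl i) (by positivity) hQ0 hP0 (by positivity)
    (fun i ξ h0 h1 t => X.Qb_bound hSs S' (hSsS.trans hSS') i ξ h0 h1 t)
    (fun i s hs => X.E_approx h hb hc hA hB hAh hBh h1 hK hl S' hl' i s hs)
    (fun s hs t0 t1 t2 ht => by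
      have := hV s hs t0 t1 t2 ht
      rw [← this]
      refine Finset.sum_congr rfl fun i _ => ?_
      unfold term; ring) s hs.le t0 t1 t2 (by omega)
  have heq : ∑ i, (p i : ℝ) * (Polynomial.hasseDeriv t0 (qF X.Ss i.1)).eval (s:ℝ) * (X.u1 i : ℝ) ^ t1 * (X.u2 i : ℝ) ^ t2 * X.E i s
      = ∑ i, (p i : ℝ) * X.term s t0 t1 t2 i := by
    refine Finset.sum_congr rfl fun i _ => ?_
    unfold term; ring
  rw [heq] at hmain
  obtain ⟨z, hz⟩ := X.exists_int_sum hSs hb hB p s t0 t1 t2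
  have hden := X.den_le (Real.log X.b) h (by rw [Real.exp_log (by linarith)])
    (by rw [← Real.log_le_iff_le_exp (by linarith)]; exact hBh) s t0
  have hdpos : (0:ℝ) < X.den s t0 := by exact_mod_cast X.den_pos hb hB s t0
  have hs' : (s:ℝ) ≤ S' := by exact_mod_cast hs.le
  have ht0 : (t0:ℝ) ≤ (T + τ : ℕ) := by
    have : t0 ≤ T + τ := by omega
    exact_mod_cast this
  have hlogb := Real.log_nonneg hb'
  have hden2 : (X.den s t0 : ℝ) ≤ Real.exp (6 * X.Ss * (T + τ : ℕ) + h * (X.K * S') + Real.log X.b * (X.L * S')) := by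
    refine hden.trans ?_
    rw [Real.exp_le_exp]
    gcongr
  have hzabs : |(z:ℝ)| < 1 := by
    rw [← hz, abs_mul, abs_of_pos hdpos]
    refine lt_of_le_of_lt ?_ hlt
    exact mul_le_mul hden2 hmain (abs_nonneg _) (Real.exp_pos _).le
  have hz0 : z = 0 := by
    have : |z| < 1 := by exact_mod_cast hzabs
    exact Int.abs_lt_one_iff.1 this
  rw [hz0, Int.cast_zero] at hz
  exact (mul_eq_zero.1 hz).resolve_left hdpos.ne'

end BD


namespace BD

/-- the concrete choice of parameters -/
def mk' (b c m k A B r J H ℓ : ℕ) : BD where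
  b := b
  c := c
  m := m
  k := k
  A := A
  B := B
  Ss := ℓ
  D := 2 * (2 * J * r) ^ 3 * H * (600 * J * ℓ)
  L := (16 * 1208 * 600 * J ^ 4 * r ^ 2) * H
  K := 16 * 1208 * 600 * J ^ 4 * r ^ 2

lemma nat_le_exp (n : ℕ) : (n:ℝ) ≤ Real.exp n := by
  have := Real.add_one_le_exp (n:ℝ)
  linarith

lemma Qb_le (X : BD) (J S' : ℕ) (hJ : 1 ≤ J) (hSs : 1 ≤ X.Ss) (hS' : S' ≤ 2 ^ J * (600 * J * X.Ss)) :
    X.Qb S' ≤ Real.exp (X.D * (602 * J + 1) + X.Ss) := by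
  have hp : (0:ℝ) < X.Ss := by exact_mod_cast hSs
  have hJ1 : (1:ℝ) ≤ J := by exact_mod_cast hJ
  have h1 : 2 * (S':ℝ) / X.Ss ≤ Real.exp (602 * J) := by
    rw [div_le_iff₀ hp]
    have h2 : (S':ℝ) ≤ 2 ^ J * (600 * J * X.Ss) := by exact_mod_cast hS'
    have e2 : (2:ℝ) ≤ Real.exp 1 := by have := Real.add_one_le_exp (1:ℝ); linarith
    have e3 : (2:ℝ) ^ J ≤ Real.exp J := by
      calc (2:ℝ) ^ J ≤ (Real.exp 1) ^ J := by gcongr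
        _ = _ := by rw [← Real.exp_nat_mul]; ring_nf
    have e4 : 600 * (J:ℝ) ≤ Real.exp (600 * J) := by
      have := Real.add_one_le_exp (600 * (J:ℝ)); linarith
    have e5 : (2:ℝ) ≤ Real.exp J := e2.trans (by rw [Real.exp_le_exp]; exact hJ1)
    calc 2 * (S':ℝ) ≤ 2 * (2 ^ J * (600 * J * X.Ss)) := by gcongr
      _ = (2 * 2 ^ J * (600 * J)) * X.Ss := by ring
      _ ≤ (Real.exp J * Real.exp J * Real.exp (600 * J)) * X.Ss := by gcongr
      _ = Real.exp (602 * J) * X.Ss := by rw [← Real.exp_add, ← Real.exp_add]; ring_nf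
  unfold Qb
  calc _ ≤ (Real.exp (602 * J)) ^ X.D * Real.exp (X.D + X.Ss) := by gcongr
    _ = _ := by rw [← Real.exp_nat_mul, ← Real.exp_add]; ring_nf

set_option maxHeartbeats 4000000 in
theorem aux_exists (b c m k A B r J H ℓ : ℕ) (hb : 2 ≤ b) (hc : 2 ≤ c)
    (hA : 1 ≤ A) (hB : 1 ≤ B) (hJ : 1 ≤ J) (hH : 1 ≤ H) (hℓ : 1 ≤ ℓ)
    (hr : 220 * (Real.log b + Real.log c + 2) ≤ r)
    (hAh : Real.log A ≤ H) (hBh : Real.log B ≤ H)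
    (X : BD) (hX : X = mk' b c m k A B r J H ℓ)
    (hu1 : ((X.L + m * X.K : ℕ) : ℝ) ≤ Real.exp (2 * ℓ)) (hu2 : ((X.L + k * X.K : ℕ) : ℝ) ≤ Real.exp (2 * ℓ))
    (hlam : |X.lam| ≤ Real.exp (-(13 * (r * X.L * (2 ^ J * (600 * J * ℓ)))))) :
    ∃ p : X.I → ℤ, p ≠ 0 ∧ X.V p (J * r * X.L) (2 ^ J * (600 * J * ℓ)) := by
  have Xb : X.b = b := by rw [hX]; rfl
  have Xc : X.c = c := by rw [hX]; rfl
  have XA : X.A = A := by rw [hX]; rfl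
  have XB : X.B = B := by rw [hX]; rfl
  have Xm : X.m = m := by rw [hX]; rfl
  have Xk : X.k = k := by rw [hX]; rfl
  have XSs : X.Ss = ℓ := by rw [hX]; rfl
  have XL : X.L = X.K * H := by rw [hX]; rfl
  have XD : X.D = 2 * (2 * J * r) ^ 3 * H * (600 * J * ℓ) := by rw [hX]; rfl
  have XK : X.K = 16 * 1208 * 600 * J ^ 4 * r ^ 2 := by rw [hX]; rfl
  have hβ1 : 0 ≤ Real.log b := Real.log_nonneg (by exact_mod_cast (by omega : 1 ≤ b))
  have hβ2 : 0 ≤ Real.log c := Real.log_nonneg (by exact_mod_cast (by omega : 1 ≤ c))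
  have hr1 : 1 ≤ r := by
    have : (1:ℝ) ≤ r := by linarith
    exact_mod_cast this
  set S0 := 600 * J * ℓ with hS0
  set T := 2 * J * r * X.L with hT
  have hK1 : 1 ≤ X.K := by rw [XK]; exact Nat.succ_le_of_lt (by positivity)
  have hL1 : 1 ≤ X.L := by rw [XL]; exact Nat.mul_pos hK1 hH
  have hS01 : 1 ≤ S0 := Nat.succ_le_of_lt (by positivity)
  have hT1 : 1 ≤ T := Nat.succ_le_of_lt (by positivity)
  have hℓS0 : ℓ ≤ S0 := by rw [hS0]; nlinarith
  have hN : X.D * X.L ^ 2 * X.K = 2 * (T ^ 3 * S0) := by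
    rw [XD, hT, XL]; ring
  have hDn0 : 1208 * 600 * J * X.D = r * X.L * S0 := by
    rw [XD, XL, XK]; ring
  -- real versions
  have hℓr : (1:ℝ) ≤ ℓ := by exact_mod_cast hℓ
  have hLr : (1:ℝ) ≤ X.L := by exact_mod_cast hL1
  have hJr : (1:ℝ) ≤ J := by exact_mod_cast hJ
  have hS0r : (1:ℝ) ≤ S0 := by exact_mod_cast hS01
  have hTr : (1:ℝ) ≤ T := by exact_mod_cast hT1
  have hℓS0r : (ℓ:ℝ) ≤ S0 := by exact_mod_cast hℓS0
  have hTℓ : (T:ℝ) * ℓ = r * X.L * S0 / 300 := by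
    rw [hT, hS0]; push_cast; ring
  have hTTℓ : (T:ℝ) ≤ T * ℓ := le_mul_of_one_le_right (by positivity) hℓr
  have hDr : (X.D : ℝ) * J = r * X.L * S0 / (1208 * 600) := by
    have : (1208 * 600 * J * X.D : ℝ) = r * X.L * S0 := by exact_mod_cast hDn0
    linarith
  have hDJ : (X.D : ℝ) ≤ X.D * J := le_mul_of_one_le_right (by positivity) hJr
  have hKH : (X.K : ℝ) * H = X.L := by rw [XL]; push_cast; ring
  have hHr : (1:ℝ) ≤ H := by exact_mod_cast hH
  have hKL : (X.K : ℝ) ≤ X.L := by rw [← hKH]; exact le_mul_of_one_le_right (by positivity) hHr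
  -- sizes of N
  have hcard : (Fintype.card X.I : ℝ) = (X.D * X.L ^ 2 * X.K : ℕ) := by
    congr 1
    simp [I]; ring
  have hNexp : ((X.D * X.L ^ 2 * X.K : ℕ) : ℝ) ≤ Real.exp (4 * T + S0) := by
    rw [hN]
    push_cast
    have e2 : (2:ℝ) ≤ Real.exp T := by have := Real.add_one_le_exp (T:ℝ); linarith
    have e3 := nat_le_exp T
    have e4 := nat_le_exp S0
    calc 2 * ((T:ℝ) ^ 3 * S0) ≤ Real.exp T * ((Real.exp T) ^ 3 * Real.exp S0) := by gcongr
      _ = _ := by rw [← Real.exp_nat_mul, ← Real.exp_add, ← Real.exp_add]; push_cast; ring_nf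
  have hu1' : ∀ i, (X.u1 i : ℝ) ≤ Real.exp (2 * ℓ) := by
    intro i
    refine le_trans ?_ hu1
    have h1 := i.2.1.2.le
    have h2 := Nat.mul_le_mul_left m i.2.2.2.2.le
    have : X.u1 i ≤ X.L + m * X.K := by unfold u1; rw [Xm]; omega
    exact_mod_cast this
  have hu2' : ∀ i, (X.u2 i : ℝ) ≤ Real.exp (2 * ℓ) := by
    intro i
    refine le_trans ?_ hu2
    have h1 := i.2.2.1.2.le
    have h2 := Nat.mul_le_mul_left k i.2.2.2.2.le
    have : X.u2 i ≤ X.L + k * X.K := by unfold u2; rw [Xk]; omega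
    exact_mod_cast this
  have hU1 : (1:ℝ) ≤ Real.exp (2 * ℓ) := Real.one_le_exp (by positivity)
  have hUpow : ∀ n : ℕ, Real.exp (2 * ℓ) ^ n = Real.exp (2 * (n * ℓ)) := by
    intro n; rw [← Real.exp_nat_mul]; ring_nf
  have hAp : (0:ℝ) < A := by exact_mod_cast hA
  have hBp : (0:ℝ) < B := by exact_mod_cast hB
  have hbp : (0:ℝ) < b := by exact_mod_cast (by omega : 0 < b)
  have hcp : (0:ℝ) < c := by exact_mod_cast (by omega : 0 < c)
  have h2J : 1 ≤ 2 ^ J := Nat.one_le_two_pow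
  have hQ0 : X.Qb S0 ≤ Real.exp (X.D * (602 * J + 1) + ℓ) := by
    have := X.Qb_le J S0 hJ (by omega) (by rw [XSs]; exact Nat.le_mul_of_pos_left _ (by omega))
    rwa [XSs] at this
  set Z : ℝ := Real.exp (6 * (T * ℓ) + (Real.log b + Real.log c) * (X.L * S0) + X.L * S0 +
    (X.D * (602 * J + 1) + ℓ) + 4 * (T * ℓ)) with hZ
  obtain ⟨p, hp0, hpV, hpb⟩ := X.siegel (by omega) (by omega) (by omega) T S0 hT1 hS01 Z
    (Real.one_le_exp (by positivity)) hN.ge (by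
      intro s t0 t1 t2 i hs h0 h1 h2
      have := X.entry_le (Real.log b) (Real.log c) H (X.Qb S0) (Real.exp (2 * ℓ)) (by omega) (by omega) (by omega)
        (by rw [Xb, Real.exp_log hbp]) (by rw [Xc, Real.exp_log hcp])
        (by rw [XA, ← Real.log_le_iff_le_exp hAp]; exact hAh)
        (by rw [XB, ← Real.log_le_iff_le_exp hBp]; exact hBh) hU1 (by unfold Qb; positivity) T S0
        (fun i s hs t => X.Qb_bound' (by omega) S0 (by omega) i s hs t) hu1' hu2' s t0 t1 t2 hs.le h0.le h1.le h2.le i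
      refine this.trans ?_
      rw [hUpow]
      calc _ ≤ Real.exp (6 * X.Ss * T + (Real.log b + Real.log c) * (X.L * S0) + H * (X.K * S0)) *
            Real.exp (X.D * (602 * J + 1) + ℓ) * Real.exp (2 * ((2 * T : ℕ) * ℓ)) := by gcongr
        _ = Z := by
          rw [hZ, ← Real.exp_add, ← Real.exp_add, XSs, ← hKH]
          push_cast
          ring_nf)
  refine ⟨p, hp0, ?_⟩
  have hind : ∀ j ≤ J, X.V p ((2 * J - j) * r * X.L) (2 ^ j * S0) := by
    intro j
    induction j with
    | zero => intro _; simpa [hT] using hpV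
    | succ j ih =>
      intro hj
      have hV := ih (by omega)
      have eT : (2 * J - j) * r * X.L = (2 * J - (j + 1)) * r * X.L + r * X.L := by
        have : 2 * J - j = (2 * J - (j + 1)) + 1 := by omega
        rw [this]; ring
      rw [eT] at hV
      set S := 2 ^ j * S0 with hS
      have hSS : 2 ^ (j + 1) * S0 = 2 * S := by rw [hS, pow_succ]; ring
      rw [hSS]
      have hSS0 : S0 ≤ S := Nat.le_mul_of_pos_left _ (by positivity)
      have hSJ : 2 * S ≤ 2 ^ J * S0 := by
        rw [← hSS]
        exact Nat.mul_le_mul_right _ (Nat.pow_le_pow_right (by norm_num) hj)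
      have hSr : (S0:ℝ) ≤ S := by exact_mod_cast hSS0
      have hSJr : 2 * (S:ℝ) ≤ 2 ^ J * S0 := by exact_mod_cast hSJ
      set n : ℝ := r * X.L * S with hn
      have hn0 : (r:ℝ) * X.L * S0 ≤ n := by rw [hn]; gcongr
      set y : ℝ := X.L * S with hy
      have hyn : n = r * y := by rw [hn, hy]; ring
      have hny : 220 * (Real.log b + Real.log c + 2) * y ≤ n := by rw [hyn]; gcongr
      have hSy : (S:ℝ) ≤ y := by rw [hy]; exact le_mul_of_one_le_left (by positivity) hLr
      have hy1 : 1 ≤ y := by linarith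
      have hLS0y : (X.L:ℝ) * S0 ≤ y := by rw [hy]; gcongr
      have hb1y : 0 ≤ Real.log b * y := by positivity
      have hb2y : 0 ≤ Real.log c * y := by positivity
      have hlam2 : |X.lam| ≤ Real.exp (-(13 * n)) := by
        refine hlam.trans ?_
        rw [Real.exp_le_exp]
        have : n ≤ r * X.L * (2 ^ J * S0) := by
          rw [hn]; gcongr
          linarith
        push_cast [hS0] at this ⊢
        linarith
      have hny' : 440 * y ≤ n := by linarith
      have hKS : 2 * (X.K:ℝ) * (2 * S : ℕ) ≤ Real.exp n := by
        have : (X.K:ℝ) * S ≤ y := by rw [hy]; gcongr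
        have h2 := Real.add_one_le_exp n
        have e : 2 * (X.K:ℝ) * (2 * S : ℕ) = 4 * (X.K * S) := by push_cast; ring
        rw [e]
        linarith
      have hn1 : 440 ≤ n := by linarith
      have hCb : X.Cb = Real.log b + Real.log c + 2 := by unfold Cb; rw [Xb, Xc]
      have hexp1 : Real.exp (-1) < 1 / 2 := by
        have := Real.exp_neg_one_lt_d9
        linarith
      have hlamKS : 2 * X.K * (2 * S : ℕ) * |X.lam| ≤ Real.exp (-(12 * n)) := by
        calc _ ≤ Real.exp n * Real.exp (-(13 * n)) := by gcongr
          _ = _ := by rw [← Real.exp_add]; ring_nf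
      have hle1 : Real.exp (-(12 * n)) ≤ 1 := Real.exp_le_one_iff.2 (by linarith)
      refine X.step p H ((X.D * X.L ^ 2 * X.K : ℕ) * Z) (Real.exp (2 * ℓ)) ((2 * J - (j + 1)) * r * X.L) S (2 * S) (r * X.L)
        (by omega) (by omega) (by omega) (by omega) (by rw [XA]; exact hAh) (by rw [XB]; exact hBh) hHr hKH.le
        (hlam2.trans (Real.exp_le_one_iff.2 (by linarith))) ?_ (by omega) (by omega) (by omega)
        (Nat.mul_pos hr1 hL1) ?_ (by positivity) hpb hU1 hu1' hu2' hV ?_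
      · have := hlamKS.trans hle1
        have h0 : 0 ≤ (X.K:ℝ) * (2 * S : ℕ) * |X.lam| := by positivity
        have e : 2 * X.K * (2 * S : ℕ) * |X.lam| = 2 * ((X.K:ℝ) * (2 * S : ℕ) * |X.lam|) := by ring
        rw [e] at this
        linarith
      · have h1 : 2 * X.D ≤ r * X.L * S0 := by rw [← hDn0]; nlinarith
        exact h1.trans (Nat.mul_le_mul_left _ hSS0)
      · rw [← eT, hcard, hUpow, Xb, XSs, hCb]
        have hTj : (2 * J - j) * r * X.L ≤ T := by
          rw [hT]; gcongr; omega
        have hTjr : (((2 * J - j) * r * X.L : ℕ) : ℝ) ≤ T := by exact_mod_cast hTj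
        set T' := (2 * J - j) * r * X.L with hT'
        have hQ : X.Qb (2 * S) ≤ Real.exp (X.D * (602 * J + 1) + ℓ) := by
          have := X.Qb_le J (2 * S) hJ (by omega) (by rw [XSs]; exact hSJ)
          rwa [XSs] at this
        have hD2 : (X.D : ℝ) * 2 ^ X.D ≤ Real.exp (2 * X.D) := by
          have e1 := nat_le_exp X.D
          have e2 : (2:ℝ) ^ X.D ≤ Real.exp X.D := by
            have : (2:ℝ) ≤ Real.exp 1 := by have := Real.add_one_le_exp (1:ℝ); linarith
            calc (2:ℝ) ^ X.D ≤ (Real.exp 1) ^ X.D := by gcongr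
              _ = _ := by rw [← Real.exp_nat_mul]; ring_nf
          calc _ ≤ Real.exp X.D * Real.exp X.D := by gcongr
            _ = _ := by rw [← Real.exp_add]; ring_nf
        have hden : 6 * (ℓ:ℝ) * T' + H * (X.K * (2 * S : ℕ)) + Real.log b * (X.L * (2 * S : ℕ)) ≤
            6 * (T * ℓ) + 2 * y + 2 * (Real.log b * y) := by
          have e1 : (H:ℝ) * (X.K * (2 * S : ℕ)) = 2 * y := by rw [hy, ← hKH]; push_cast; ring
          have e2 : Real.log b * (X.L * (2 * S : ℕ)) = 2 * (Real.log b * y) := by rw [hy]; push_cast; ring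
          rw [e1, e2]
          have : 6 * (ℓ:ℝ) * T' ≤ 6 * ℓ * T := by gcongr
          linarith
        have hQ0' : 0 ≤ X.Qb (2 * S) := by unfold Qb; positivity
        set Et : ℝ := (6 * (T * ℓ) + 2 * y + 2 * (Real.log b * y)) + (4 * T + S0) + ((4 * T + S0) +
          (6 * (T * ℓ) + (Real.log b + Real.log c) * (X.L * S0) + X.L * S0 + (X.D * (602 * J + 1) + ℓ) + 4 * (T * ℓ)))
          + 2 * (T * ℓ) + 2 * X.D + (X.D * (602 * J + 1) + ℓ) with hEt
        have hEtb : Et + 18 * ((Real.log b + Real.log c + 2) * y) ≤ n / 5 := by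
          have e1 : (Real.log b + Real.log c) * (X.L * S0) ≤ (Real.log b + Real.log c) * y := by gcongr
          rw [hEt]
          have e2 : (T:ℝ) * ℓ ≤ n / 300 := by rw [hTℓ]; linarith
          have e3 : (X.D:ℝ) * J ≤ n / (1208 * 600) := by
            rw [hDr]; gcongr
          linarith
        have hbr : Real.exp (9 * ((Real.log b + Real.log c + 2) * X.L * (2 * S : ℕ)) - (r * X.L : ℕ) * S) +
          ((r * X.L : ℕ) + 1) * Real.exp (4 * (2 * S : ℕ) * (r * X.L : ℕ) + 2 * ((Real.log b + Real.log c + 2) * X.L * (2 * S : ℕ))) * (2 * X.K * (2 * S : ℕ) * |X.lam|)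
          ≤ Real.exp (18 * ((Real.log b + Real.log c + 2) * y) - n) + Real.exp (18 * ((Real.log b + Real.log c + 2) * y) - 3 * n) := by
          have e1 : 9 * ((Real.log b + Real.log c + 2) * X.L * (2 * S : ℕ)) - ((r * X.L : ℕ):ℝ) * S =
              18 * ((Real.log b + Real.log c + 2) * y) - n := by
            rw [hn, hy]; push_cast; ring
          have e2 : 4 * ((2 * S : ℕ):ℝ) * (r * X.L : ℕ) + 2 * ((Real.log b + Real.log c + 2) * X.L * (2 * S : ℕ)) =
              8 * n + 4 * ((Real.log b + Real.log c + 2) * y) := by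
            rw [hn, hy]; push_cast; ring
          have e3 : ((r * X.L : ℕ):ℝ) + 1 ≤ Real.exp n := by
            refine le_trans ?_ (Real.add_one_le_exp n)
            rw [hn]; push_cast
            have : (1:ℝ) ≤ S := by linarith
            have h2 : (r:ℝ) * X.L ≤ r * X.L * S := le_mul_of_one_le_right (by positivity) this
            linarith
          rw [e1, e2]
          gcongr
          calc _ ≤ Real.exp n * Real.exp (8 * n + 4 * ((Real.log b + Real.log c + 2) * y)) * Real.exp (-(12 * n)) := by gcongr
            _ = Real.exp (4 * ((Real.log b + Real.log c + 2) * y) - 3 * n) := by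
              rw [← Real.exp_add, ← Real.exp_add]; ring_nf
            _ ≤ _ := by
              gcongr
              norm_num
        calc _ ≤ Real.exp (6 * (T * ℓ) + 2 * y + 2 * (Real.log b * y)) *
            (Real.exp (4 * T + S0) * (Real.exp (4 * T + S0) * Z) * Real.exp (2 * (T * ℓ)) *
              (Real.exp (2 * X.D) * Real.exp (X.D * (602 * J + 1) + ℓ)) *
              (Real.exp (18 * ((Real.log b + Real.log c + 2) * y) - n) + Real.exp (18 * ((Real.log b + Real.log c + 2) * y) - 3 * n))) := by
              gcongr
          _ = Real.exp (Et + 18 * ((Real.log b + Real.log c + 2) * y) - n) +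
              Real.exp (Et + 18 * ((Real.log b + Real.log c + 2) * y) - 3 * n) := by
              rw [hZ, mul_add, mul_add]
              simp only [← Real.exp_add]
              rw [hEt]
              ring_nf
          _ ≤ Real.exp (-1) + Real.exp (-1) := by
              gcongr <;> linarith
          _ < 1 := by linarith
  have := hind J le_rfl
  have e : (2 * J - J) * r * X.L = J * r * X.L := by
    congr 2; omega
  rwa [e] at this

end BD


section P6a
open MvPolynomial

lemma phiAt_aeval_coeff {n : ℕ} (P : Fin n → ℝ) (i : Fin n) (q : Polynomial ℝ) (t : ℕ) :
    (phiAt P (Polynomial.aeval (X i : MvPolynomial (Fin n) ℝ) q)).coeff t =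
      C ((Polynomial.taylor (P i) q).coeff t) * X i ^ t := by
  have key : phiAt P (Polynomial.aeval (X i : MvPolynomial (Fin n) ℝ) q) =
      ((Polynomial.taylor (P i) q).map (C : ℝ →+* MvPolynomial (Fin n) ℝ)).comp
        (Polynomial.C (X i) * Polynomial.X) := by
    rw [← Polynomial.aeval_algHom_apply]
    have h1 : phiAt P (X i) = Polynomial.C (C (P i)) + Polynomial.C (X i) * Polynomial.X := by
      simp [phiAt]
    rw [h1]
    induction q using Polynomial.induction_on' with
    | add p q hp hq => simp [hp, hq]
    | monomial k a =>
      rw [Polynomial.taylor_monomial, Polynomial.aeval_monomial]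
      simp only [Polynomial.map_mul, Polynomial.map_pow, Polynomial.map_add, Polynomial.map_C,
        Polynomial.map_X, Polynomial.mul_comp, Polynomial.pow_comp, Polynomial.add_comp,
        Polynomial.C_comp, Polynomial.X_comp, Polynomial.algebraMap_apply, MvPolynomial.algebraMap_eq]
      rw [add_comm]
  rw [key, Polynomial.comp_C_mul_X_coeff, Polynomial.coeff_map]

/-- one term -/
noncomputable def mtm (c : ℝ) (a b : ℕ) (q : Polynomial ℝ) : MvPolynomial (Fin 3) ℝ :=
  C c * (X 0 ^ a * X 1 ^ b * Polynomial.aeval (X 2) q)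

lemma phiAt_mtm_coeff (P : Fin 3 → ℝ) (c : ℝ) (a b : ℕ) (q : Polynomial ℝ) (n : ℕ) :
    (phiAt P (mtm c a b q)).coeff n = ∑ u ∈ Finset.HasAntidiagonal.antidiagonal n, ∑ v ∈ Finset.HasAntidiagonal.antidiagonal u.1,
      C (c * ((P 0) ^ (a - v.1) * (a.choose v.1) * ((P 1) ^ (b - v.2) * (b.choose v.2)) *
        (Polynomial.hasseDeriv u.2 q).eval (P 2))) * (X 0 ^ v.1 * X 1 ^ v.2 * X 2 ^ u.2) := by
  have e0 : ∀ (i : Fin 3) (a : ℕ), (X i : MvPolynomial (Fin 3) ℝ) ^ a = Polynomial.aeval (X i) (Polynomial.X ^ a : Polynomial ℝ) := by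
    intro i a; simp
  have e1 : phiAt P (C c) = Polynomial.C (C c) := by simp [phiAt]
  unfold mtm
  rw [e0, e0, map_mul, e1, Polynomial.coeff_C_mul, map_mul, map_mul, Polynomial.coeff_mul, Finset.mul_sum]
  refine Finset.sum_congr rfl fun u _ => ?_
  rw [Polynomial.coeff_mul, Finset.sum_mul, Finset.mul_sum]
  refine Finset.sum_congr rfl fun v _ => ?_
  rw [phiAt_aeval_coeff, phiAt_aeval_coeff, phiAt_aeval_coeff, Polynomial.taylor_X_pow,
    Polynomial.taylor_X_pow, Polynomial.coeff_X_add_C_pow, Polynomial.coeff_X_add_C_pow, Polynomial.taylor_coeff]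
  simp only [map_mul]
  ring

lemma coeff_prod_top {R : Type*} [CommRing R] {ι : Type*} (s : Finset ι) (f : ι → Polynomial R) (d : ι → ℕ)
    (h : ∀ i ∈ s, (f i).natDegree ≤ d i) :
    (∏ i ∈ s, f i).natDegree ≤ ∑ i ∈ s, d i ∧
    (∏ i ∈ s, f i).coeff (∑ i ∈ s, d i) = ∏ i ∈ s, (f i).coeff (d i) := by
  classical
  induction s using Finset.induction_on with
  | empty => simp
  | insert a s ha ih =>
    have ih := ih fun i hi => h i (Finset.mem_insert_of_mem hi)
    have h1 := h a (Finset.mem_insert_self _ _)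
    rw [Finset.prod_insert ha, Finset.sum_insert ha, Finset.prod_insert ha]
    exact ⟨Polynomial.natDegree_mul_le_of_le h1 ih.1, by
      rw [Polynomial.coeff_mul_add_eq_of_natDegree_le h1 ih.1, ih.2]⟩

lemma det_ne_zero_of_top {R : Type*} [CommRing R] [IsDomain R] {r : ℕ}
    (f : Fin r → Fin r → Polynomial R) (P : Fin r → Polynomial R) (v : Fin r → ℕ → R)
    (hP : ∀ l, P l ≠ 0) (hf : ∀ i l j, (f i l).coeff j = (v l j) ^ (i : ℕ) * (P l).coeff j)
    (hv : ∀ l l', v l (P l).natDegree = v l' (P l').natDegree → l = l') :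
    (Matrix.of f).det ≠ 0 := by
  intro h0
  have hdeg : ∀ i l, (f i l).natDegree ≤ (P l).natDegree := by
    intro i l
    rw [Polynomial.natDegree_le_iff_coeff_eq_zero]
    intro N hN
    rw [hf, Polynomial.coeff_eq_zero_of_natDegree_lt hN, mul_zero]
  have h1 := congrArg (fun q => Polynomial.coeff q (∑ l, (P l).natDegree)) h0
  simp only [Matrix.det_apply, Polynomial.finsetSum_coeff, Polynomial.coeff_zero, Polynomial.coeff_smul] at h1
  have h2 : ∀ σ : Equiv.Perm (Fin r), (∏ l, Matrix.of f (σ l) l).coeff (∑ l, (P l).natDegree) =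
      ∏ l, (Matrix.of (fun i l => (P l).leadingCoeff * (Matrix.vandermonde (fun l => v l (P l).natDegree)).transpose i l)) (σ l) l := by
    intro σ
    refine ((coeff_prod_top Finset.univ _ _ (fun l _ => hdeg (σ l) l)).2).trans ?_
    refine Finset.prod_congr rfl fun l _ => ?_
    rw [hf]
    simp [Matrix.vandermonde_apply]
    ring
  simp only [h2] at h1
  rw [← Matrix.det_apply, Matrix.det_mul_row, Matrix.det_transpose] at h1
  rcases mul_eq_zero.1 h1 with h | h
  · rw [Finset.prod_eq_zero_iff] at h
    obtain ⟨l, _, hl⟩ := h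
    exact hP l (Polynomial.leadingCoeff_eq_zero.1 hl)
  · exact (Matrix.det_vandermonde_ne_zero_iff.2 (fun a b hab => hv a b hab)) h

lemma degreeOf_det {r n : ℕ} (M : Matrix (Fin r) (Fin r) (MvPolynomial (Fin n) ℝ)) (j : Fin n) (d : ℕ)
    (h : ∀ i l, degreeOf j (M i l) ≤ d) : degreeOf j M.det ≤ r * d := by
  rw [Matrix.det_apply]
  refine (degreeOf_sum_le _ _ _).trans (Finset.sup_le fun σ _ => ?_)
  have h1 : degreeOf j (∏ i, M (σ i) i) ≤ r * d := by
    refine (degreeOf_prod_le _ _ _).trans ?_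
    refine (Finset.sum_le_sum fun i _ => h (σ i) i).trans ?_
    simp
  rcases Int.units_eq_one_or (Equiv.Perm.sign σ) with hs | hs
  · rw [hs, one_smul]; exact h1
  · rw [hs]
    have : ((-1 : ℤˣ) • ∏ i, M (σ i) i) = C (-1) * ∏ i, M (σ i) i := by simp [Units.smul_def]
    rw [this]
    exact (degreeOf_C_mul_le _ _ _).trans h1

end P6a


section P6b
open MvPolynomial

lemma choose_poly (a : ℕ) : ∃ f : Polynomial ℝ, f.natDegree ≤ a ∧ ∀ u : ℕ, f.eval (u:ℝ) = (u.choose a : ℝ) := by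
  refine ⟨Polynomial.C ((a.factorial : ℝ)⁻¹) * descPochhammer ℝ a, ?_, ?_⟩
  · refine (Polynomial.natDegree_C_mul_le _ _).trans ?_
    rw [descPochhammer_natDegree]
  · intro u
    rw [Polynomial.eval_mul, Polynomial.eval_C, descPochhammer_eval_eq_descFactorial,
      Nat.descFactorial_eq_factorial_mul_choose]
    push_cast
    field_simp

noncomputable def mon3 (a b j : ℕ) : Fin 3 →₀ ℕ := Finsupp.single 0 a + Finsupp.single 1 b + Finsupp.single 2 j

lemma mon3_0 (a b j : ℕ) : mon3 a b j 0 = a := by simp [mon3]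
lemma mon3_1 (a b j : ℕ) : mon3 a b j 1 = b := by simp [mon3]
lemma mon3_2 (a b j : ℕ) : mon3 a b j 2 = j := by simp [mon3]

lemma mtm_eq (c : ℝ) (a b : ℕ) (q : Polynomial ℝ) :
    mtm c a b q = ∑ j ∈ Finset.range (q.natDegree + 1), monomial (mon3 a b j) (c * q.coeff j) := by
  unfold mtm
  rw [Polynomial.aeval_eq_sum_range, Finset.mul_sum, Finset.mul_sum]
  refine Finset.sum_congr rfl fun j _ => ?_
  rw [X_pow_eq_monomial, X_pow_eq_monomial, X_pow_eq_monomial, smul_monomial, monomial_mul, monomial_mul,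
    C_mul_monomial, mon3]
  simp

lemma mtm_coeff (c : ℝ) (a b : ℕ) (q : Polynomial ℝ) (a' b' j : ℕ) :
    coeff (mon3 a' b' j) (mtm c a b q) = if a = a' ∧ b = b' then c * q.coeff j else 0 := by
  rw [mtm_eq, coeff_sum]
  simp only [coeff_monomial]
  have hinj : ∀ i, (mon3 a b i = mon3 a' b' j) ↔ (a = a' ∧ b = b') ∧ i = j := by
    intro i
    constructor
    · intro h
      have h0 := DFunLike.congr_fun h 0
      have h1 := DFunLike.congr_fun h 1
      have h2 := DFunLike.congr_fun h 2
      simp only [mon3_0, mon3_1, mon3_2] at h0 h1 h2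
      exact ⟨⟨h0, h1⟩, h2⟩
    · rintro ⟨⟨h0, h1⟩, h2⟩
      rw [h0, h1, h2]
  simp only [hinj]
  by_cases hab : a = a' ∧ b = b'
  · simp only [hab, true_and, and_self, if_true]
    rw [Finset.sum_ite_eq' (Finset.range (q.natDegree + 1)) j]
    split_ifs with h
    · rfl
    · rw [Polynomial.coeff_eq_zero_of_natDegree_lt (by simpa using h), mul_zero]
  · simp [hab]

lemma mtm_degreeOf (c : ℝ) (a b : ℕ) (q : Polynomial ℝ) :
    degreeOf 0 (mtm c a b q) ≤ a ∧ degreeOf 1 (mtm c a b q) ≤ b ∧ degreeOf 2 (mtm c a b q) ≤ q.natDegree := by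
  have key : ∀ (i : Fin 3) (d : ℕ), (∀ j ≤ q.natDegree, mon3 a b j i ≤ d) → degreeOf i (mtm c a b q) ≤ d := by
    intro i d h
    rw [mtm_eq]
    refine (degreeOf_sum_le _ _ _).trans (Finset.sup_le fun j hj => ?_)
    refine le_trans ?_ (h j (by simpa [Nat.lt_succ_iff] using hj))
    rw [degreeOf_le_iff]
    intro m hm
    have := support_monomial_subset hm
    rw [Finset.mem_singleton] at this
    rw [this]
  exact ⟨key 0 a fun j _ => by rw [mon3_0], key 1 b fun j _ => by rw [mon3_1], key 2 _ fun j hj => by rw [mon3_2]; exact hj⟩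

lemma mtm_finSucc (c : ℝ) (a b : ℕ) (q : Polynomial ℝ) (j : ℕ) :
    (finSuccEquiv ℝ 2 (mtm c a b q)).coeff j =
      if j = a then C c * (X 0 ^ b * Polynomial.aeval (X 1 : MvPolynomial (Fin 2) ℝ) q) else 0 := by
  have e1 : finSuccEquiv ℝ 2 (X 1) = Polynomial.C (X 0) := finSuccEquiv_X_succ (j := 0)
  have e2 : finSuccEquiv ℝ 2 (X 2) = Polynomial.C (X 1) := finSuccEquiv_X_succ (j := 1)
  have e3 : finSuccEquiv ℝ 2 (Polynomial.aeval (X 2) q) = Polynomial.C (Polynomial.aeval (X 1 : MvPolynomial (Fin 2) ℝ) q) := by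
    induction q using Polynomial.induction_on' with
    | add p q hp hq => simp [hp, hq]
    | monomial k r =>
      simp only [Polynomial.aeval_monomial, MvPolynomial.algebraMap_eq, map_mul, map_pow, e2]
      simp [finSuccEquiv_apply]
  have e4 : finSuccEquiv ℝ 2 (C c) = Polynomial.C (C c) := by simp [finSuccEquiv_apply]
  have e5 : finSuccEquiv ℝ 2 (mtm c a b q) =
      Polynomial.C (C c * (X 0 ^ b * Polynomial.aeval (X 1 : MvPolynomial (Fin 2) ℝ) q)) * Polynomial.X ^ a := by
    unfold mtm
    simp only [map_mul, map_pow, e1, e3, e4, finSuccEquiv_X_zero]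
    ring
  rw [e5, Polynomial.coeff_C_mul_X_pow]

namespace BD

noncomputable def NN (X : BD) (p : X.I → ℤ) (i : ℕ) (l : Fin X.K) : MvPolynomial (Fin 3) ℝ :=
  ∑ x : X.I with x.2.2.2 = l, mtm (p x * (X.u1 x : ℝ) ^ i) x.2.1 x.2.2.1 (qF X.Ss x.1)

lemma NN_ne_zero (X : BD) (p : X.I → ℤ) (x : X.I) (hx : p x ≠ 0) : X.NN p 0 x.2.2.2 ≠ 0 := by
  classical
  obtain ⟨y, hy, hmax⟩ := Finset.exists_max_image (Finset.univ.filter fun y : X.I => y.2 = x.2 ∧ p y ≠ 0)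
    (fun y => (y.1 : ℕ)) ⟨x, by simp [hx]⟩
  simp only [Finset.mem_filter, Finset.mem_univ, true_and] at hy hmax
  intro h0
  have h1 := congrArg (coeff (mon3 y.2.1 y.2.2.1 y.1)) h0
  unfold NN at h1
  rw [coeff_sum, coeff_zero, Finset.sum_eq_single y] at h1
  · rw [mtm_coeff] at h1
    simp only [and_self, if_true, pow_zero, mul_one] at h1
    have h2 : (qF X.Ss y.1).coeff y.1 ≠ 0 := by
      have := qF_natDegree X.Ss y.1
      have h3 : (qF X.Ss y.1).leadingCoeff ≠ 0 := Polynomial.leadingCoeff_ne_zero.2 (qF_ne_zero _ _)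
      rwa [Polynomial.leadingCoeff, this] at h3
    rcases mul_eq_zero.1 h1 with h | h
    · exact hy.2 (by exact_mod_cast h)
    · exact h2 h
  · intro z hz hzy
    simp only [Finset.mem_filter, Finset.mem_univ, true_and] at hz
    rw [mtm_coeff]
    split_ifs with h
    · have hz2 : z.2 = y.2 := by
        refine Prod.ext (Fin.ext h.1) (Prod.ext (Fin.ext h.2) ?_)
        rw [hz, hy.1]
      by_cases hpz : p z = 0
      · simp [hpz]
      · have hle := hmax z ⟨by rw [hz2, hy.1], hpz⟩
        have hlt : (z.1:ℕ) < y.1 := by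
          refine lt_of_le_of_ne hle fun he => hzy (Prod.ext (Fin.ext he) hz2)
        rw [Polynomial.coeff_eq_zero_of_natDegree_lt (by rw [qF_natDegree]; exact hlt), mul_zero]
    · rfl
  · intro hn
    exact absurd (by simp [hy.1]) hn

lemma NN_degreeOf (X : BD) (p : X.I → ℤ) (i : ℕ) (l : Fin X.K) :
    degreeOf 0 (X.NN p i l) ≤ X.L ∧ degreeOf 1 (X.NN p i l) ≤ X.L ∧ degreeOf 2 (X.NN p i l) ≤ X.D := by
  unfold NN
  refine ⟨(degreeOf_sum_le _ _ _).trans (Finset.sup_le fun x _ => ?_),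
    (degreeOf_sum_le _ _ _).trans (Finset.sup_le fun x _ => ?_),
    (degreeOf_sum_le _ _ _).trans (Finset.sup_le fun x _ => ?_)⟩
  · exact (mtm_degreeOf _ _ _ _).1.trans x.2.1.2.le
  · exact (mtm_degreeOf _ _ _ _).2.1.trans x.2.2.1.2.le
  · refine (mtm_degreeOf _ _ _ _).2.2.trans ?_
    rw [qF_natDegree]; exact x.1.2.le

lemma NN_finSucc (X : BD) (p : X.I → ℤ) (i : ℕ) (l : Fin X.K) (j : ℕ) :
    (finSuccEquiv ℝ 2 (X.NN p i l)).coeff j =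
      (C (((j + X.m * l : ℕ)) : ℝ)) ^ i * (finSuccEquiv ℝ 2 (X.NN p 0 l)).coeff j := by
  unfold NN
  rw [map_sum, map_sum, Polynomial.finsetSum_coeff, Polynomial.finsetSum_coeff, Finset.mul_sum]
  refine Finset.sum_congr rfl fun x hx => ?_
  simp only [Finset.mem_filter, Finset.mem_univ, true_and] at hx
  rw [mtm_finSucc, mtm_finSucc]
  split_ifs with h
  · have : X.u1 x = j + X.m * l := by rw [u1, h, hx]
    rw [this]
    simp only [map_mul, map_pow, pow_zero]
    simp
    ring
  · simp

lemma NN_natDegree_lt (X : BD) (p : X.I → ℤ) (l : Fin X.K) (h : X.NN p 0 l ≠ 0) :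
    (finSuccEquiv ℝ 2 (X.NN p 0 l)).natDegree < X.L := by
  have h1 : (finSuccEquiv ℝ 2 (X.NN p 0 l)) ≠ 0 := by simpa using h
  have h2 := Polynomial.leadingCoeff_ne_zero.2 h1
  rw [Polynomial.leadingCoeff] at h2
  set d := (finSuccEquiv ℝ 2 (X.NN p 0 l)).natDegree
  unfold NN at h2
  rw [map_sum, Polynomial.finsetSum_coeff] at h2
  obtain ⟨x, _, hx⟩ := Finset.exists_ne_zero_of_sum_ne_zero h2
  rw [mtm_finSucc] at hx
  split_ifs at hx with hd
  · rw [hd]; exact x.2.1.2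
  · exact absurd rfl hx

lemma V_poly (X : BD) (p : X.I → ℤ) (T S : ℕ) (hV : X.V p T S) (s : ℕ) (hs : s < S) (t0 : ℕ)
    (f g : Polynomial ℝ) (h : t0 + f.natDegree + g.natDegree < T) :
    ∑ x, (p x : ℝ) * ((Polynomial.hasseDeriv t0 (qF X.Ss x.1)).eval (s:ℝ) * f.eval (X.u1 x : ℝ) *
      g.eval (X.u2 x : ℝ) * X.E x s) = 0 := by
  have : ∀ x : X.I, (p x : ℝ) * ((Polynomial.hasseDeriv t0 (qF X.Ss x.1)).eval (s:ℝ) * f.eval (X.u1 x : ℝ) *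
      g.eval (X.u2 x : ℝ) * X.E x s) = ∑ a ∈ Finset.range (f.natDegree + 1), ∑ b ∈ Finset.range (g.natDegree + 1),
        f.coeff a * g.coeff b * ((p x : ℝ) * X.term s t0 a b x) := by
    intro x
    rw [Polynomial.eval_eq_sum_range (p := f), Polynomial.eval_eq_sum_range (p := g)]
    simp only [Finset.mul_sum, Finset.sum_mul]
    rw [Finset.sum_comm]
    refine Finset.sum_congr rfl fun a _ => Finset.sum_congr rfl fun b _ => ?_
    unfold term
    ring
  simp only [this]
  rw [Finset.sum_comm]
  refine Finset.sum_eq_zero fun a ha => ?_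
  rw [Finset.sum_comm]
  refine Finset.sum_eq_zero fun b hb => ?_
  rw [Finset.mem_range] at ha hb
  rw [← Finset.mul_sum, hV s hs t0 a b (by omega), mul_zero]

lemma pow_sub_choose (P : ℝ) (hP : P ≠ 0) (u a : ℕ) :
    P ^ (u - a) * (u.choose a : ℝ) = (P ^ a)⁻¹ * P ^ u * u.choose a := by
  by_cases h : a ≤ u
  · rw [pow_sub₀ P hP h]; ring
  · rw [Nat.choose_eq_zero_of_lt (by omega)]; simp

/-- the full polynomial attached to the point `s` -/
noncomputable def GG (X : BD) (p : X.I → ℤ) (κ : ℝ) (i : ℕ) : MvPolynomial (Fin 3) ℝ :=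
  ∑ x : X.I, mtm (p x * (X.u1 x : ℝ) ^ i * κ ^ (x.2.2.2 : ℕ)) (X.u1 x) (X.u2 x) (qF X.Ss x.1)

lemma GG_dvd (X : BD) (p : X.I → ℤ) (T S : ℕ) (hV : X.V p T S) (s : ℕ) (hs : s < S) (i : ℕ) (κ : ℝ)
    (P : Fin 3 → ℝ) (h0 : P 0 ≠ 0) (h1 : P 1 ≠ 0) (h2 : P 2 = s)
    (hE : ∀ x : X.I, κ ^ (x.2.2.2 : ℕ) * P 0 ^ X.u1 x * P 1 ^ X.u2 x = X.E x s) :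
    (Polynomial.X : Polynomial (MvPolynomial (Fin 3) ℝ)) ^ (T - i) ∣ phiAt P (X.GG p κ i) := by
  rw [Polynomial.X_pow_dvd_iff]
  intro n hn
  unfold GG
  rw [map_sum, Polynomial.finsetSum_coeff]
  simp only [phiAt_mtm_coeff]
  rw [Finset.sum_comm]
  refine Finset.sum_eq_zero fun u hu => ?_
  rw [Finset.sum_comm]
  refine Finset.sum_eq_zero fun v hv => ?_
  rw [Finset.HasAntidiagonal.mem_antidiagonal] at hu hv
  rw [← Finset.sum_mul, ← map_sum]
  obtain ⟨f, hf, hf'⟩ := choose_poly v.1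
  obtain ⟨g, hg, hg'⟩ := choose_poly v.2
  have key := X.V_poly p T S hV s hs u.2 (Polynomial.X ^ i * f) g (by
    have := Polynomial.natDegree_mul_le (p := (Polynomial.X ^ i : Polynomial ℝ)) (q := f)
    rw [Polynomial.natDegree_X_pow] at this
    omega)
  have : ∑ x : X.I, (p x * (X.u1 x : ℝ) ^ i * κ ^ (x.2.2.2 : ℕ)) * ((P 0) ^ (X.u1 x - v.1) * ((X.u1 x).choose v.1) *
      ((P 1) ^ (X.u2 x - v.2) * ((X.u2 x).choose v.2)) *
        (Polynomial.hasseDeriv u.2 (qF X.Ss x.1)).eval (P 2)) = 0 := by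
    rw [← mul_zero (((P 0) ^ v.1)⁻¹ * ((P 1) ^ v.2)⁻¹), ← key, Finset.mul_sum]
    refine Finset.sum_congr rfl fun x _ => ?_
    rw [pow_sub_choose _ h0, pow_sub_choose _ h1, ← hE, h2, Polynomial.eval_mul, Polynomial.eval_pow,
      Polynomial.eval_X, hf', hg']
    ring
  rw [this]
  simp

end BD
end P6b


section P6c
open MvPolynomial

namespace BD

lemma GG_eq (X : BD) (p : X.I → ℤ) (κ : ℝ) (i : ℕ) :
    X.GG p κ i = ∑ l, X.NN p i l * (C (κ ^ (l:ℕ)) * (MvPolynomial.X 0 ^ (X.m * l) * MvPolynomial.X 1 ^ (X.k * l))) := by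
  classical
  unfold GG NN
  rw [← Finset.sum_fiberwise Finset.univ (fun x : X.I => x.2.2.2)]
  refine Finset.sum_congr rfl fun l _ => ?_
  rw [Finset.sum_mul]
  refine Finset.sum_congr rfl fun x hx => ?_
  simp only [Finset.mem_filter, Finset.mem_univ, true_and] at hx
  unfold mtm
  rw [← hx, u1, u2, pow_add, pow_add]
  simp only [map_mul]
  ring

lemma NN_eq_zero (X : BD) (p : X.I → ℤ) (i : ℕ) (l : Fin X.K) (h : ∀ x : X.I, x.2.2.2 = l → p x = 0) :
    X.NN p i l = 0 := by
  unfold NN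
  refine Finset.sum_eq_zero fun x hx => ?_
  simp only [Finset.mem_filter, Finset.mem_univ, true_and] at hx
  rw [h x hx]
  simp [mtm]

theorem wronskian (X : BD) (p : X.I → ℤ) (hp : p ≠ 0) (T S : ℕ) (hV : X.V p T S) (hm : X.L ≤ X.m)
    (P : ℕ → Fin 3 → ℝ) (h0 : ∀ s, P s 0 ≠ 0) (h1 : ∀ s, P s 1 ≠ 0) (h2 : ∀ s, P s 2 = s) (κ : ℕ → ℝ)
    (hκ : ∀ s, κ s ≠ 0)
    (hE : ∀ s, ∀ x : X.I, κ s ^ (x.2.2.2 : ℕ) * P s 0 ^ X.u1 x * P s 1 ^ X.u2 x = X.E x s) :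
    ∃ W : MvPolynomial (Fin 3) ℝ, W ≠ 0 ∧ degreeOf 0 W ≤ X.K * X.L ∧ degreeOf 1 W ≤ X.K * X.L ∧
      degreeOf 2 W ≤ X.K * X.D ∧ ∀ s < S, T - X.K ≤ ordAt (P s) W := by
  classical
  set Λ : Finset (Fin X.K) := Finset.univ.filter fun l => ∃ x : X.I, x.2.2.2 = l ∧ p x ≠ 0 with hΛ
  set r := Λ.card with hr
  have hrK : r ≤ X.K := by
    have := Finset.card_le_univ Λ
    simpa using this
  set g : Fin r → Fin X.K := fun a => Λ.orderEmbOfFin hr.symm a with hg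
  have hginj : Function.Injective g := (Λ.orderEmbOfFin hr.symm).injective
  have hgmem : ∀ a, ∃ x : X.I, x.2.2.2 = g a ∧ p x ≠ 0 := by
    intro a
    have : g a ∈ Λ := Finset.orderEmbOfFin_mem Λ hr.symm a
    simpa [hΛ] using this
  have hgne : ∀ a, X.NN p 0 (g a) ≠ 0 := by
    intro a
    obtain ⟨x, hx, hpx⟩ := hgmem a
    rw [← hx]
    exact X.NN_ne_zero p x hpx
  set N : Matrix (Fin r) (Fin r) (MvPolynomial (Fin 3) ℝ) := Matrix.of fun i a => X.NN p i (g a) with hN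
  have hW : N.det ≠ 0 := by
    intro hdet
    have h3 : (Matrix.of fun (i a : Fin r) => finSuccEquiv ℝ 2 (X.NN p i (g a))).det ≠ 0 := by
      refine det_ne_zero_of_top _ (fun a => finSuccEquiv ℝ 2 (X.NN p 0 (g a)))
        (fun a j => C (((j + X.m * (g a) : ℕ)) : ℝ)) ?_ ?_ ?_
      · intro a; simpa using hgne a
      · intro i a j; exact X.NN_finSucc p i (g a) j
      · intro a a' h
        have h := C_injective _ _ h
        have h : (finSuccEquiv ℝ 2 (X.NN p 0 (g a))).natDegree + X.m * (g a) =
          (finSuccEquiv ℝ 2 (X.NN p 0 (g a'))).natDegree + X.m * (g a') := by exact_mod_cast h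
        have d1 := X.NN_natDegree_lt p (g a) (hgne a)
        have d2 := X.NN_natDegree_lt p (g a') (hgne a')
        set e := (finSuccEquiv ℝ 2 (X.NN p 0 (g a))).natDegree
        set e' := (finSuccEquiv ℝ 2 (X.NN p 0 (g a'))).natDegree
        apply hginj
        apply Fin.ext
        have q1 : (e + X.m * (g a)) / X.m = g a := by
          rw [Nat.add_mul_div_left _ _ (by omega), Nat.div_eq_of_lt (by omega), zero_add]
        have q2 : (e' + X.m * (g a')) / X.m = g a' := by
          rw [Nat.add_mul_div_left _ _ (by omega), Nat.div_eq_of_lt (by omega), zero_add]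
        rw [← q1, ← q2, h]
    apply h3
    have h4 := (finSuccEquiv ℝ 2).toRingEquiv.toRingHom.map_det N
    rw [hdet, map_zero] at h4
    rw [h4]
    rfl
  have hdeg := fun i a => X.NN_degreeOf p i (g a)
  refine ⟨N.det, hW, ?_, ?_, ?_, ?_⟩
  · exact (degreeOf_det N 0 X.L fun i a => (hdeg i a).1).trans (Nat.mul_le_mul_right _ hrK)
  · exact (degreeOf_det N 1 X.L fun i a => (hdeg i a).2.1).trans (Nat.mul_le_mul_right _ hrK)
  · exact (degreeOf_det N 2 X.D fun i a => (hdeg i a).2.2).trans (Nat.mul_le_mul_right _ hrK)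
  intro s hs
  rw [le_ordAt_iff _ hW]
  set v : Fin X.K → MvPolynomial (Fin 3) ℝ := fun l =>
    C (κ s ^ (l:ℕ)) * (MvPolynomial.X 0 ^ (X.m * l) * MvPolynomial.X 1 ^ (X.k * l)) with hv
  have hNv : N.mulVec (fun a => v (g a)) = fun i : Fin r => X.GG p (κ s) i := by
    funext i
    rw [GG_eq]
    simp only [Matrix.mulVec, dotProduct, hN, Matrix.of_apply]
    have e1 : ∑ a : Fin r, X.NN p i (g a) * v (g a) = ∑ l ∈ Λ, X.NN p i l * v l := by
      rw [← Finset.map_orderEmbOfFin_univ Λ hr.symm, Finset.sum_map]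
      rfl
    rw [e1]
    apply Finset.sum_subset (Finset.subset_univ _)
    intro l _ hl
    rw [NN_eq_zero, zero_mul]
    intro x hx
    by_contra hpx
    exact hl (by simp only [hΛ, Finset.mem_filter, Finset.mem_univ, true_and]; exact ⟨x, hx, hpx⟩)
  obtain ⟨x0, hx0⟩ : ∃ x, p x ≠ 0 := by
    by_contra h
    push Not at h
    exact hp (funext h)
  have hrpos : 0 < r := Finset.card_pos.2 ⟨x0.2.2.2, by simp only [hΛ, Finset.mem_filter, Finset.mem_univ, true_and]; exact ⟨x0, rfl, hx0⟩⟩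
  have hadj : N.det • (fun a => v (g a)) = N.adjugate.mulVec (fun i : Fin r => X.GG p (κ s) i) := by
    rw [← hNv, Matrix.mulVec_mulVec, Matrix.adjugate_mul, Matrix.smul_mulVec, Matrix.one_mulVec]
  have hcomp := congrFun hadj ⟨0, hrpos⟩
  simp only [Pi.smul_apply, smul_eq_mul, Matrix.mulVec, dotProduct] at hcomp
  have hdvd : (Polynomial.X : Polynomial (MvPolynomial (Fin 3) ℝ)) ^ (T - X.K) ∣ phiAt (P s) (N.det * v (g ⟨0, hrpos⟩)) := by
    rw [hcomp, map_sum]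
    refine Finset.dvd_sum fun i _ => ?_
    rw [map_mul]
    refine Dvd.dvd.mul_left ?_ _
    refine dvd_trans (pow_dvd_pow _ ?_) (X.GG_dvd p T S hV s hs i (κ s) (P s) (h0 s) (h1 s) (h2 s) (hE s))
    have := i.2
    omega
  rw [map_mul] at hdvd
  refine Polynomial.prime_X.pow_dvd_of_dvd_mul_right _ ?_ hdvd
  intro hd
  rw [Polynomial.X_dvd_iff, phiAt_coeff_zero] at hd
  have := C_injective _ _ (hd.trans C_0.symm)
  simp only [hv, map_mul, map_pow, eval_C, eval_X] at this
  have hne : κ s ^ ((g ⟨0, hrpos⟩ : Fin X.K) : ℕ) * (P s 0 ^ (X.m * (g ⟨0, hrpos⟩ : Fin X.K)) * P s 1 ^ (X.k * (g ⟨0, hrpos⟩ : Fin X.K))) ≠ 0 :=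
    mul_ne_zero (pow_ne_zero _ (hκ s)) (mul_ne_zero (pow_ne_zero _ (h0 s)) (pow_ne_zero _ (h1 s)))
  exact hne this

theorem zero_est (X : BD) (p : X.I → ℤ) (hp : p ≠ 0) (T S : ℕ) (hV : X.V p T S) (hm : X.L ≤ X.m)
    (hb : 2 ≤ X.b) (hc : 2 ≤ X.c) (hA : 1 ≤ X.A) (hB : 1 ≤ X.B)
    (hirr : Irrational (Real.log X.b / Real.log X.c)) (hT : X.K ≤ T)
    (η : ℝ) (hη : 0 < η) (hη1 : η ≤ 1) (hS : 32 ≤ η ^ 4 * S) :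
    (S:ℝ) * (T - X.K) ≤ 4 * η * S * (X.K * X.L) + 68 / η ^ 3 * (X.K * X.D) := by
  have hb0 : (0:ℝ) < X.b := by exact_mod_cast (by omega : 0 < X.b)
  have hc0 : (0:ℝ) < X.c := by exact_mod_cast (by omega : 0 < X.c)
  have hA0 : (0:ℝ) < X.A := by exact_mod_cast (by omega : 0 < X.A)
  have hB0 : (0:ℝ) < X.B := by exact_mod_cast (by omega : 0 < X.B)
  have hlb : 0 < Real.log X.b := Real.log_pos (by exact_mod_cast (by omega : 1 < X.b))
  have hlc : 0 < Real.log X.c := Real.log_pos (by exact_mod_cast (by omega : 1 < X.c))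
  have hg : ∀ i j : ℤ, i * (-Real.log X.b) + j * Real.log X.c = 0 → i = 0 ∧ j = 0 := by
    intro i j h
    by_cases hi : i = 0
    · subst hi
      simp [hlc.ne'] at h
      exact ⟨rfl, h⟩
    · exfalso
      apply hirr
      refine ⟨(j:ℚ) / i, ?_⟩
      have hi' : (i:ℝ) ≠ 0 := by exact_mod_cast hi
      push_cast
      rw [div_eq_div_iff hi' hlc.ne']
      linarith
  have ep0 : ∀ s : ℕ, Real.exp (-Real.log X.b * s) = ((X.b:ℝ)⁻¹) ^ s := by
    intro s
    rw [mul_comm, Real.exp_nat_mul, Real.exp_neg, Real.exp_log hb0]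
  have ep1 : ∀ s : ℕ, Real.exp (Real.log X.c * s) = (X.c:ℝ) ^ s := by
    intro s
    rw [mul_comm, Real.exp_nat_mul, Real.exp_log hc0]
  have hα : ((X.A:ℝ) / X.B * X.b ^ X.m / X.c ^ X.k) ≠ 0 := by positivity
  obtain ⟨W, hW, d0, d1, d2, hord⟩ := X.wronskian p hp T S hV hm (pt3 (-Real.log X.b) (Real.log X.c))
    (fun s => by simp [pt3, Real.exp_ne_zero]) (fun s => by simp [pt3, Real.exp_ne_zero]) (fun s => by simp [pt3])
    (fun s => ((X.A:ℝ) / X.B * X.b ^ X.m / X.c ^ X.k) ^ s) (fun s => pow_ne_zero _ hα) (by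
      intro s x
      have q0 : pt3 (-Real.log X.b) (Real.log X.c) s 0 = ((X.b:ℝ)⁻¹) ^ s := by rw [← ep0]; simp [pt3]
      have q1 : pt3 (-Real.log X.b) (Real.log X.c) s 1 = (X.c:ℝ) ^ s := by rw [← ep1]; simp [pt3]
      rw [q0, q1, E, u1, u2]
      simp only [pow_add, mul_pow, div_pow, ← pow_mul, inv_pow]
      have r1 : X.m * s * (x.2.2.2:ℕ) = s * (X.m * x.2.2.2) := by ring
      have r2 : X.k * s * (x.2.2.2:ℕ) = s * (X.k * x.2.2.2) := by ring
      rw [r1, r2, mul_comm s (x.2.1:ℕ), mul_comm s (x.2.2.1:ℕ), mul_comm s (x.2.2.2:ℕ)]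
      field_simp)
  have hz := ZB3 (-Real.log X.b) (Real.log X.c) hg S η hη hη1 hS W hW
  have hl : (S:ℝ) * (T - X.K) ≤ ∑ s ∈ Finset.range S, (ordAt (pt3 (-Real.log X.b) (Real.log X.c) s) W : ℝ) := by
    have : ∀ s ∈ Finset.range S, ((T:ℝ) - X.K) ≤ (ordAt (pt3 (-Real.log X.b) (Real.log X.c) s) W : ℝ) := by
      intro s hs
      have := hord s (Finset.mem_range.1 hs)
      have h3 : ((T - X.K : ℕ):ℝ) ≤ (ordAt (pt3 (-Real.log X.b) (Real.log X.c) s) W : ℝ) := by exact_mod_cast this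
      rwa [Nat.cast_sub hT] at h3
    have := Finset.card_nsmul_le_sum _ _ _ this
    simpa using this
  refine hl.trans (hz.trans ?_)
  rw [Fin.sum_univ_three]
  simp only [Matrix.cons_val_zero, Matrix.cons_val_one, Matrix.cons_val]
  have d0' : (degreeOf 0 W : ℝ) ≤ X.K * X.L := by exact_mod_cast d0
  have d1' : (degreeOf 1 W : ℝ) ≤ X.K * X.L := by exact_mod_cast d1
  have d2' : (degreeOf 2 W : ℝ) ≤ X.K * X.D := by exact_mod_cast d2
  calc _ ≤ 2 * η * S * (X.K * X.L) + 2 * η * S * (X.K * X.L) + 68 / η ^ 3 * (X.K * X.D) := by gcongr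
    _ = _ := by ring

end BD
end P6c


namespace BD

lemma exists_J (r : ℕ) : ∃ J : ℕ, 2 ≤ J ∧ 272 * 16 ^ 4 * (16 * 1208 * 600 * (J:ℝ) ^ 4 * r ^ 2) ^ 3 < 2 ^ J ∧
    32 * (16 * 16 * 1208 * 600 * (J:ℝ) ^ 3 * r) ^ 4 ≤ 2 ^ J := by
  set Cst : ℝ := 272 * 16 ^ 4 * (16 * 1208 * 600 * (r:ℝ) ^ 2) ^ 3 + 32 * (16 * 16 * 1208 * 600 * (r:ℝ)) ^ 4 + 1 with hC
  have hCp : 0 < Cst := by positivity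
  have h := tendsto_pow_const_div_const_pow_of_one_lt 12 (one_lt_two : (1:ℝ) < 2)
  have h1 := (h.eventually_lt_const (show (0:ℝ) < 1 / Cst by positivity)).and (Filter.eventually_ge_atTop 2)
  obtain ⟨J, hJ, hJ2⟩ := h1.exists
  have hJp : (0:ℝ) < 2 ^ J := by positivity
  rw [div_lt_div_iff₀ hJp hCp, one_mul] at hJ
  have hJ12 : 0 ≤ (J:ℝ) ^ 12 := by positivity
  have x1 : 0 ≤ 272 * 16 ^ 4 * (16 * 1208 * 600 * (r:ℝ) ^ 2) ^ 3 * (J:ℝ) ^ 12 := by positivity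
  have x2 : 0 ≤ 32 * (16 * 16 * 1208 * 600 * (r:ℝ)) ^ 4 * (J:ℝ) ^ 12 := by positivity
  have e : (J:ℝ) ^ 12 * Cst = 272 * 16 ^ 4 * (16 * 1208 * 600 * (r:ℝ) ^ 2) ^ 3 * (J:ℝ) ^ 12 +
    32 * (16 * 16 * 1208 * 600 * (r:ℝ)) ^ 4 * (J:ℝ) ^ 12 + (J:ℝ) ^ 12 := by rw [hC]; ring
  rw [e] at hJ
  refine ⟨J, hJ2, ?_, ?_⟩
  · calc _ = 272 * 16 ^ 4 * (16 * 1208 * 600 * (r:ℝ) ^ 2) ^ 3 * (J:ℝ) ^ 12 := by ring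
      _ < _ := by linarith
  · calc _ = 32 * (16 * 16 * 1208 * 600 * (r:ℝ)) ^ 4 * (J:ℝ) ^ 12 := by ring
      _ ≤ _ := by linarith

theorem lower_bound (b c : ℕ) (hb : 2 ≤ b) (hc : 2 ≤ c) (hirr : Irrational (Real.log b / Real.log c)) :
    ∃ C : ℕ, 1 ≤ C ∧ ∀ m k A B H ℓ : ℕ, 1 ≤ A → 1 ≤ B → 1 ≤ H → 1 ≤ ℓ → Real.log A ≤ H → Real.log B ≤ H →
      C * H ≤ m → ((C * (m + k) : ℕ) : ℝ) ≤ Real.exp (2 * ℓ) →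
      Real.exp (-(C * H * ℓ)) < |Real.log (A / B) + m * Real.log b - k * Real.log c| := by
  have hβ1 : 0 ≤ Real.log b := Real.log_nonneg (by exact_mod_cast (by omega : 1 ≤ b))
  have hβ2 : 0 ≤ Real.log c := Real.log_nonneg (by exact_mod_cast (by omega : 1 ≤ c))
  obtain ⟨r, hr⟩ := exists_nat_ge (220 * (Real.log b + Real.log c + 2))
  have hr1 : 1 ≤ r := by
    have : (1:ℝ) ≤ r := by linarith
    exact_mod_cast this
  have hrr : (1:ℝ) ≤ r := by exact_mod_cast hr1
  obtain ⟨J, hJ, hJ1, hJ2⟩ := exists_J r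
  have hJr : (2:ℝ) ≤ J := by exact_mod_cast hJ
  set K := 16 * 1208 * 600 * J ^ 4 * r ^ 2 with hK
  have hK1 : 1 ≤ K := Nat.succ_le_of_lt (by positivity)
  refine ⟨13 * r * K * 2 ^ J * 600 * J + K + 1, by omega, ?_⟩
  intro m k A B H ℓ hA hB hH hℓ hAh hBh hCm hexp
  by_contra hcon
  push Not at hcon
  set X : BD := mk' b c m k A B r J H ℓ with hX
  have Xb : X.b = b := rfl
  have Xc : X.c = c := rfl
  have XA : X.A = A := rfl
  have XB : X.B = B := rfl
  have Xm : X.m = m := rfl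
  have Xk : X.k = k := rfl
  have XL : X.L = K * H := rfl
  have XD : X.D = 2 * (2 * J * r) ^ 3 * H * (600 * J * ℓ) := rfl
  have XK : X.K = K := rfl
  have hLm : X.L ≤ m := by
    rw [XL]
    refine le_trans ?_ hCm
    exact Nat.mul_le_mul_right _ (by omega)
  have hu : ∀ u : ℕ, u ≤ m + k → ((X.L + u * X.K : ℕ) : ℝ) ≤ Real.exp (2 * ℓ) := by
    intro u hu
    refine le_trans ?_ hexp
    have : X.L + u * X.K ≤ (13 * r * K * 2 ^ J * 600 * J + K + 1) * (m + k) := by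
      rw [XK]
      calc X.L + u * K ≤ (m + k) + (m + k) * K := Nat.add_le_add (by omega) (Nat.mul_le_mul_right _ hu)
        _ = (K + 1) * (m + k) := by ring
        _ ≤ _ := Nat.mul_le_mul_right _ (by omega)
    exact_mod_cast this
  have hHℓ : (0:ℝ) ≤ H * ℓ := by positivity
  obtain ⟨p, hp, hV⟩ := aux_exists b c m k A B r J H ℓ hb hc hA hB (by omega) hH hℓ hr hAh hBh X hX
    (hu m (by omega)) (hu k (by omega)) (by
      have e : X.lam = Real.log (A / B) + m * Real.log b - k * Real.log c := rfl
      rw [e]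
      refine hcon.trans ?_
      rw [Real.exp_le_exp, XL]
      push_cast
      have : ((13 * r * K * 2 ^ J * 600 * J + K + 1 : ℝ)) * H * ℓ = 13 * (r * (K * H) * (2 ^ J * (600 * J * ℓ))) + (K + 1) * (H * ℓ) := by ring
      rw [this]
      have : (0:ℝ) ≤ (K + 1) * (H * ℓ) := by positivity
      linarith)
  have hKr : (1:ℝ) ≤ K := by exact_mod_cast hK1
  have hKeq : (K:ℝ) = 16 * 1208 * 600 * J ^ 4 * r ^ 2 := by rw [hK]; push_cast; ring
  have hHr : (1:ℝ) ≤ H := by exact_mod_cast hH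
  have hℓr : (1:ℝ) ≤ ℓ := by exact_mod_cast hℓ
  have hKJr : (K:ℝ) = (16 * 1208 * 600 * J ^ 3 * r) * (J * r) := by rw [hKeq]; ring
  have hJr0 : (0:ℝ) < J * r := by positivity
  set Q : ℝ := 16 * 1208 * 600 * J ^ 3 * r with hQ
  have hQ1 : 1 ≤ Q := by
    have : (1:ℝ) ≤ J ^ 3 * r := one_le_mul_of_one_le_of_one_le (one_le_pow₀ (by linarith)) hrr
    rw [hQ]; linarith
  have hT : X.K ≤ J * r * X.L := by
    rw [XK, XL]
    calc K = 1 * (K * 1) := by ring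
      _ ≤ J * r * (K * H) := Nat.mul_le_mul (Nat.mul_pos (by omega) hr1) (Nat.mul_le_mul_left _ hH)
  have hz := X.zero_est p hp (J * r * X.L) (2 ^ J * (600 * J * ℓ)) hV hLm hb hc hA hB hirr hT
    (1 / (16 * Q)) (by positivity) (by rw [div_le_one (by positivity)]; linarith) (by
      have e1 : 32 * (16 * Q) ^ 4 ≤ 2 ^ J := by
        refine le_trans (le_of_eq ?_) hJ2
        rw [hQ]; ring
      have e2 : (1:ℝ) ≤ 600 * J * ℓ := by nlinarith
      push_cast
      rw [div_pow, one_pow, div_mul_eq_mul_div, one_mul, le_div_iff₀ (by positivity)]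
      refine e1.trans ?_
      exact le_mul_of_one_le_right (by positivity) e2)
  rw [XK, XD, XL] at hz
  push_cast at hz
  set S0 : ℝ := 600 * J * ℓ with hS0
  have hS0p : 0 < S0 := by positivity
  have h2J : (0:ℝ) < 2 ^ J := by positivity
  have hKH : (K:ℝ) ≤ K * H := le_mul_of_one_le_right (by positivity) hHr
  have hJ2r : (2:ℝ) ≤ J * r := by nlinarith
  have hTK : (J * r * (K * H) : ℝ) / 2 ≤ J * r * (K * H) - K := by
    have : 2 * (K * H : ℝ) ≤ J * r * (K * H) := by gcongr
    linarith
  have hl : 2 ^ J * S0 * ((J * r * (K * H) : ℝ) / 2) ≤ 2 ^ J * S0 * (J * r * (K * H) - K) := by gcongr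
  have e3 : 4 * (1 / (16 * Q)) * (2 ^ J * S0) * (K * (K * H)) = 2 ^ J * S0 * ((J * r * (K * H)) / 4) := by
    have : (K:ℝ) / Q = J * r := by rw [hKJr]; field_simp
    rw [← this]; field_simp; norm_num
  have e4 : 68 / (1 / (16 * Q)) ^ 3 * (K * (2 * (2 * J * r) ^ 3 * H * S0)) = 68 * 16 ^ 4 * (K:ℝ) ^ 3 * (K * H) * S0 := by
    have : (K:ℝ) ^ 3 = Q ^ 3 * (J * r) ^ 3 := by rw [hKJr]; ring
    rw [this]; field_simp; ring
  rw [e3, e4] at hz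
  have h5 := hl.trans hz
  have h6 : S0 * (K * H) * (2 ^ J * (J * r)) ≤ S0 * (K * H) * (272 * 16 ^ 4 * (K:ℝ) ^ 3) := by linarith
  have h7 : (2:ℝ) ^ J * (J * r) ≤ 272 * 16 ^ 4 * (K:ℝ) ^ 3 := le_of_mul_le_mul_left h6 (by positivity)
  have h8 : (2:ℝ) ^ J ≤ 2 ^ J * (J * r) := le_mul_of_one_le_right (by positivity) (by linarith)
  rw [hKeq] at h7
  linarith

end BD

lemma digSum_step (b : ℕ) (hb : 2 ≤ b) (x : ℕ) : digSum b x = x % b + digSum b (x / b) := by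
  unfold digSum
  rcases Nat.eq_zero_or_pos x with h | h
  · subst h; simp
  · rw [Nat.digits_def' (by omega) h]; simp

lemma digSum_div (b : ℕ) (hb : 2 ≤ b) (t : ℕ) : ∀ x, digSum b (x / b ^ t) ≤ digSum b x ∧
    (x % b ^ t ≠ 0 → digSum b (x / b ^ t) + 1 ≤ digSum b x) := by
  induction t with
  | zero => intro x; simp [Nat.mod_one]
  | succ t ih =>
    intro x
    have h1 := ih (x / b)
    rw [Nat.div_div_eq_div_mul] at h1
    have h2 := digSum_step b hb x
    rw [pow_succ', Nat.mod_mul]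
    refine ⟨by omega, fun h => ?_⟩
    by_cases h3 : x / b % b ^ t = 0
    · rw [h3] at h
      simp at h
      omega
    · have := h1.2 h3
      omega

lemma base_step (b n : ℕ) (hb : 2 ≤ b) (hn : 1 ≤ n) (θ θ' : ℝ) (h0 : 0 ≤ θ) (h1 : θ ≤ θ') (h2 : θ' ≤ Real.log n)
    (m m' : ℕ) (hm : m = ⌊(Real.log n - θ) / Real.log b⌋₊) (hm' : m' = ⌊(Real.log n - θ') / Real.log b⌋₊) :
    digSum b (n / b ^ m) ≤ digSum b (n / b ^ m') ∧
    (digSum b (n / b ^ m) + 1 ≤ digSum b (n / b ^ m') ∨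
      (0 ≤ Real.log n - Real.log (n / b ^ m : ℕ) - m * Real.log b ∧
        Real.log n - Real.log (n / b ^ m : ℕ) - m * Real.log b ≤ b * Real.exp (θ - θ'))) ∧
    1 ≤ n / b ^ m ∧ Real.log (n / b ^ m : ℕ) ≤ θ + Real.log b ∧ (m:ℝ) * Real.log b ≤ Real.log n - θ ∧
    Real.log n - θ < (m + 1) * Real.log b := by
  have hb0 : (0:ℝ) < b := by exact_mod_cast (by omega : 0 < b)
  have hlb : 0 < Real.log b := Real.log_pos (by exact_mod_cast (by omega : 1 < b))
  have hn0 : (0:ℝ) < n := by exact_mod_cast hn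
  have a1 : (m:ℝ) * Real.log b ≤ Real.log n - θ := by
    rw [← le_div_iff₀ hlb, hm]
    exact Nat.floor_le (div_nonneg (by linarith) hlb.le)
  have a1' : (m':ℝ) * Real.log b ≤ Real.log n - θ' := by
    rw [← le_div_iff₀ hlb, hm']
    exact Nat.floor_le (div_nonneg (by linarith) hlb.le)
  have a2 : Real.log n - θ < (m + 1) * Real.log b := by
    rw [← div_lt_iff₀ hlb, hm]
    exact Nat.lt_floor_add_one _
  have hmm : m' ≤ m := by
    rw [hm, hm']
    exact Nat.floor_le_floor (by gcongr)
  have hbm : b ^ m ≤ n := by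
    have : ((b ^ m : ℕ) : ℝ) ≤ n := by
      push_cast
      rw [← Real.log_le_log_iff (by positivity) hn0, Real.log_pow]
      linarith
    exact_mod_cast this
  have hbp : 0 < b ^ m := by positivity
  have hA1 : 1 ≤ n / b ^ m := (Nat.one_le_div_iff hbp).2 hbm
  have hAr : (1:ℝ) ≤ (n / b ^ m : ℕ) := by exact_mod_cast hA1
  have hAle : ((n / b ^ m : ℕ) : ℝ) * (b:ℝ) ^ m ≤ n := by exact_mod_cast Nat.div_mul_le_self n (b ^ m)
  have hlogA : Real.log (n / b ^ m : ℕ) + m * Real.log b ≤ Real.log n := by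
    rw [← Real.log_pow, ← Real.log_mul (by positivity) (by positivity)]
    exact Real.log_le_log (by positivity) hAle
  have hdd : n / b ^ m = n / b ^ m' / b ^ (m - m') := by
    rw [Nat.div_div_eq_div_mul, ← pow_add]
    congr 2; omega
  have hds := digSum_div b hb (m - m') (n / b ^ m')
  rw [← hdd] at hds
  refine ⟨hds.1, ?_, hA1, by nlinarith, a1, a2⟩
  by_cases hz : n / b ^ m' % b ^ (m - m') = 0
  · right
    refine ⟨by linarith, ?_⟩
    have hmod : n % b ^ m = n % b ^ m' := by
      have : b ^ m = b ^ m' * b ^ (m - m') := by rw [← pow_add]; congr 1; omega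
      rw [this, Nat.mod_mul, hz]; simp
    have hR : n % b ^ m < b ^ m' := by rw [hmod]; exact Nat.mod_lt _ (by positivity)
    have hRr : ((n % b ^ m : ℕ) : ℝ) ≤ (b:ℝ) ^ m' := by exact_mod_cast hR.le
    have hsum : (n:ℝ) = ((n / b ^ m : ℕ) : ℝ) * (b:ℝ) ^ m + (n % b ^ m : ℕ) := by
      exact_mod_cast (Nat.div_add_mod' n (b ^ m)).symm
    set A : ℝ := ((n / b ^ m : ℕ) : ℝ)
    set R : ℝ := ((n % b ^ m : ℕ) : ℝ)
    have hAb : 0 < A * (b:ℝ) ^ m := by positivity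
    have e1 : Real.log n - Real.log A - m * Real.log b = Real.log (n / (A * (b:ℝ) ^ m)) := by
      rw [Real.log_div (by positivity) (by positivity), Real.log_mul (by positivity) (by positivity), Real.log_pow]
      ring
    rw [e1]
    calc Real.log (n / (A * (b:ℝ) ^ m)) ≤ n / (A * (b:ℝ) ^ m) - 1 := Real.log_le_sub_one_of_pos (by positivity)
      _ = R / (A * (b:ℝ) ^ m) := by
        rw [hsum]; field_simp; ring
      _ ≤ (b:ℝ) ^ m' / (1 * (b:ℝ) ^ m) := by gcongr
      _ = Real.exp (m' * Real.log b - m * Real.log b) := by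
        rw [one_mul, Real.exp_sub, Real.exp_nat_mul, Real.exp_nat_mul, Real.exp_log hb0]
      _ ≤ Real.exp (Real.log b + (θ - θ')) := by
        rw [Real.exp_le_exp]; linarith
      _ = _ := by rw [Real.exp_add, Real.exp_log hb0]
  · left
    exact hds.2 hz

theorem digits_many (b c : ℕ) (hb : 2 ≤ b) (hc : 2 ≤ c) (hirr : Irrational (Real.log b / Real.log c)) :
    ∃ G C : ℕ, 2 ≤ G ∧ 1 ≤ C ∧ ∀ n ℓ I : ℕ, 1 ≤ n → 1 ≤ ℓ → (4 * C : ℝ) ≤ Real.log n →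
      Real.log (Real.log n) ≤ ℓ → ((G * ℓ : ℕ) : ℝ) ^ I ≤ Real.log n → I ≤ digSum b n + digSum c n := by
  obtain ⟨C, hC, hmain⟩ := BD.lower_bound b c hb hc hirr
  have hb0 : (0:ℝ) < b := by exact_mod_cast (by omega : 0 < b)
  have hc0 : (0:ℝ) < c := by exact_mod_cast (by omega : 0 < c)
  have hlb2 : Real.log 2 ≤ Real.log b := Real.log_le_log (by norm_num) (by exact_mod_cast hb)
  have hlc2 : Real.log 2 ≤ Real.log c := Real.log_le_log (by norm_num) (by exact_mod_cast hc)
  have hl2 := Real.log_two_gt_d9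
  obtain ⟨β, hβ⟩ := exists_nat_ge (Real.log b + Real.log c + Real.log (b + c))
  have hlbc : 0 ≤ Real.log ((b:ℝ) + c) := Real.log_nonneg (by
    have : (2:ℝ) ≤ b := by exact_mod_cast hb
    linarith)
  have hCr : (1:ℝ) ≤ C := by exact_mod_cast hC
  have hβ0 : (0:ℝ) ≤ β := by positivity
  refine ⟨C * (1 + β) * (1 + β) + (1 + β), C, ?_, hC, ?_⟩
  · have : 1 ≤ C * (1 + β) * (1 + β) := Nat.succ_le_of_lt (by positivity)
    omega
  intro n ℓ I hn hℓ hy4 hlly hI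
  set y := Real.log n with hy
  set G := C * (1 + β) * (1 + β) + (1 + β) with hG
  have hGr : (G:ℝ) = C * (1 + β) * (1 + β) + (1 + β) := by rw [hG]; push_cast; ring
  have hG1 : 1 ≤ G := by omega
  have hGℓ : 1 ≤ G * ℓ := Nat.mul_pos hG1 hℓ
  have hℓr : (1:ℝ) ≤ ℓ := by exact_mod_cast hℓ
  have hy0 : 0 < y := by linarith
  set θ : ℕ → ℕ := fun i => (G * ℓ) ^ i with hθ
  have hθ1 : ∀ i, 1 ≤ θ i := fun i => Nat.one_le_pow _ _ hGℓ
  have hθmono : ∀ i j, i ≤ j → θ i ≤ θ j := fun i j h => Nat.pow_le_pow_right hGℓ h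
  have hθI : ∀ i ≤ I, (θ i : ℝ) ≤ y := by
    intro i hi
    have h1 : (θ i : ℝ) ≤ θ I := by exact_mod_cast hθmono i I hi
    refine h1.trans ?_
    simpa [hθ] using hI
  set f : ℕ → ℕ := fun i => digSum b (n / b ^ ⌊(y - θ i) / Real.log b⌋₊) + digSum c (n / c ^ ⌊(y - θ i) / Real.log c⌋₊) with hf
  have hstep : ∀ i, i + 1 ≤ I → f i + 1 ≤ f (i + 1) := by
    intro i hi
    have t1 : (0:ℝ) ≤ θ i := by positivity
    have t2 : (θ i : ℝ) ≤ θ (i + 1) := by exact_mod_cast hθmono i (i+1) (by omega)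
    have t3 := hθI (i + 1) hi
    have t4 : (θ (i + 1) : ℝ) = G * ℓ * θ i := by
      simp only [hθ]; push_cast; ring
    have t5 : (1:ℝ) ≤ θ i := by exact_mod_cast hθ1 i
    obtain ⟨b1, b2, b3, b4, b5, b6⟩ := base_step b n hb hn (θ i) (θ (i+1)) t1 t2 t3 _ _ rfl rfl
    obtain ⟨c1, c2, c3, c4, c5, c6⟩ := base_step c n hc hn (θ i) (θ (i+1)) t1 t2 t3 _ _ rfl rfl
    rw [← hy] at b1 b2 b3 b4 b5 b6 c1 c2 c3 c4 c5 c6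
    simp only [hf]
    rcases b2 with b2 | b2
    · omega
    rcases c2 with c2 | c2
    · omega
    exfalso
    set m := ⌊(y - θ i) / Real.log b⌋₊ with hm
    set k := ⌊(y - θ i) / Real.log c⌋₊ with hk
    have hθℓ : (θ i : ℝ) ≤ ℓ * θ i := le_mul_of_one_le_left (by positivity) hℓr
    have key := hmain m k (n / b ^ m) (n / c ^ k) ((1 + β) * θ i) ℓ b3 c3 (Nat.mul_pos (by omega) (hθ1 i)) hℓ
      (by
        push_cast
        have : (β:ℝ) ≤ β * θ i := le_mul_of_one_le_right hβ0 t5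
        linarith)
      (by
        push_cast
        have : (β:ℝ) ≤ β * θ i := le_mul_of_one_le_right hβ0 t5
        linarith)
      (by
        have : ((C * ((1 + β) * θ i) : ℕ) : ℝ) < (m + 1 : ℕ) := by
          push_cast
          have hlb : 0 < Real.log b := by linarith
          have q1 : (C * ((1 + β) * θ i) : ℝ) * Real.log b ≤ y - θ i := by
            have q2 : (C * ((1 + β) * θ i) : ℝ) * Real.log b ≤ (C * ((1 + β) * θ i) : ℝ) * (1 + β) := by
              gcongr; linarith
            have q3 : (C * ((1 + β) * θ i) : ℝ) * (1 + β) + θ i ≤ G * θ i := by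
              rw [hGr]
              have : 0 ≤ (β:ℝ) * θ i := by positivity
              linarith
            have q4 : (G * θ i : ℝ) ≤ G * ℓ * θ i := by
              rw [mul_assoc]; gcongr
            linarith
          have q5 := q1.trans_lt b6
          exact lt_of_mul_lt_mul_right q5 hlb.le
        have : C * ((1 + β) * θ i) < m + 1 := by exact_mod_cast this
        omega)
      (by
        have m2 : (m:ℝ) ≤ 2 * y := by
          have : (m:ℝ) * (1/2) ≤ m * Real.log b := by gcongr; linarith
          linarith
        have k2 : (k:ℝ) ≤ 2 * y := by
          have : (k:ℝ) * (1/2) ≤ k * Real.log c := by gcongr; linarith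
          linarith
        push_cast
        have ey : y ≤ Real.exp ℓ := by rwa [← Real.log_le_iff_le_exp hy0]
        calc (C:ℝ) * (m + k) ≤ C * (2 * y + 2 * y) := by gcongr
          _ = (4 * C) * y := by ring
          _ ≤ y * y := by gcongr
          _ ≤ Real.exp ℓ * Real.exp ℓ := by gcongr
          _ = _ := by rw [← Real.exp_add]; ring_nf)
    have hAp : (0:ℝ) < (n / b ^ m : ℕ) := by exact_mod_cast b3
    have hBp : (0:ℝ) < (n / c ^ k : ℕ) := by exact_mod_cast c3
    rw [Real.log_div hAp.ne' hBp.ne'] at key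
    have hup : |Real.log (n / b ^ m : ℕ) - Real.log (n / c ^ k : ℕ) + m * Real.log b - k * Real.log c| ≤
        (b + c) * Real.exp (θ i - θ (i + 1)) := by
      have hx : 0 < Real.exp ((θ i : ℝ) - θ (i + 1)) := Real.exp_pos _
      have hx1 : 0 < (b:ℝ) * Real.exp ((θ i : ℝ) - θ (i + 1)) := by positivity
      have hx2 : 0 < (c:ℝ) * Real.exp ((θ i : ℝ) - θ (i + 1)) := by positivity
      rw [add_mul, abs_le]
      constructor <;> linarith [b2.1, b2.2, c2.1, c2.2]
    have hlow : ((b:ℝ) + c) * Real.exp (θ i - θ (i + 1)) ≤ Real.exp (-(C * ((1 + β) * θ i : ℕ) * ℓ)) := by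
      rw [← Real.exp_log (show (0:ℝ) < b + c by positivity), ← Real.exp_add, Real.exp_le_exp, t4, hGr]
      push_cast
      have w1 : (C * (1 + β) * (1 + β) + (1 + β) : ℝ) * ℓ * θ i = C * ((1 + β) * θ i) * ℓ +
        β * (C * ((1 + β) * θ i) * ℓ) + ℓ * θ i + β * (ℓ * θ i) := by ring
      have w2 : 0 ≤ (β:ℝ) * (C * ((1 + β) * θ i) * ℓ) := by positivity
      have w3 : (β:ℝ) ≤ β * (ℓ * θ i) := le_mul_of_one_le_right hβ0 (by linarith)
      rw [w1]
      linarith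
    exact absurd key (not_lt.2 (hup.trans hlow))
  have hind : ∀ i ≤ I, i ≤ f i := by
    intro i
    induction i with
    | zero => intro _; exact Nat.zero_le _
    | succ i ih =>
      intro hi
      have := ih (by omega)
      have := hstep i hi
      omega
  have h1 := hind I le_rfl
  have h2 := (digSum_div b hb ⌊(y - θ I) / Real.log b⌋₊ n).1
  have h3 := (digSum_div c hc ⌊(y - θ I) / Real.log c⌋₊ n).1
  simp only [hf] at h1
  omega

theorem digit_sum_lower_bound (b c : ℕ) (hb : 2 ≤ b) (hc : 2 ≤ c)
    (hirr : Irrational (Real.log b / Real.log c)) :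
    ∃ d : ℝ, ∀ n : ℕ, 25 < n →
      ((digSum b n + digSum c n : ℕ) : ℝ) >
        Real.log (Real.log n) / (Real.log (Real.log (Real.log n)) + d) - 1 := by
  obtain ⟨G, C, hG, hC, hmain⟩ := digits_many b c hb hc hirr
  have hGr : (2:ℝ) ≤ G := by exact_mod_cast hG
  have hCr : (1:ℝ) ≤ C := by exact_mod_cast hC
  refine ⟨Real.log (2 * G) + Real.log (4 * C), ?_⟩
  intro n hn
  have hd1 : 0 < Real.log (2 * G) := Real.log_pos (by linarith)
  have hd2 : 0 < Real.log (4 * C) := Real.log_pos (by linarith)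
  have hn0 : (0:ℝ) < n := by exact_mod_cast (by omega : 0 < n)
  have hn26 : (26:ℝ) ≤ n := by exact_mod_cast hn
  have he := Real.exp_one_lt_d9
  have hy3 : 3 ≤ Real.log n := by
    rw [Real.le_log_iff_exp_le hn0]
    have : Real.exp 3 = Real.exp 1 ^ 3 := by rw [← Real.exp_nat_mul]; norm_num
    rw [this]
    calc Real.exp 1 ^ 3 ≤ 2.7182818286 ^ 3 := by gcongr
      _ ≤ 26 := by norm_num
      _ ≤ n := hn26
  set y := Real.log n with hy
  have hy0 : 0 < y := by linarith
  have hly : 1 < Real.log y := by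
    rw [Real.lt_log_iff_exp_lt hy0]; linarith
  have hlly : 0 < Real.log (Real.log y) := Real.log_pos hly
  set den := Real.log (Real.log y) + (Real.log (2 * G) + Real.log (4 * C)) with hden
  have hden0 : 0 < den := by linarith
  by_cases hbig : 4 * (C:ℝ) ≤ y
  · set ℓ := ⌈Real.log y⌉₊ with hℓ
    have hℓ1 : 1 ≤ ℓ := Nat.ceil_pos.2 (by linarith)
    have hℓle : Real.log y ≤ ℓ := Nat.le_ceil _
    have hℓlt : (ℓ:ℝ) < Real.log y + 1 := Nat.ceil_lt_add_one (by linarith)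
    have hℓr : (1:ℝ) ≤ ℓ := by exact_mod_cast hℓ1
    have hGℓ2 : (2:ℝ) ≤ (G * ℓ : ℕ) := by
      push_cast
      calc (2:ℝ) = 2 * 1 := by norm_num
        _ ≤ G * ℓ := by gcongr
    have hlG : 0 < Real.log (G * ℓ : ℕ) := Real.log_pos (by linarith)
    have hlGle : Real.log (G * ℓ : ℕ) ≤ den := by
      have : Real.log (G * ℓ : ℕ) ≤ Real.log ((2 * G) * Real.log y) := by
        refine Real.log_le_log (by linarith) ?_
        push_cast
        calc (G:ℝ) * ℓ ≤ G * (2 * Real.log y) := by gcongr; linarith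
          _ = _ := by ring
      rw [Real.log_mul (by positivity) (by positivity)] at this
      linarith
    set I := ⌊Real.log y / Real.log (G * ℓ : ℕ)⌋₊ with hI
    have hI1 : (I:ℝ) * Real.log (G * ℓ : ℕ) ≤ Real.log y := by
      rw [← le_div_iff₀ hlG]
      exact Nat.floor_le (by positivity)
    have hI2 : Real.log y / Real.log (G * ℓ : ℕ) < I + 1 := Nat.lt_floor_add_one _
    have hpow : ((G * ℓ : ℕ) : ℝ) ^ I ≤ y := by
      rw [← Real.log_le_log_iff (by positivity) hy0, Real.log_pow]
      exact hI1
    have := hmain n ℓ I (by omega) hℓ1 hbig hℓle hpow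
    have h1 : (I:ℝ) ≤ (digSum b n + digSum c n : ℕ) := by exact_mod_cast this
    have h2 : Real.log y / den ≤ Real.log y / Real.log (G * ℓ : ℕ) := by gcongr
    linarith
  · push Not at hbig
    have h1 : Real.log y < den := by
      have := Real.log_lt_log hy0 hbig
      linarith
    have h2 : Real.log y / den < 1 := by rwa [div_lt_one hden0]
    have h3 : (0:ℝ) ≤ (digSum b n + digSum c n : ℕ) := by positivity
    linarith
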